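/- For every integer b ≥ 2 and every ε ∈ {−1, 1}, there exist real numbers v_2, …, v_b and three polynomials f, g, k ∈ P^b_ε whose ordered critical values are (v_1(f), v_2, …, v_b), (v_1(g), v_2, …, v_b) and (v_1(k), v_2, …, v_b) respectively, with v_1(f) < v_1(g) < v_1(k), such that h_top(g) < h_top(f) and h_top(g) < h_top(k). In particular, with v_2, …, v_b kept fixed, the map sending the first critical value v_1 to the topological entropy of the corresponding polynomial is not monotone. -/

import Mathlib

/-- Topological entropy of a self-map of `ℝ`, computed on the interval `[-1,1]`. -/
noncomputable def htop (f : ℝ → ℝ) : EReal := Dynamics.coverEntropy f (Set.Icc (-1) 1)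

/-- Evaluation of the polynomial with coefficient vector `a`. -/
noncomputable def evalP {n : ℕ} (a : Fin n → ℝ) (x : ℝ) : ℝ := ∑ i, a i * x ^ (i : ℕ)

/-- The family `P^b_ε`: polynomials of degree `b+1` (encoded by their coefficient vectors
`a : Fin (b+2) → ℝ`, carrying the product, i.e. coefficient, topology), mapping `[-1,1]`
into itself, with `f(-1) = ε`, `f(1) ∈ {-1,1}`, and exactly `b` distinct critical
points, all in `(-1,1)`. -/
def PolyFam (b : ℕ) (ε : ℝ) : Set (Fin (b + 2) → ℝ) :=
  {a | a (Fin.last (b + 1)) ≠ 0 ∧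
    Set.MapsTo (evalP a) (Set.Icc (-1) 1) (Set.Icc (-1) 1) ∧
    evalP a (-1) = ε ∧ (evalP a 1 = -1 ∨ evalP a 1 = 1) ∧
    ∃ c : Fin b → ℝ, StrictMono c ∧ (∀ i, c i ∈ Set.Ioo (-1 : ℝ) 1) ∧
      ∀ x : ℝ, deriv (evalP a) x = 0 ↔ ∃ i, c i = x}


/-- `a` has ordered critical values `v`: the critical points of the polynomial `a`,
listed in increasing order as `c 0 < c 1 < … < c (b-1)`, have images `v 0, …, v (b-1)`.
(Index `i : Fin b` corresponds to the paper's `v_{i+1}`.) -/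
def HasCritValues {b : ℕ} (a : Fin (b + 2) → ℝ) (v : Fin b → ℝ) : Prop :=
  ∃ c : Fin b → ℝ, StrictMono c ∧ (∀ i, c i ∈ Set.Ioo (-1 : ℝ) 1) ∧
    (∀ x : ℝ, deriv (evalP a) x = 0 ↔ ∃ i, c i = x) ∧ ∀ i, evalP a (c i) = v i

open Set Filter Topology Dynamics

/-- A continuous self-map of `[-1,1]` with finite fibres and finitely many turning points. -/
structure FiniteLapMap (f : ℝ → ℝ) : Prop where
  cont : Continuous f
  maps : MapsTo f (Icc (-1) 1) (Icc (-1) 1)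
  fin : ∀ y, {x ∈ Icc (-1 : ℝ) 1 | f x = y}.Finite
  cut : ∃ C : Set ℝ, C.Finite ∧ ∀ u ∈ Icc (-1 : ℝ) 1, ∀ v ∈ Icc (-1 : ℝ) 1, u < v → f u = f v →
    ∃ c ∈ C, u < c ∧ c < v

/-- The points of `[-1,1]` sent to `y` by the `n`-th iterate. -/
def iterFibre (f : ℝ → ℝ) (n : ℕ) (y : ℝ) : Set ℝ := {x ∈ Icc (-1 : ℝ) 1 | f^[n] x = y}

lemma FiniteLapMap.iterFibre_finite {f : ℝ → ℝ} (hf : FiniteLapMap f) (n : ℕ) (y : ℝ) :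
    (iterFibre f n y).Finite := by
  induction n generalizing y with
  | zero =>
    refine (Set.finite_singleton y).subset ?_
    rintro x ⟨_, hx⟩
    simpa using hx
  | succ n ih =>
    refine ((ih y).biUnion (fun z _ => hf.fin z)).subset ?_
    rintro x ⟨hxI, hx⟩
    simp only [mem_iUnion]
    refine ⟨f x, ⟨hf.maps hxI, ?_⟩, hxI, rfl⟩
    simpa [Function.iterate_succ_apply] using hx

lemma FiniteLapMap.iterate_cut {f : ℝ → ℝ} (hf : FiniteLapMap f) (N : ℕ) :
    ∃ C : Set ℝ, C.Finite ∧ ∀ u ∈ Icc (-1 : ℝ) 1, ∀ v ∈ Icc (-1 : ℝ) 1, u < v →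
      f^[N] u = f^[N] v → ∃ c ∈ C, u < c ∧ c < v := by
  induction N with
  | zero =>
    refine ⟨∅, finite_empty, fun u _ v _ huv h => ?_⟩
    simp at h
    exact absurd h huv.ne
  | succ N ih =>
    obtain ⟨C, hC, hcut⟩ := ih
    obtain ⟨C', hC', hcut'⟩ := hf.cut
    refine ⟨C' ∪ ⋃ s ∈ C, {x ∈ Icc (-1 : ℝ) 1 | f x = s},
      hC'.union (hC.biUnion fun s _ => hf.fin s), fun u hu v hv huv h => ?_⟩
    rcases eq_or_ne (f u) (f v) with heq | hne
    · obtain ⟨c, hc, h1, h2⟩ := hcut' u hu v hv huv heq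
      exact ⟨c, Or.inl hc, h1, h2⟩
    · simp only [Function.iterate_succ_apply] at h
      have key : ∃ s ∈ C, s ∈ f '' Ioo u v := by
        rcases hne.lt_or_gt with hlt | hlt
        · obtain ⟨s, hs, h1, h2⟩ := hcut _ (hf.maps hu) _ (hf.maps hv) hlt h
          exact ⟨s, hs, intermediate_value_Ioo huv.le hf.cont.continuousOn ⟨h1, h2⟩⟩
        · obtain ⟨s, hs, h1, h2⟩ := hcut _ (hf.maps hv) _ (hf.maps hu) hlt h.symm
          exact ⟨s, hs, intermediate_value_Ioo' huv.le hf.cont.continuousOn ⟨h1, h2⟩⟩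
      obtain ⟨s, hs, t, ht, rfl⟩ := key
      refine ⟨t, Or.inr ?_, ht.1, ht.2⟩
      simp only [mem_iUnion]
      exact ⟨f t, hs, ⟨hu.1.trans ht.1.le, ht.2.le.trans hv.2⟩, rfl⟩

/-- Finite sets meeting every long interval can be chosen off a countable set. -/
lemma exists_finite_grid {B : Set ℝ} (hB : B.Countable) {δ : ℝ} (hδ : 0 < δ) :
    ∃ G : Set ℝ, G.Finite ∧ G ⊆ Icc (-1) 1 \ B ∧
      ∀ x ∈ Icc (-1 : ℝ) 1, ∀ y ∈ Icc (-1 : ℝ) 1, x + δ ≤ y → ∃ g ∈ G, x < g ∧ g < y := by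
  have htb : TotallyBounded (Icc (-1 : ℝ) 1 \ B) :=
    (isCompact_Icc.totallyBounded).subset sdiff_subset
  obtain ⟨G, hGs, hG, hcov⟩ :=
    (totallyBounded_iff_subset.1 htb) _ (Metric.dist_mem_uniformity (show 0 < δ / 4 by positivity))
  refine ⟨G, hG, hGs, fun x hx y hy hxy => ?_⟩
  obtain ⟨z, hz1, hz2⟩ := (hB.dense_compl ℝ).exists_between
    (show (x + y) / 2 - δ / 4 < (x + y) / 2 + δ / 4 by linarith)
  have hzI : z ∈ Icc (-1 : ℝ) 1 \ B :=
    ⟨⟨by linarith [hz2.1, hx.1], by linarith [hz2.2, hy.2]⟩, hz1⟩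
  have := hcov hzI
  simp only [mem_iUnion, mem_ofPred_eq] at this
  obtain ⟨g, hg, hd⟩ := this
  change dist z g < δ / 4 at hd
  rw [Real.dist_eq, abs_lt] at hd
  exact ⟨g, hg, by linarith [hz2.1], by linarith [hz2.2]⟩

lemma FiniteLapMap.iterate_mem {f : ℝ → ℝ} (hf : FiniteLapMap f) (n : ℕ) {x : ℝ}
    (hx : x ∈ Icc (-1 : ℝ) 1) : f^[n] x ∈ Icc (-1 : ℝ) 1 := hf.maps.iterate n hx

/-- The preimages of a fine grid form a dynamical cover. -/
lemma FiniteLapMap.isDynCoverOf_preimages {f : ℝ → ℝ} (hf : FiniteLapMap f) {δ : ℝ}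
    {G : Set ℝ} (hG : G.Finite)
    (hgrid : ∀ x ∈ Icc (-1 : ℝ) 1, ∀ y ∈ Icc (-1 : ℝ) 1, x + δ ≤ y → ∃ g ∈ G, x < g ∧ g < y)
    (n : ℕ) :
    IsDynCoverOf f (Icc (-1) 1) {p : ℝ × ℝ | dist p.1 p.2 < δ} n
      (insert (-1) (⋃ j ∈ Finset.range n, ⋃ g ∈ G, iterFibre f j g)) := by
  intro x hx
  set S : Set ℝ := insert (-1) (⋃ j ∈ Finset.range n, ⋃ g ∈ G, iterFibre f j g) with hS
  have hSfin : S.Finite := by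
    refine Set.Finite.insert _ ?_
    exact (Finset.finite_toSet _).biUnion fun j _ => hG.biUnion fun g _ => hf.iterFibre_finite j g
  have hne : (S ∩ Iic x).Nonempty := ⟨-1, mem_insert _ _, hx.1⟩
  obtain ⟨s, hs, hmax⟩ := Set.exists_max_image (S ∩ Iic x) id (hSfin.inter_of_left _) hne
  have hsI : s ∈ Icc (-1 : ℝ) 1 := by
    refine ⟨hmax (-1) ⟨mem_insert _ _, hx.1⟩, hs.2.trans hx.2⟩
  refine ⟨s, hs.1, ?_⟩
  rw [mem_dynEntourage]
  intro j hj
  by_contra hcon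
  simp only [mem_ofPred_eq, not_lt, Real.dist_eq] at hcon
  have hxj := hf.iterate_mem j hx
  have hsj := hf.iterate_mem j hsI
  have hsx : s ≤ x := hs.2
  have key : ∃ g ∈ G, g ∈ f^[j] '' Ioo s x := by
    rcases le_abs.1 hcon with h | h
    · obtain ⟨g, hg, h1, h2⟩ := hgrid _ hsj _ hxj (by linarith)
      exact ⟨g, hg, intermediate_value_Ioo hsx (hf.cont.iterate j).continuousOn ⟨h1, h2⟩⟩
    · obtain ⟨g, hg, h1, h2⟩ := hgrid _ hxj _ hsj (by linarith)
      exact ⟨g, hg, intermediate_value_Ioo' hsx (hf.cont.iterate j).continuousOn ⟨h1, h2⟩⟩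
  obtain ⟨g, hg, t, ht, htg⟩ := key
  have htS : t ∈ S := by
    refine mem_insert_of_mem _ ?_
    simp only [mem_iUnion, Finset.mem_range]
    exact ⟨j, hj, g, hg, ⟨hsI.1.trans ht.1.le, ht.2.le.trans hx.2⟩, htg⟩
  exact absurd (hmax t ⟨htS, ht.2.le⟩) (not_le.2 ht.1)

lemma FiniteLapMap.htop_le {f : ℝ → ℝ} (hf : FiniteLapMap f) {B : Set ℝ} (hB : B.Countable)
    {C μ : ℝ} (hμ : 1 < μ)
    (hcount : ∀ y ∈ Icc (-1 : ℝ) 1 \ B, ∀ n, ((iterFibre f n y).ncard : ℝ) ≤ C * μ ^ n) :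
    htop f ≤ (Real.log μ : ℝ) := by
  rw [htop, coverEntropy_eq_iSup_basis Metric.uniformity_basis_dist]
  refine iSup₂_le fun δ hδ => ?_
  obtain ⟨G, hG, hGB, hgrid⟩ := exists_finite_grid hB hδ
  set K : ℝ := 1 + (G.ncard : ℝ) * (C / (μ - 1)) with hK
  have hμ0 : 0 < μ - 1 := by linarith
  have hcard : ∀ n, coverMincard f (Icc (-1) 1) {p : ℝ × ℝ | dist p.1 p.2 < δ} n ≤
      ((insert (-1) (⋃ j ∈ Finset.range n, ⋃ g ∈ G, iterFibre f j g) : Set ℝ).ncard : ℕ∞) := by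
    intro n
    have hfin : (insert (-1) (⋃ j ∈ Finset.range n, ⋃ g ∈ G, iterFibre f j g) : Set ℝ).Finite :=
      Set.Finite.insert _ ((Finset.finite_toSet _).biUnion fun j _ =>
        hG.biUnion fun g _ => hf.iterFibre_finite j g)
    have h := hf.isDynCoverOf_preimages hG hgrid n
    rw [Set.ncard_eq_toFinset_card _ hfin]
    refine IsDynCoverOf.coverMincard_le_card ?_
    simpa using h
  have hncard : ∀ n, ((insert (-1) (⋃ j ∈ Finset.range n, ⋃ g ∈ G, iterFibre f j g) :
      Set ℝ).ncard : ℝ) ≤ (max K 0) * μ ^ n := by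
    intro n
    have hpow : (1 : ℝ) ≤ μ ^ n := one_le_pow₀ hμ.le
    have hC : ∀ g ∈ G, 0 ≤ C := fun g hg => by
      have := hcount g (hGB hg) 0
      simp only [pow_zero, mul_one] at this
      exact le_trans (Nat.cast_nonneg _) this
    have h1 : ((insert (-1) (⋃ j ∈ Finset.range n, ⋃ g ∈ G, iterFibre f j g) : Set ℝ).ncard : ℝ)
        ≤ 1 + ∑ j ∈ Finset.range n, ∑ g ∈ hG.toFinset, ((iterFibre f j g).ncard : ℝ) := by
      have ha := Set.ncard_insert_le (-1 : ℝ) (⋃ j ∈ Finset.range n, ⋃ g ∈ G, iterFibre f j g)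
      have hb : (⋃ j ∈ Finset.range n, ⋃ g ∈ G, iterFibre f j g).ncard ≤
          ∑ j ∈ Finset.range n, ∑ g ∈ hG.toFinset, (iterFibre f j g).ncard := by
        refine (Finset.set_ncard_biUnion_le _ _).trans (Finset.sum_le_sum fun j _ => ?_)
        have := Finset.set_ncard_biUnion_le hG.toFinset (fun g => iterFibre f j g)
        simpa using this
      have hc := ha.trans (Nat.add_le_add_right hb 1)
      rw [add_comm]
      exact_mod_cast hc
    have h2 : ∑ j ∈ Finset.range n, ∑ g ∈ hG.toFinset, ((iterFibre f j g).ncard : ℝ) ≤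
        ∑ j ∈ Finset.range n, (G.ncard : ℝ) * (C * μ ^ j) := by
      refine Finset.sum_le_sum fun j _ => ?_
      have : ∑ g ∈ hG.toFinset, ((iterFibre f j g).ncard : ℝ) ≤ ∑ g ∈ hG.toFinset, C * μ ^ j :=
        Finset.sum_le_sum fun g hg => hcount g (hGB (hG.mem_toFinset.1 hg)) j
      rw [Finset.sum_const, nsmul_eq_mul, ← Set.ncard_eq_toFinset_card _ hG] at this
      exact this
    have h3 : ∑ j ∈ Finset.range n, (G.ncard : ℝ) * (C * μ ^ j) =
        (G.ncard : ℝ) * (C / (μ - 1)) * (μ ^ n - 1) := by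
      rw [← Finset.mul_sum, ← Finset.mul_sum, geom_sum_eq hμ.ne']
      ring
    have h4 : 0 ≤ (G.ncard : ℝ) * (C / (μ - 1)) := by
      rcases G.eq_empty_or_nonempty with rfl | ⟨g, hg⟩
      · simp
      · exact mul_nonneg (Nat.cast_nonneg _) (div_nonneg (hC g hg) hμ0.le)
    calc _ ≤ 1 + (G.ncard : ℝ) * (C / (μ - 1)) * (μ ^ n - 1) := by linarith
      _ ≤ K * μ ^ n := by rw [hK]; nlinarith
      _ ≤ max K 0 * μ ^ n := by gcongr; exact le_max_left _ _
  have hgrow : coverEntropyEntourage f (Icc (-1) 1) {p : ℝ × ℝ | dist p.1 p.2 < δ} ≤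
      ExpGrowth.expGrowthSup (fun n => ENNReal.ofReal μ ^ n) := by
    refine ExpGrowth.expGrowthSup_le_of_eventually_le (b := ENNReal.ofReal (max K 0))
      ENNReal.ofReal_ne_top (Eventually.of_forall fun n => ?_)
    rw [← ENNReal.ofReal_pow (by linarith), ← ENNReal.ofReal_mul (le_max_right _ _)]
    refine le_trans (ENat.toENNReal_mono (hcard n)) ?_
    rw [ENat.toENNReal_coe, ← ENNReal.ofReal_natCast]
    exact ENNReal.ofReal_le_ofReal (hncard n)
  rw [ExpGrowth.expGrowthSup_pow] at hgrow
  refine hgrow.trans (le_of_eq ?_)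
  rw [ENNReal.log_ofReal_of_pos (by linarith)]

/-- Within a dynamical ball, points of a fibre are separated by their itinerary relative to the
cuts; hence a cover controls the size of the fibre. -/
lemma FiniteLapMap.ncard_iterFibre_le {f : ℝ → ℝ} (hf : FiniteLapMap f) (N : ℕ) (hN : N ≠ 0) :
    ∃ δ > 0, ∀ (n : ℕ) (y : ℝ) (s : Finset ℝ),
      IsDynCoverOf f (Icc (-1) 1) {p : ℝ × ℝ | dist p.1 p.2 < δ} (N * n) s →
      (iterFibre f (N * n) y).ncard ≤ 3 ^ n * s.card := by
  obtain ⟨C, hC, hcut⟩ := hf.iterate_cut N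
  obtain ⟨δ, hδ, hsep⟩ : ∃ δ > 0, ∀ c ∈ C, ∀ d ∈ C, dist c d < 2 * δ → c = d := by
    have h : ∀ᶠ δ : ℝ in 𝓝[>] 0, ∀ p ∈ C.offDiag, 2 * δ ≤ dist p.1 p.2 := by
      rw [Filter.eventually_all_finite hC.offDiag]
      intro p hp
      have hpos : 0 < dist p.1 p.2 := dist_pos.2 hp.2.2
      filter_upwards [Ioo_mem_nhdsGT (show (0 : ℝ) < dist p.1 p.2 / 2 by positivity)] with δ hδ
      linarith [hδ.2]
    obtain ⟨δ, h1, h2⟩ := (h.and self_mem_nhdsWithin).exists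
    refine ⟨δ, h2, fun c hc d hd hcd => ?_⟩
    by_contra hne
    exact absurd (h1 (c, d) ⟨hc, hd, hne⟩) (not_le.2 hcd)
  refine ⟨δ, hδ, fun n y s hs => ?_⟩
  choose! σ hσs hσ using fun x (hx : x ∈ Icc (-1 : ℝ) 1) => hs hx
  have hfinF := hf.iterFibre_finite (N * n) y
  classical
  let κ : ℝ → ℕ → ℝ := fun t i =>
    if h : ∃ c ∈ C, dist c (f^[N * i] t) < δ then h.choose else 0
  let code : ℝ → ℝ × (Fin n → SignType) := fun x =>
    (σ x, fun i => SignType.sign (f^[N * i] x - κ (σ x) i))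
  have hinj : InjOn code (iterFibre f (N * n) y) := by
    rintro x ⟨hx, hxy⟩ x' ⟨hx', hxy'⟩ hcode
    have h1 : σ x = σ x' := congrArg Prod.fst hcode
    have h2 : ∀ i : Fin n, SignType.sign (f^[N * i] x - κ (σ x) i) =
        SignType.sign (f^[N * i] x' - κ (σ x) i) := fun i => by
      have := congrFun (congrArg Prod.snd hcode) i
      simpa [code, ← h1] using this
    have hball : ∀ z ∈ Icc (-1 : ℝ) 1, ∀ i < n, dist (f^[N * i] z) (f^[N * i] (σ z)) < δ := by
      intro z hz i hi
      have := (mem_dynEntourage.1 (hσ z hz)) (N * i) (by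
        exact Nat.mul_lt_mul_of_pos_left hi (Nat.pos_of_ne_zero hN))
      exact this
    have hstep : ∀ u ∈ Icc (-1 : ℝ) 1, ∀ v ∈ Icc (-1 : ℝ) 1, ∀ i : Fin n,
        dist u (f^[N * i] (σ x)) < δ → dist v (f^[N * i] (σ x)) < δ →
        SignType.sign (u - κ (σ x) i) = SignType.sign (v - κ (σ x) i) →
        f^[N] u = f^[N] v → ¬ u < v := by
      intro u hu v hv i hdu hdv hsgn hfuv huv
      obtain ⟨c, hc, hc1, hc2⟩ := hcut u hu v hv huv hfuv
      have hcd : dist c (f^[N * i] (σ x)) < δ := by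
        rw [Real.dist_eq, abs_lt] at *
        constructor <;> linarith [hdu.1, hdv.2]
      have hex : ∃ c ∈ C, dist c (f^[N * i] (σ x)) < δ := ⟨c, hc, hcd⟩
      have hκ : κ (σ x) i = c := by
        have : κ (σ x) i = hex.choose := by simp only [κ]; rw [dif_pos hex]
        rw [this]
        refine hsep _ hex.choose_spec.1 _ hc ?_
        have := dist_triangle_right hex.choose c (f^[N * i] (σ x))
        linarith [hex.choose_spec.2]
      rw [hκ, sign_neg (by linarith), sign_pos (by linarith)] at hsgn
      exact absurd hsgn (by decide)
    have hdown : ∀ j ≤ n, f^[N * (n - j)] x = f^[N * (n - j)] x' := by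
      intro j
      induction j with
      | zero => intro _; simp [hxy, hxy']
      | succ j ih =>
        intro hj
        have ih := ih (by omega)
        have hi : n - (j + 1) < n := by omega
        have hsucc : N * (n - j) = N + N * (n - (j + 1)) := by
          have : n - j = n - (j + 1) + 1 := by omega
          rw [this]; ring
        rw [hsucc, Function.iterate_add_apply, Function.iterate_add_apply] at ih
        have hu := hf.iterate_mem (N * (n - (j + 1))) hx
        have hv := hf.iterate_mem (N * (n - (j + 1))) hx'
        have hdu := hball x hx _ hi
        have hdv := hball x' hx' _ hi
        rw [← h1] at hdv
        have hs := h2 ⟨_, hi⟩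
        exact le_antisymm (not_lt.1 (hstep _ hv _ hu ⟨_, hi⟩ hdv hdu hs.symm ih.symm))
          (not_lt.1 (hstep _ hu _ hv ⟨_, hi⟩ hdu hdv hs ih))
    simpa using hdown n le_rfl
  have hmap : MapsTo code (iterFibre f (N * n) y) (↑(s ×ˢ (Finset.univ : Finset (Fin n → SignType)))) := by
    rintro x ⟨hx, _⟩
    simpa [code] using hσs x hx
  have := Set.ncard_le_ncard_of_injOn code hmap hinj (Finset.finite_toSet _)
  rw [Set.ncard_coe_finset, Finset.card_product, Finset.card_univ] at this
  have h3 : Fintype.card SignType = 3 := rfl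
  simpa [mul_comm, h3] using this

lemma FiniteLapMap.le_htop {f : ℝ → ℝ} (hf : FiniteLapMap f) {c μ y : ℝ} (hc : 0 < c)
    (hμ : 1 < μ) (hcount : ∀ n, c * μ ^ n ≤ ((iterFibre f n y).ncard : ℝ)) :
    (Real.log μ : ℝ) ≤ htop f := by
  have hN : ∀ N : ℕ, N ≠ 0 → ((Real.log μ - Real.log 3 / N : ℝ) : EReal) ≤ htop f := by
    intro N hN
    obtain ⟨δ, hδ, h⟩ := hf.ncard_iterFibre_le N hN
    set U : Set (ℝ × ℝ) := {p : ℝ × ℝ | dist p.1 p.2 < δ} with hU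
    refine le_trans ?_ (coverEntropyEntourage_le_coverEntropy f (Icc (-1) 1)
      (Metric.dist_mem_uniformity hδ))
    have hmono : Monotone (fun n => (coverMincard f (Icc (-1) 1) U n : ENNReal)) := fun m n hmn =>
      ENat.toENNReal_mono (coverMincard_monotone_time f (Icc (-1) 1) U hmn)
    have hmul := hmono.expGrowthSup_comp_mul hN
    have hge : ∀ n, ENNReal.ofReal c * ENNReal.ofReal (μ ^ N / 3) ^ n ≤
        (coverMincard f (Icc (-1) 1) U (N * n) : ENNReal) := by
      intro n
      rcases eq_or_ne (coverMincard f (Icc (-1) 1) U (N * n)) ⊤ with htop | htop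
      · simp [htop]
      · obtain ⟨s, hs, hcard⟩ := (coverMincard_finite_iff f (Icc (-1) 1) U (N * n)).1
          (lt_top_iff_ne_top.2 htop)
        rw [← hcard, ENat.toENNReal_coe, ← ENNReal.ofReal_pow (by positivity),
          ← ENNReal.ofReal_mul hc.le, ← ENNReal.ofReal_natCast]
        refine ENNReal.ofReal_le_ofReal ?_
        have h1 := hcount (N * n)
        have h2 : ((iterFibre f (N * n) y).ncard : ℝ) ≤ 3 ^ n * s.card := by
          exact_mod_cast h n y s hs
        rw [div_pow, ← pow_mul, ← mul_div_assoc, div_le_iff₀ (by positivity)]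
        linarith
    have h3 := ExpGrowth.expGrowthSup_of_eventually_ge (b := ENNReal.ofReal c)
      (by simpa using hc) (Eventually.of_forall hge)
    rw [ExpGrowth.expGrowthSup_pow, ENNReal.log_ofReal_of_pos (by positivity)] at h3
    have h4 := h3.trans hmul.le
    have hN0 : (0 : ℝ) < N := by exact_mod_cast Nat.pos_of_ne_zero hN
    have h5 : Real.log (μ ^ N / 3) = N * (Real.log μ - Real.log 3 / N) := by
      rw [Real.log_div (by positivity) (by norm_num), Real.log_pow]
      field_simp
    rw [h5] at h4
    change _ ≤ ((N : ℝ) : EReal) * coverEntropyEntourage f (Icc (-1) 1) U at h4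
    generalize coverEntropyEntourage f (Icc (-1) 1) U = E at h4 ⊢
    induction E with
    | bot => rw [EReal.coe_mul_bot_of_pos hN0] at h4; exact absurd h4 (not_le.2 (EReal.bot_lt_coe _))
    | top => exact le_top
    | coe r =>
      rw [← EReal.coe_mul, EReal.coe_le_coe_iff] at h4
      exact EReal.coe_le_coe_iff.2 (le_of_mul_le_mul_left h4 hN0)
  refine le_of_tendsto' (f := fun N : ℕ => ((Real.log μ - Real.log 3 / ((N + 1 : ℕ) : ℝ) : ℝ) : EReal))
    (x := atTop) ?_ (fun N => hN (N + 1) (Nat.succ_ne_zero N))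
  refine (continuous_coe_real_ereal.tendsto _).comp ?_
  have : Tendsto (fun N : ℕ => Real.log 3 / ((N + 1 : ℕ) : ℝ)) atTop (𝓝 0) :=
    (tendsto_const_div_atTop_nhds_zero_nat (Real.log 3)).comp (tendsto_add_atTop_nat 1)
  simpa using this.const_sub (Real.log μ)

/-- The fibre of `f` over `y` in `[-1,1]`, as a finset. -/
noncomputable def FiniteLapMap.fibre {f : ℝ → ℝ} (hf : FiniteLapMap f) (y : ℝ) : Finset ℝ :=
  (hf.fin y).toFinset

lemma FiniteLapMap.mem_fibre {f : ℝ → ℝ} (hf : FiniteLapMap f) {x y : ℝ} :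
    x ∈ hf.fibre y ↔ x ∈ Icc (-1 : ℝ) 1 ∧ f x = y := by
  simp [FiniteLapMap.fibre]

lemma FiniteLapMap.sum_iterFibre_succ {f : ℝ → ℝ} (hf : FiniteLapMap f) (ω : ℝ → ℝ) (n : ℕ)
    (y : ℝ) :
    ∑ x ∈ (hf.iterFibre_finite (n + 1) y).toFinset, ω x =
      ∑ z ∈ (hf.iterFibre_finite n y).toFinset, ∑ x ∈ hf.fibre z, ω x := by
  rw [← Finset.sum_fiberwise_of_maps_to (g := f) (t := (hf.iterFibre_finite n y).toFinset)]
  · refine Finset.sum_congr rfl fun z hz => Finset.sum_congr ?_ fun _ _ => rfl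
    ext x
    simp only [Finset.mem_filter, Set.Finite.mem_toFinset, hf.mem_fibre, iterFibre, mem_ofPred_eq]
      at hz ⊢
    constructor
    · rintro ⟨⟨h1, h2⟩, h3⟩
      exact ⟨h1, h3⟩
    · rintro ⟨h1, h3⟩
      refine ⟨⟨h1, ?_⟩, h3⟩
      rw [Function.iterate_succ_apply, h3]
      exact hz.2
  · intro x hx
    simp only [Set.Finite.mem_toFinset, iterFibre, mem_ofPred_eq] at hx ⊢
    exact ⟨hf.maps hx.1, by simpa [Function.iterate_succ_apply] using hx.2⟩

lemma notMem_of_iterate_notMem {f : ℝ → ℝ} (hf : FiniteLapMap f) {B : Set ℝ}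
    (hB : ∀ x ∈ Icc (-1 : ℝ) 1, x ∈ B → f x ∈ B) {n : ℕ} {x : ℝ} (hx : x ∈ Icc (-1 : ℝ) 1)
    (h : f^[n] x ∉ B) : x ∉ B := by
  induction n generalizing x with
  | zero => simpa using h
  | succ n ih =>
    rw [Function.iterate_succ_apply] at h
    exact fun hxB => ih (hf.maps hx) h (hB x hx hxB)

/-- A bounded positive weight that is subinvariant under the transfer operator bounds the
entropy from above. -/
lemma FiniteLapMap.htop_le_of_transfer_le {f : ℝ → ℝ} (hf : FiniteLapMap f) {B : Set ℝ}
    (hBc : B.Countable) (hB : ∀ x ∈ Icc (-1 : ℝ) 1, x ∈ B → f x ∈ B) {ω : ℝ → ℝ} {μ m M : ℝ}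
    (hμ : 1 < μ) (hm : 0 < m) (hω : ∀ x ∈ Icc (-1 : ℝ) 1, m ≤ ω x ∧ ω x ≤ M)
    (h : ∀ y ∈ Icc (-1 : ℝ) 1, y ∉ B → ∑ x ∈ hf.fibre y, ω x ≤ μ * ω y) :
    htop f ≤ (Real.log μ : ℝ) := by
  refine hf.htop_le hBc (C := M / m) hμ fun y hy n => ?_
  have hsum : ∑ x ∈ (hf.iterFibre_finite n y).toFinset, ω x ≤ M * μ ^ n := by
    induction n with
    | zero =>
      have : (hf.iterFibre_finite 0 y).toFinset = {y} := by
        ext x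
        simp only [Set.Finite.mem_toFinset, iterFibre, mem_ofPred_eq, Function.iterate_zero, id,
          Finset.mem_singleton]
        exact ⟨fun h => h.2, fun h => ⟨h ▸ hy.1, h⟩⟩
      rw [this]
      simpa using (hω y hy.1).2
    | succ n ih =>
      rw [hf.sum_iterFibre_succ]
      calc _ ≤ ∑ z ∈ (hf.iterFibre_finite n y).toFinset, μ * ω z := by
            refine Finset.sum_le_sum fun z hz => ?_
            simp only [Set.Finite.mem_toFinset, iterFibre, mem_ofPred_eq] at hz
            exact h z hz.1 (notMem_of_iterate_notMem hf hB hz.1 (hz.2 ▸ hy.2))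
        _ = μ * ∑ z ∈ (hf.iterFibre_finite n y).toFinset, ω z := by rw [Finset.mul_sum]
        _ ≤ μ * (M * μ ^ n) := by gcongr
        _ = M * μ ^ (n + 1) := by ring
  have hlow : ((iterFibre f n y).ncard : ℝ) * m ≤
      ∑ x ∈ (hf.iterFibre_finite n y).toFinset, ω x := by
    rw [Set.ncard_eq_toFinset_card _ (hf.iterFibre_finite n y), ← nsmul_eq_mul]
    refine Finset.card_nsmul_le_sum _ _ _ fun x hx => ?_
    simp only [Set.Finite.mem_toFinset, iterFibre, mem_ofPred_eq] at hx
    exact (hω x hx.1).1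
  rw [div_mul_eq_mul_div, le_div_iff₀ hm]
  exact hlow.trans hsum

/-- A bounded weight that is superinvariant under the transfer operator off a forward invariant
set, and positive somewhere off that set, bounds the entropy from below. -/
lemma FiniteLapMap.le_htop_of_le_transfer {f : ℝ → ℝ} (hf : FiniteLapMap f) {B : Set ℝ}
    (hB : ∀ x ∈ Icc (-1 : ℝ) 1, x ∈ B → f x ∈ B) {ω : ℝ → ℝ} {μ M y : ℝ}
    (hμ : 1 < μ) (hω : ∀ x ∈ Icc (-1 : ℝ) 1, ω x ≤ M)
    (hy : y ∈ Icc (-1 : ℝ) 1) (hyB : y ∉ B) (hpos : 0 < ω y)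
    (h : ∀ y ∈ Icc (-1 : ℝ) 1, y ∉ B → μ * ω y ≤ ∑ x ∈ hf.fibre y, ω x) :
    (Real.log μ : ℝ) ≤ htop f := by
  have hM : 0 < M := hpos.trans_le (hω y hy)
  refine hf.le_htop (c := ω y / M) (y := y) (by positivity) hμ fun n => ?_
  have hsum : ω y * μ ^ n ≤ ∑ x ∈ (hf.iterFibre_finite n y).toFinset, ω x := by
    induction n with
    | zero =>
      have : (hf.iterFibre_finite 0 y).toFinset = {y} := by
        ext x
        simp only [Set.Finite.mem_toFinset, iterFibre, mem_ofPred_eq, Function.iterate_zero, id,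
          Finset.mem_singleton]
        exact ⟨fun h => h.2, fun h => ⟨h ▸ hy, h⟩⟩
      rw [this]
      simp
    | succ n ih =>
      rw [hf.sum_iterFibre_succ]
      calc ω y * μ ^ (n + 1) = μ * (ω y * μ ^ n) := by ring
        _ ≤ μ * ∑ z ∈ (hf.iterFibre_finite n y).toFinset, ω z := by gcongr
        _ = ∑ z ∈ (hf.iterFibre_finite n y).toFinset, μ * ω z := by rw [Finset.mul_sum]
        _ ≤ _ := by
            refine Finset.sum_le_sum fun z hz => ?_
            simp only [Set.Finite.mem_toFinset, iterFibre, mem_ofPred_eq] at hz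
            exact h z hz.1 (notMem_of_iterate_notMem hf hB hz.1 (hz.2 ▸ hyB))
  have hup : ∑ x ∈ (hf.iterFibre_finite n y).toFinset, ω x ≤ ((iterFibre f n y).ncard : ℝ) * M := by
    rw [Set.ncard_eq_toFinset_card _ (hf.iterFibre_finite n y), ← nsmul_eq_mul]
    refine Finset.sum_le_card_nsmul _ _ _ fun x hx => ?_
    simp only [Set.Finite.mem_toFinset, iterFibre, mem_ofPred_eq] at hx
    exact hω x hx.1
  rw [div_mul_eq_mul_div, div_le_iff₀ hM]
  exact hsum.trans hup

/-- The correction subtracted from a weight to account for the orbit of a short interval. -/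
noncomputable def tailWeight (S : ℕ → Set ℝ) (μ : ℝ) (k : ℕ) (x : ℝ) : ℝ :=
  ∑ n ∈ Finset.range k, 2 / μ ^ (n + 1) * (S n).indicator 1 x

lemma tailWeight_nonneg (S : ℕ → Set ℝ) {μ : ℝ} (hμ : 0 < μ) (k : ℕ) (x : ℝ) :
    0 ≤ tailWeight S μ k x :=
  Finset.sum_nonneg fun n _ => mul_nonneg (by positivity)
    (Set.indicator_nonneg (fun _ _ => zero_le_one) x)

lemma mul_tailWeight (S : ℕ → Set ℝ) {μ : ℝ} (hμ : 0 < μ) (k : ℕ) (y : ℝ) :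
    2 * (S 0).indicator 1 y + ∑ n ∈ Finset.range k, 2 / μ ^ (n + 1) * (S (n + 1)).indicator 1 y =
      μ * tailWeight S μ k y + 2 / μ ^ k * (S k).indicator 1 y := by
  have h1 := Finset.sum_range_succ (fun n => 2 / μ ^ n * (S n).indicator (1 : ℝ → ℝ) y) k
  rw [Finset.sum_range_succ'] at h1
  have h2 : μ * tailWeight S μ k y =
      ∑ n ∈ Finset.range k, 2 / μ ^ n * (S n).indicator (1 : ℝ → ℝ) y := by
    rw [tailWeight, Finset.mul_sum]
    refine Finset.sum_congr rfl fun n _ => ?_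
    rw [pow_succ]
    field_simp
  rw [h2, ← h1]
  simp [add_comm]

lemma indicator_one_cases (A : Set ℝ) (x : ℝ) :
    (x ∈ A ∧ A.indicator (1 : ℝ → ℝ) x = 1) ∨ (x ∉ A ∧ A.indicator (1 : ℝ → ℝ) x = 0) := by
  by_cases h : x ∈ A <;> simp [h]

theorem FiniteLapMap.htop_le_of_weight {f : ℝ → ℝ} (hf : FiniteLapMap f) {B J R : Set ℝ}
    {S : ℕ → Set ℝ} {ω : ℝ → ℝ} {μ s m M : ℝ} {k D : ℕ}
    (hBc : B.Countable) (hB : ∀ x ∈ Icc (-1 : ℝ) 1, x ∈ B → f x ∈ B)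
    (hJ : ∀ x ∈ J, f x ∈ J) (hD : ∀ y, (hf.fibre y).card ≤ D)
    (hJ2 : ∀ y, ({x ∈ (hf.fibre y : Set ℝ) | x ∈ J}).ncard ≤ 2)
    (hμ : 2 < μ)
    (hop : ∀ y ∈ Icc (-1 : ℝ) 1, y ∉ B → y ∉ J →
      ∑ x ∈ hf.fibre y, ω x ≤ μ * ω y + s * R.indicator 1 y - 2 * (S 0).indicator 1 y)
    (hS : ∀ n < k, ∀ y ∈ S (n + 1), y ∈ Icc (-1 : ℝ) 1 → ∃ x ∈ S n, x ∈ Icc (-1 : ℝ) 1 ∧ f x = y)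
    (hR : ∀ y ∈ Icc (-1 : ℝ) 1, y ∉ J → y ∈ R → y ∈ S k) (hs : s * μ ^ k ≤ 2)
    (hm : 0 < m) (hω : ∀ x ∈ Icc (-1 : ℝ) 1, x ∉ J → m + tailWeight S μ k x ≤ ω x ∧ ω x ≤ M) :
    htop f ≤ (Real.log μ : ℝ) := by
  classical
  have hμ0 : 0 < μ := by linarith
  set M' : ℝ := max M 0
  set Γ : ℝ := m + M' + D * M' / (μ - 2) with hΓ
  have hM' : 0 ≤ M' := le_max_right _ _
  have hμ2 : 0 < μ - 2 := by linarith
  have hΓ0 : 0 ≤ D * M' / (μ - 2) := by positivity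
  set φ : ℝ → ℝ := fun x => if x ∈ J then Γ else ω x - tailWeight S μ k x with hφ
  have hφle : ∀ x ∈ Icc (-1 : ℝ) 1, x ∉ J → φ x ≤ M' := fun x hx hxJ => by
    simp only [hφ, if_neg hxJ]
    have := tailWeight_nonneg S hμ0 k x
    exact le_trans (by linarith [(hω x hx hxJ).2]) (le_max_left M 0)
  refine hf.htop_le_of_transfer_le hBc hB (ω := φ) (m := m) (M := Γ) (by linarith) hm ?_ ?_
  · intro x hx
    by_cases hxJ : x ∈ J
    · simp only [hφ, if_pos hxJ]
      constructor <;> linarith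
    · have h1 := hφle x hx hxJ
      simp only [hφ, if_neg hxJ] at h1 ⊢
      constructor <;> linarith [(hω x hx hxJ).1]
  · intro y hy hyB
    by_cases hyJ : y ∈ J
    · rw [← Finset.sum_filter_add_sum_filter_not (hf.fibre y) (· ∈ J)]
      have h1 : ∑ x ∈ hf.fibre y with x ∈ J, φ x ≤ 2 * Γ := by
        have hc : ((hf.fibre y).filter (· ∈ J)).card ≤ 2 := by
          have := hJ2 y
          rw [← Set.ncard_coe_finset]
          convert this using 2
          ext x
          simp
        have : ∑ x ∈ hf.fibre y with x ∈ J, φ x ≤ ((hf.fibre y).filter (· ∈ J)).card • Γ :=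
          Finset.sum_le_card_nsmul _ _ _ fun x hx => by
            simp only [hφ, if_pos (Finset.mem_filter.1 hx).2]; exact le_rfl
        rw [nsmul_eq_mul] at this
        refine this.trans ?_
        have hc' : (((hf.fibre y).filter (· ∈ J)).card : ℝ) ≤ 2 := by exact_mod_cast hc
        have : 0 ≤ Γ := by linarith
        gcongr
      have h2 : ∑ x ∈ hf.fibre y with x ∉ J, φ x ≤ D * M' := by
        have : ∑ x ∈ hf.fibre y with x ∉ J, φ x ≤ ((hf.fibre y).filter (· ∉ J)).card • M' :=
          Finset.sum_le_card_nsmul _ _ _ fun x hx => by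
            rw [Finset.mem_filter, hf.mem_fibre] at hx
            exact hφle x hx.1.1 hx.2
        rw [nsmul_eq_mul] at this
        refine this.trans ?_
        gcongr
        exact (Finset.card_filter_le _ _).trans (hD y)
      have h3 : D * M' / (μ - 2) * (μ - 2) = D * M' := div_mul_cancel₀ _ hμ2.ne'
      simp only [hφ, if_pos hyJ]
      simp only [hφ] at h1 h2
      nlinarith
    · have h0 : ∑ x ∈ hf.fibre y, φ x = ∑ x ∈ hf.fibre y, ω x -
          ∑ n ∈ Finset.range k, 2 / μ ^ (n + 1) * ∑ x ∈ hf.fibre y, (S n).indicator 1 x := by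
        have : ∀ x ∈ hf.fibre y, φ x = ω x - tailWeight S μ k x := fun x hx => by
          rw [hf.mem_fibre] at hx
          have : x ∉ J := fun hxJ => hyJ (hx.2 ▸ hJ x hxJ)
          simp only [hφ, if_neg this]
        rw [Finset.sum_congr rfl this, Finset.sum_sub_distrib]
        congr 1
        simp only [tailWeight]
        rw [Finset.sum_comm]
        simp only [Finset.mul_sum]
      have h1 : ∑ n ∈ Finset.range k, 2 / μ ^ (n + 1) * (S (n + 1)).indicator 1 y ≤
          ∑ n ∈ Finset.range k, 2 / μ ^ (n + 1) * ∑ x ∈ hf.fibre y, (S n).indicator 1 x := by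
        refine Finset.sum_le_sum fun n hn => ?_
        gcongr
        have hnn : ∀ x ∈ hf.fibre y, 0 ≤ (S n).indicator (1 : ℝ → ℝ) x := fun x _ =>
          Set.indicator_nonneg (fun _ _ => zero_le_one) x
        by_cases hyS : y ∈ S (n + 1)
        · obtain ⟨x, hxS, hxI, hxy⟩ := hS n (Finset.mem_range.1 hn) y hyS hy
          have := Finset.single_le_sum hnn (hf.mem_fibre.2 ⟨hxI, hxy⟩)
          simpa [hyS, hxS] using this
        · simpa [hyS] using Finset.sum_nonneg hnn
      have h2 := mul_tailWeight S hμ0 k y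
      have h3 : s * R.indicator 1 y ≤ 2 / μ ^ k * (S k).indicator 1 y := by
        have hs' : s ≤ 2 / μ ^ k := by rwa [le_div_iff₀ (by positivity)]
        have hp : 0 ≤ 2 / μ ^ k := by positivity
        rcases indicator_one_cases R y with ⟨h, e⟩ | ⟨h, e⟩
        · rw [e, Set.indicator_of_mem (hR y hy hyJ h)]; simpa using hs'
        · rw [e, mul_zero]
          exact mul_nonneg hp (Set.indicator_nonneg (fun _ _ => zero_le_one) y)
      have h4 := hop y hy hyB hyJ
      rw [h0]
      simp only [hφ, if_neg hyJ]
      rw [mul_sub]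
      linarith

theorem FiniteLapMap.le_htop_of_weight {f : ℝ → ℝ} (hf : FiniteLapMap f) {B R : Set ℝ}
    {S : ℕ → Set ℝ} {ω : ℝ → ℝ} {μ s M y₀ : ℝ} {k : ℕ}
    (hB : ∀ x ∈ Icc (-1 : ℝ) 1, x ∈ B → f x ∈ B)
    (hμ : 1 < μ)
    (hop : ∀ y ∈ Icc (-1 : ℝ) 1, y ∉ B →
      μ * ω y + s * R.indicator 1 y - 2 * (S 0).indicator 1 y ≤ ∑ x ∈ hf.fibre y, ω x)
    (hinj : ∀ n < k, InjOn f (S n)) (hS : ∀ n < k, ∀ x ∈ S n, f x ∈ S (n + 1))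
    (hR : S k ⊆ R) (hs : 2 ≤ s * μ ^ k) (hω : ∀ x ∈ Icc (-1 : ℝ) 1, ω x ≤ M)
    (hy : y₀ ∈ Icc (-1 : ℝ) 1) (hyB : y₀ ∉ B) (hpos : tailWeight S μ k y₀ < ω y₀) :
    (Real.log μ : ℝ) ≤ htop f := by
  have hμ0 : 0 < μ := by linarith
  refine hf.le_htop_of_le_transfer hB (ω := fun x => ω x - tailWeight S μ k x) (M := M) hμ ?_ hy hyB
    (by linarith) ?_
  · intro x hx
    have := tailWeight_nonneg S hμ0 k x
    linarith [hω x hx]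
  · intro y hy hyB
    have h0 : ∑ x ∈ hf.fibre y, (ω x - tailWeight S μ k x) = ∑ x ∈ hf.fibre y, ω x -
        ∑ n ∈ Finset.range k, 2 / μ ^ (n + 1) * ∑ x ∈ hf.fibre y, (S n).indicator 1 x := by
      rw [Finset.sum_sub_distrib]
      congr 1
      simp only [tailWeight]
      rw [Finset.sum_comm]
      simp only [Finset.mul_sum]
    have h1 : ∑ n ∈ Finset.range k, 2 / μ ^ (n + 1) * ∑ x ∈ hf.fibre y, (S n).indicator 1 x ≤
        ∑ n ∈ Finset.range k, 2 / μ ^ (n + 1) * (S (n + 1)).indicator 1 y := by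
      refine Finset.sum_le_sum fun n hn => ?_
      gcongr
      have hn := Finset.mem_range.1 hn
      by_cases hex : ∃ x ∈ hf.fibre y, x ∈ S n
      · obtain ⟨x, hx, hxS⟩ := hex
        have hxy := (hf.mem_fibre.1 hx).2
        rw [Set.indicator_of_mem (hxy ▸ hS n hn x hxS), Finset.sum_eq_single_of_mem x hx]
        · simp [hxS]
        · intro x' hx' hne
          refine Set.indicator_of_notMem (fun h => hne ?_) _
          exact hinj n hn h hxS ((hf.mem_fibre.1 hx').2.trans hxy.symm)
      · push Not at hex
        rw [Finset.sum_eq_zero fun x hx => Set.indicator_of_notMem (hex x hx) _]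
        exact Set.indicator_nonneg (fun _ _ => zero_le_one) y
    have h2 := mul_tailWeight S hμ0 k y
    have h3 : 2 / μ ^ k * (S k).indicator 1 y ≤ s * R.indicator 1 y := by
      have hs' : 2 / μ ^ k ≤ s := by rwa [div_le_iff₀ (by positivity)]
      have hp : 0 ≤ 2 / μ ^ k := by positivity
      rcases indicator_one_cases (S k) y with ⟨h, e⟩ | ⟨h, e⟩
      · rw [e, Set.indicator_of_mem (hR h)]; simpa using hs'
      · rw [e, mul_zero]
        exact mul_nonneg (hp.trans hs') (Set.indicator_nonneg (fun _ _ => zero_le_one) y)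
    have h4 := hop y hy hyB
    rw [h0, mul_sub]
    linarith

/-- A self-map of `[-1,1]` which is alternately increasing and decreasing on the `b + 1`
intervals cut out by the nodes `x 0 = -1 < x 1 < … < x (b + 1) = 1`; the sign `θ` tells whether
the first lap is increasing. -/
structure LapMap (b : ℕ) (θ : ℝ) (f : ℝ → ℝ) (x : ℕ → ℝ) : Prop where
  cont : Continuous f
  maps : MapsTo f (Icc (-1) 1) (Icc (-1) 1)
  first : x 0 = -1
  last : x (b + 1) = 1
  lt : ∀ j ≤ b, x j < x (j + 1)
  mono : ∀ j ≤ b, StrictMonoOn (fun t => θ * (-1) ^ j * f t) (Icc (x j) (x (j + 1)))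

namespace LapMap

variable {b : ℕ} {θ : ℝ} {f : ℝ → ℝ} {x : ℕ → ℝ}

lemma node_lt (h : LapMap b θ f x) {i j : ℕ} (hij : i < j) (hj : j ≤ b + 1) : x i < x j := by
  induction j, hij using Nat.le_induction with
  | base => exact h.lt i (by omega)
  | succ j hij ih => exact (ih (by omega)).trans (h.lt j (by omega))

lemma node_le (h : LapMap b θ f x) {i j : ℕ} (hij : i ≤ j) (hj : j ≤ b + 1) : x i ≤ x j := by
  rcases hij.eq_or_lt with rfl | hlt
  · exact le_rfl
  · exact (h.node_lt hlt hj).le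

lemma node_mem (h : LapMap b θ f x) {j : ℕ} (hj : j ≤ b + 1) : x j ∈ Icc (-1 : ℝ) 1 :=
  ⟨h.first ▸ h.node_le (Nat.zero_le j) hj, h.last ▸ h.node_le hj le_rfl⟩

lemma lap_subset (h : LapMap b θ f x) {j : ℕ} (hj : j ≤ b) :
    Icc (x j) (x (j + 1)) ⊆ Icc (-1 : ℝ) 1 :=
  Icc_subset_Icc (h.node_mem (by omega)).1 (h.node_mem (by omega)).2

lemma injOn (h : LapMap b θ f x) {j : ℕ} (hj : j ≤ b) : InjOn f (Icc (x j) (x (j + 1))) :=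
  fun _ hu _ hv huv => (h.mono j hj).injOn hu hv (by simp only [huv])

lemma exists_lap (h : LapMap b θ f x) {t : ℝ} (h1 : -1 ≤ t) (h2 : t < 1) :
    ∃ j ≤ b, x j ≤ t ∧ t < x (j + 1) := by
  by_contra hcon
  push Not at hcon
  have : ∀ j ≤ b + 1, x j ≤ t := by
    intro j
    induction j with
    | zero => intro _; rw [h.first]; exact h1
    | succ j ih => intro hj; exact hcon j (by omega) (ih (by omega))
  have := this (b + 1) le_rfl
  rw [h.last] at this
  linarith

lemma exists_open_lap (h : LapMap b θ f x) {t : ℝ} (ht : t ∈ Icc (-1 : ℝ) 1)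
    (hn : ∀ j ≤ b + 1, x j ≠ t) : ∃ j ≤ b, t ∈ Ioo (x j) (x (j + 1)) := by
  have hne : t ≠ 1 := fun h1 => hn (b + 1) le_rfl (h.last.trans h1.symm)
  obtain ⟨j, hj, h1, h2⟩ := h.exists_lap ht.1 (lt_of_le_of_ne ht.2 hne)
  exact ⟨j, hj, lt_of_le_of_ne h1 (hn j (by omega)), h2⟩

lemma lap_unique (h : LapMap b θ f x) {t : ℝ} {i j : ℕ} (hi : i ≤ b) (hj : j ≤ b)
    (hti : t ∈ Ioo (x i) (x (i + 1))) (htj : t ∈ Ioo (x j) (x (j + 1))) : i = j := by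
  rcases lt_trichotomy i j with hlt | heq | hlt
  · have := h.node_le (show i + 1 ≤ j from hlt) (by omega)
    linarith [hti.2, htj.1]
  · exact heq
  · have := h.node_le (show j + 1 ≤ i from hlt) (by omega)
    linarith [hti.1, htj.2]

lemma finiteLapMap (h : LapMap b θ f x) : FiniteLapMap f where
  cont := h.cont
  maps := h.maps
  fin y := by
    have : {t ∈ Icc (-1 : ℝ) 1 | f t = y} ⊆
        {1} ∪ ⋃ j ∈ Finset.range (b + 1), {t ∈ Icc (x j) (x (j + 1)) | f t = y} := by
      rintro t ⟨ht, hty⟩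
      rcases ht.2.eq_or_lt with rfl | hlt
      · exact Or.inl rfl
      · obtain ⟨j, hj, h1, h2⟩ := h.exists_lap ht.1 hlt
        refine Or.inr ?_
        simp only [mem_iUnion, Finset.mem_range]
        exact ⟨j, by omega, ⟨h1, h2.le⟩, hty⟩
    refine Set.Finite.subset ((finite_singleton _).union
      ((Finset.finite_toSet _).biUnion fun j hj => ?_)) this
    refine Set.Subsingleton.finite ?_
    rintro u ⟨hu, huy⟩ v ⟨hv, hvy⟩
    have hj' : j ≤ b := by simpa [Nat.lt_succ_iff] using hj
    exact h.injOn hj' hu hv (huy.trans hvy.symm)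
  cut := by
    refine ⟨x '' Icc 0 (b + 1), (finite_Icc _ _).image _, fun u hu v hv huv hfuv => ?_⟩
    obtain ⟨j, hj, h1, h2⟩ := h.exists_lap hu.1 (huv.trans_le hv.2)
    refine ⟨x (j + 1), ⟨j + 1, ⟨Nat.zero_le _, by omega⟩, rfl⟩, h2, ?_⟩
    by_contra hcon
    push Not at hcon
    exact huv.ne (h.injOn hj ⟨h1, h2.le⟩ ⟨h1.trans huv.le, hcon⟩ hfuv)

lemma sum_fibre_le (h : LapMap b θ f x) {ω : ℝ → ℝ} {y : ℝ} {K : ℕ → ℝ}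
    (hy : ∀ j ≤ b + 1, f (x j) ≠ y) (hK0 : ∀ j ≤ b, 0 ≤ K j)
    (hK : ∀ j ≤ b, ∀ t ∈ Ioo (x j) (x (j + 1)), f t = y → ω t ≤ K j) :
    ∑ t ∈ h.finiteLapMap.fibre y, ω t ≤ ∑ j ∈ Finset.range (b + 1), K j := by
  have hex : ∀ t ∈ h.finiteLapMap.fibre y, ∃ j ≤ b, t ∈ Ioo (x j) (x (j + 1)) := by
    intro t ht
    rw [h.finiteLapMap.mem_fibre] at ht
    exact h.exists_open_lap ht.1 fun j hj hxt => hy j hj (hxt ▸ ht.2)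
  choose! l hl hlt using hex
  have hinj : Set.InjOn l (h.finiteLapMap.fibre y) := by
    intro t ht t' ht' heq
    have h1 := hlt t ht
    have h2 := hlt t' ht'
    rw [← heq] at h2
    have e1 := (h.finiteLapMap.mem_fibre.1 ht).2
    have e2 := (h.finiteLapMap.mem_fibre.1 ht').2
    exact h.injOn (hl t ht) (Ioo_subset_Icc_self h1) (Ioo_subset_Icc_self h2) (e1.trans e2.symm)
  calc _ ≤ ∑ t ∈ h.finiteLapMap.fibre y, K (l t) := Finset.sum_le_sum fun t ht =>
        hK _ (hl t ht) t (hlt t ht) (h.finiteLapMap.mem_fibre.1 ht).2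
    _ = ∑ j ∈ (h.finiteLapMap.fibre y).image l, K j := by rw [Finset.sum_image hinj]
    _ ≤ _ := by
        refine Finset.sum_le_sum_of_subset_of_nonneg ?_ fun j hj _ => hK0 j ?_
        · intro j hj
          obtain ⟨t, ht, rfl⟩ := Finset.mem_image.1 hj
          have := hl t ht
          exact Finset.mem_range.2 (by omega)
        · have := Finset.mem_range.1 hj
          omega

lemma card_fibre_le (h : LapMap b θ f x) (y : ℝ) :
    (h.finiteLapMap.fibre y).card ≤ b + 2 := by
  have hex : ∀ t ∈ h.finiteLapMap.fibre y, ∃ j ≤ b + 1, t = 1 ∧ j = b + 1 ∨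
      j ≤ b ∧ x j ≤ t ∧ t < x (j + 1) := by
    intro t ht
    rw [h.finiteLapMap.mem_fibre] at ht
    rcases ht.1.2.eq_or_lt with he | hlt
    · exact ⟨b + 1, le_rfl, Or.inl ⟨he, rfl⟩⟩
    · obtain ⟨j, hj, h1, h2⟩ := h.exists_lap ht.1.1 hlt
      exact ⟨j, by omega, Or.inr ⟨hj, h1, h2⟩⟩
  choose! l hl hlt using hex
  have hinj : Set.InjOn l (h.finiteLapMap.fibre y) := by
    intro t ht t' ht' heq
    have e1 := (h.finiteLapMap.mem_fibre.1 ht).2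
    have e2 := (h.finiteLapMap.mem_fibre.1 ht').2
    have h2 := hlt t' ht'
    rw [← heq] at h2
    rcases hlt t ht with h1 | h1 <;> rcases h2 with h2 | h2
    · exact h1.1.trans h2.1.symm
    · omega
    · omega
    · exact h.injOn h1.1 ⟨h1.2.1, h1.2.2.le⟩ ⟨h2.2.1, h2.2.2.le⟩ (e1.trans e2.symm)
  have := Finset.card_le_card_of_injOn l (t := Finset.range (b + 2))
    (fun t ht => by have := hl t ht; simp; omega) hinj
  simpa using this

lemma le_sum_fibre (h : LapMap b θ f x) {ω : ℝ → ℝ} {y : ℝ} {K : ℕ → ℝ}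
    (hω : ∀ t ∈ Icc (-1 : ℝ) 1, 0 ≤ ω t)
    (hK : ∀ j ≤ b, K j ≤ 0 ∨ ∃ t ∈ Ioo (x j) (x (j + 1)), f t = y ∧ K j ≤ ω t) :
    ∑ j ∈ Finset.range (b + 1), K j ≤ ∑ t ∈ h.finiteLapMap.fibre y, ω t := by
  classical
  set P := (Finset.range (b + 1)).filter fun j => ∃ t ∈ Ioo (x j) (x (j + 1)), f t = y ∧ K j ≤ ω t
  have hP : ∀ j ∈ P, j ≤ b ∧ ∃ t ∈ Ioo (x j) (x (j + 1)), f t = y ∧ K j ≤ ω t := fun j hj => by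
    have := Finset.mem_filter.1 hj
    exact ⟨by have := Finset.mem_range.1 this.1; omega, this.2⟩
  have h1 : ∑ j ∈ Finset.range (b + 1), K j ≤ ∑ j ∈ P, K j := by
    rw [← Finset.sum_filter_add_sum_filter_not (Finset.range (b + 1))
      fun j => ∃ t ∈ Ioo (x j) (x (j + 1)), f t = y ∧ K j ≤ ω t]
    have : ∑ j ∈ Finset.range (b + 1) with ¬ ∃ t ∈ Ioo (x j) (x (j + 1)), f t = y ∧ K j ≤ ω t,
        K j ≤ 0 := Finset.sum_nonpos fun j hj => by
      have hj := Finset.mem_filter.1 hj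
      exact (hK j (by have := Finset.mem_range.1 hj.1; omega)).resolve_right hj.2
    linarith
  refine h1.trans ?_
  choose! τ hτ hτy hτK using fun j hj => (hP j hj).2
  have hinj : Set.InjOn τ P := fun i hi j hj hij =>
    h.lap_unique (hP i hi).1 (hP j hj).1 (hτ i hi) (hij ▸ hτ j hj)
  calc _ ≤ ∑ j ∈ P, ω (τ j) := Finset.sum_le_sum fun j hj => hτK j hj
    _ = ∑ t ∈ P.image τ, ω t := by rw [Finset.sum_image hinj]
    _ ≤ _ := by
        refine Finset.sum_le_sum_of_subset_of_nonneg ?_ fun t ht _ =>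
          hω t (h.finiteLapMap.mem_fibre.1 ht).1
        intro t ht
        obtain ⟨j, hj, rfl⟩ := Finset.mem_image.1 ht
        exact h.finiteLapMap.mem_fibre.2
          ⟨h.lap_subset (hP j hj).1 (Ioo_subset_Icc_self (hτ j hj)), hτy j hj⟩

end LapMap

/-- The union of the forward orbits of the points of `Z`. -/
def forwardOrbit (f : ℝ → ℝ) (Z : Set ℝ) : Set ℝ := ⋃ n : ℕ, f^[n] '' Z

lemma forwardOrbit_countable (f : ℝ → ℝ) {Z : Set ℝ} (hZ : Z.Countable) :
    (forwardOrbit f Z).Countable := countable_iUnion fun _ => hZ.image _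

lemma map_mem_forwardOrbit {f : ℝ → ℝ} {Z : Set ℝ} {x : ℝ} (hx : x ∈ forwardOrbit f Z) :
    f x ∈ forwardOrbit f Z := by
  simp only [forwardOrbit, mem_iUnion] at hx ⊢
  obtain ⟨n, z, hz, rfl⟩ := hx
  exact ⟨n + 1, z, hz, Function.iterate_succ_apply' f n z⟩

lemma subset_forwardOrbit (f : ℝ → ℝ) (Z : Set ℝ) : Z ⊆ forwardOrbit f Z := fun z hz =>
  mem_iUnion.2 ⟨0, z, hz, rfl⟩

lemma ne_of_notMem_forwardOrbit {f : ℝ → ℝ} {Z : Set ℝ} {y z : ℝ} (hy : y ∉ forwardOrbit f Z)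
    (hz : z ∈ Z) : f z ≠ y := fun h =>
  hy (h ▸ map_mem_forwardOrbit (subset_forwardOrbit f Z hz))

/-- A lap map all of whose node values are extremal, except for `θ * v` at the first turning
point and `θ * (-1 + η)` at the second one. -/
structure NearCheb (b : ℕ) (θ η v : ℝ) (f : ℝ → ℝ) (x : ℕ → ℝ) : Prop extends LapMap b θ f x where
  two_le : 2 ≤ b
  sign : θ = 1 ∨ θ = -1
  val_zero : f (x 0) = -θ
  val_one : f (x 1) = θ * v
  val_two : f (x 2) = θ * (-1 + η)
  val : ∀ j, 3 ≤ j → j ≤ b + 1 → f (x j) = θ * (-1) ^ (j + 1)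
  eta_nonneg : 0 ≤ η

lemma sum_laps (K : ℕ → ℝ) {b : ℕ} (hb : 2 ≤ b) :
    ∑ j ∈ Finset.range (b + 1), K j = K 0 + K 1 + K 2 + ∑ j ∈ Finset.Ico 3 (b + 1), K j := by
  rw [← Finset.sum_range_add_sum_Ico K (show 3 ≤ b + 1 by omega)]
  simp [Finset.sum_range_succ]

lemma sum_laps_ones (K : ℕ → ℝ) {b : ℕ} (hb : 2 ≤ b) (hK : ∀ j, 3 ≤ j → j ≤ b → K j = 1) :
    ∑ j ∈ Finset.range (b + 1), K j = K 0 + K 1 + K 2 + (b - 2) := by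
  rw [sum_laps K hb, Finset.sum_congr rfl (g := fun _ => (1 : ℝ)) fun j hj => by
    rw [Finset.mem_Ico] at hj; exact hK j hj.1 (by omega)]
  simp only [Finset.sum_const, Nat.card_Ico, nsmul_eq_mul, mul_one]
  rw [Nat.cast_sub (show 3 ≤ b + 1 by omega)]
  push_cast
  ring

lemma sum_laps_last (K : ℕ → ℝ) {b : ℕ} (hb : 3 ≤ b) (hK : ∀ j, 3 ≤ j → j < b → K j = 1) :
    ∑ j ∈ Finset.range (b + 1), K j = K 0 + K 1 + K 2 + (b - 3) + K b := by
  rw [sum_laps K (by omega), Finset.sum_Ico_succ_top hb,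
    Finset.sum_congr rfl (g := fun _ => (1 : ℝ)) fun j hj => by
    rw [Finset.mem_Ico] at hj; exact hK j hj.1 (by omega)]
  simp only [Finset.sum_const, Nat.card_Ico, nsmul_eq_mul, mul_one]
  push_cast [Nat.cast_sub hb]
  ring

namespace NearCheb

variable {b : ℕ} {θ η v : ℝ} {f : ℝ → ℝ} {x : ℕ → ℝ}

lemma theta_sq (h : NearCheb b θ η v f x) : θ * θ = 1 := by
  rcases h.sign with h | h <;> rw [h] <;> norm_num

lemma mono_even (h : NearCheb b θ η v f x) {j : ℕ} (hj : j ≤ b) (he : Even j) :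
    StrictMonoOn (fun t => θ * f t) (Icc (x j) (x (j + 1))) := by
  have := h.mono j hj
  simpa [he.neg_one_pow] using this

lemma anti_odd (h : NearCheb b θ η v f x) {j : ℕ} (hj : j ≤ b) (ho : Odd j) :
    StrictAntiOn (fun t => θ * f t) (Icc (x j) (x (j + 1))) := by
  intro u hu w hw huw
  have := h.mono j hj hu hw huw
  simp only [ho.neg_one_pow] at this ⊢
  linarith

lemma theta_val_two (h : NearCheb b θ η v f x) : θ * f (x 2) = -1 + η := by
  rw [h.val_two, ← mul_assoc, h.theta_sq, one_mul]

lemma theta_val (h : NearCheb b θ η v f x) {j : ℕ} (h3 : 3 ≤ j) (hj : j ≤ b + 1) :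
    θ * f (x j) = (-1) ^ (j + 1) := by
  rw [h.val j h3 hj, ← mul_assoc, h.theta_sq, one_mul]

lemma theta_val_even_le (h : NearCheb b θ η v f x) {j : ℕ} (h2 : 2 ≤ j) (hj : j ≤ b + 1)
    (he : Even j) : θ * f (x j) ≤ -1 + η := by
  rcases h2.eq_or_lt with rfl | h3
  · exact h.theta_val_two.le
  · rw [h.theta_val h3 hj, he.add_one.neg_one_pow]
    linarith [h.eta_nonneg]

lemma theta_val_odd (h : NearCheb b θ η v f x) {j : ℕ} (h2 : 2 ≤ j) (hj : j ≤ b + 1)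
    (ho : Odd j) : θ * f (x j) = 1 := by
  rw [h.theta_val (by rcases ho with ⟨k, rfl⟩; omega) hj, ho.add_one.neg_one_pow]

lemma lt_of_mem_lap_two (h : NearCheb b θ η v f x) {t : ℝ} (ht : t ∈ Ioo (x 2) (x 3)) :
    -1 + η < θ * f t := by
  rw [← h.theta_val_two]
  exact h.mono_even h.two_le even_two ⟨le_rfl, (h.lt 2 h.two_le).le⟩
    (Ioo_subset_Icc_self ht) ht.1

lemma lt_of_mem_lap_one (h : NearCheb b θ η v f x) {t : ℝ} (ht : t ∈ Ioo (x 1) (x 2)) :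
    -1 + η < θ * f t := by
  have hb := h.two_le
  rw [← h.theta_val_two]
  exact h.anti_odd (j := 1) (by omega) odd_one (Ioo_subset_Icc_self ht)
    ⟨(h.lt 1 (by omega)).le, le_rfl⟩ ht.2

lemma exists_between (h : NearCheb b θ η v f x) {u w y : ℝ} (huw : u < w)
    (hy : θ * f u < θ * y ∧ θ * y < θ * f w ∨ θ * f w < θ * y ∧ θ * y < θ * f u) :
    ∃ t ∈ Ioo u w, f t = y := by
  have hc : ContinuousOn (fun t => θ * f t) (Icc u w) :=
    (continuous_const.mul h.cont).continuousOn
  have hθ : θ ≠ 0 := by rcases h.sign with h | h <;> rw [h] <;> norm_num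
  rcases hy with hy | hy
  · obtain ⟨t, ht, hty⟩ := intermediate_value_Ioo huw.le hc hy
    exact ⟨t, ht, mul_left_cancel₀ hθ hty⟩
  · obtain ⟨t, ht, hty⟩ := intermediate_value_Ioo' huw.le hc hy
    exact ⟨t, ht, mul_left_cancel₀ hθ hty⟩

lemma exists_mem_lap (h : NearCheb b θ η v f x) {j : ℕ} (h2 : 2 ≤ j) (hj : j ≤ b) {y : ℝ}
    (hy1 : θ * y < 1) (hy : 2 < j ∧ -1 < θ * y ∨ -1 + η < θ * y) :
    ∃ t ∈ Ioo (x j) (x (j + 1)), f t = y := by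
  refine h.exists_between (h.lt j hj) ?_
  rcases Nat.even_or_odd j with he | ho
  · left
    refine ⟨?_, by rwa [h.theta_val_odd (by omega) (by omega) he.add_one]⟩
    rcases hy with hy | hy
    · rw [h.theta_val (by omega) (by omega), he.add_one.neg_one_pow]
      exact hy.2
    · exact (h.theta_val_even_le h2 (by omega) he).trans_lt hy
  · right
    refine ⟨?_, by rwa [h.theta_val_odd h2 (by omega) ho]⟩
    have h3 : 3 ≤ j := by rcases ho with ⟨k, rfl⟩; omega
    rw [h.theta_val (by omega) (by omega), ho.add_one.add_one.neg_one_pow]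
    rcases hy with hy | hy
    · exact hy.2
    · linarith [h.eta_nonneg]

end NearCheb

lemma tailWeight_le (S : ℕ → Set ℝ) {μ : ℝ} (hμ : 1 < μ) (k : ℕ) (x : ℝ) :
    tailWeight S μ k x ≤ 2 * (1 - (μ ^ k)⁻¹) / (μ - 1) := by
  have hμ0 : 0 < μ - 1 := by linarith
  calc tailWeight S μ k x ≤ ∑ n ∈ Finset.range k, 2 / μ ^ (n + 1) := by
        refine Finset.sum_le_sum fun n _ => ?_
        rcases indicator_one_cases (S n) x with ⟨_, e⟩ | ⟨_, e⟩ <;> rw [e]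
        · rw [mul_one]
        · rw [mul_zero]; positivity
    _ = 2 * (1 - (μ ^ k)⁻¹) / (μ - 1) := by
        induction k with
        | zero => simp
        | succ k ih => rw [Finset.sum_range_succ, ih]; field_simp; ring

lemma tailWeight_eq_zero {S : ℕ → Set ℝ} {μ : ℝ} {k : ℕ} {x : ℝ} (h : ∀ n < k, x ∉ S n) :
    tailWeight S μ k x = 0 :=
  Finset.sum_eq_zero fun n hn => by
    rw [Set.indicator_of_notMem (h n (Finset.mem_range.1 hn)), mul_zero]

lemma tailWeight_even_le {S : ℕ → Set ℝ} {μ : ℝ} (hμ : 1 < μ) {l : ℕ} {x : ℝ}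
    (h : ∀ n < 2 * l, Odd n → x ∉ S n) :
    tailWeight S μ (2 * l) x ≤ 2 * μ * (1 - (μ ^ (2 * l))⁻¹) / (μ ^ 2 - 1) := by
  have hμ0 : 0 < μ ^ 2 - 1 := by nlinarith
  induction l with
  | zero => simp [tailWeight]
  | succ l ih =>
    have ih := ih fun n hn => h n (by omega)
    have e1 : (S (2 * l + 1)).indicator (1 : ℝ → ℝ) x = 0 :=
      Set.indicator_of_notMem (h _ (by omega) ⟨l, rfl⟩) _
    have e2 : 2 / μ ^ (2 * l + 1) * (S (2 * l)).indicator (1 : ℝ → ℝ) x ≤ 2 / μ ^ (2 * l + 1) := by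
      rcases indicator_one_cases (S (2 * l)) x with ⟨_, e⟩ | ⟨_, e⟩ <;> rw [e]
      · rw [mul_one]
      · rw [mul_zero]; positivity
    have e3 : tailWeight S μ (2 * (l + 1)) x = tailWeight S μ (2 * l) x +
        2 / μ ^ (2 * l + 1) * (S (2 * l)).indicator (1 : ℝ → ℝ) x := by
      rw [tailWeight, show 2 * (l + 1) = 2 * l + 1 + 1 by ring, Finset.sum_range_succ,
        Finset.sum_range_succ, e1, mul_zero, add_zero]
      rfl
    have e4 : 2 * μ * (1 - (μ ^ (2 * (l + 1)))⁻¹) / (μ ^ 2 - 1) =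
        2 * μ * (1 - (μ ^ (2 * l))⁻¹) / (μ ^ 2 - 1) + 2 / μ ^ (2 * l + 1) := by
      field_simp
      ring
    rw [e3, e4]
    linarith

lemma tailWeight_odd_le {S : ℕ → Set ℝ} {μ : ℝ} (hμ : 1 < μ) {l : ℕ} {x : ℝ}
    (h : ∀ n < 2 * l, Even n → x ∉ S n) :
    tailWeight S μ (2 * l) x ≤ 2 * (1 - (μ ^ (2 * l))⁻¹) / (μ ^ 2 - 1) := by
  have hμ0 : 0 < μ ^ 2 - 1 := by nlinarith
  induction l with
  | zero => simp [tailWeight]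
  | succ l ih =>
    have ih := ih fun n hn => h n (by omega)
    have e1 : (S (2 * l)).indicator (1 : ℝ → ℝ) x = 0 :=
      Set.indicator_of_notMem (h _ (by omega) (even_two_mul l)) _
    have e2 : 2 / μ ^ (2 * l + 2) * (S (2 * l + 1)).indicator (1 : ℝ → ℝ) x ≤
        2 / μ ^ (2 * l + 2) := by
      rcases indicator_one_cases (S (2 * l + 1)) x with ⟨_, e⟩ | ⟨_, e⟩ <;> rw [e]
      · rw [mul_one]
      · rw [mul_zero]; positivity
    have e3 : tailWeight S μ (2 * (l + 1)) x = tailWeight S μ (2 * l) x +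
        2 / μ ^ (2 * l + 2) * (S (2 * l + 1)).indicator (1 : ℝ → ℝ) x := by
      rw [tailWeight, show 2 * (l + 1) = 2 * l + 1 + 1 by ring, Finset.sum_range_succ,
        Finset.sum_range_succ, e1, mul_zero, add_zero]
      rfl
    have e4 : 2 * (1 - (μ ^ (2 * (l + 1)))⁻¹) / (μ ^ 2 - 1) =
        2 * (1 - (μ ^ (2 * l))⁻¹) / (μ ^ 2 - 1) + 2 / μ ^ (2 * l + 2) := by
      field_simp
      ring
    rw [e3, e4]
    linarith

/-- The part of `[-1,1]` closer than `d` to the endpoint `e`. -/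
def endNhd (e d : ℝ) : Set ℝ := {y ∈ Icc (-1 : ℝ) 1 | |y - e| < d}

lemma indicator_mem_endNhd {η y : ℝ} (hy : y ∈ Icc (-1 : ℝ) 1) :
    (1 - η < y → (endNhd 1 η).indicator (1 : ℝ → ℝ) y = 1) ∧
      (y ≤ 1 - η → (endNhd 1 η).indicator (1 : ℝ → ℝ) y = 0) := by
  have habs : |y - 1| = 1 - y := by rw [abs_of_nonpos (by linarith [hy.2])]; ring
  refine ⟨fun h => indicator_of_mem (show y ∈ endNhd 1 η from ⟨hy, ?_⟩) _,
    fun h => indicator_of_notMem (fun hm : y ∈ endNhd 1 η => ?_) _⟩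
  · rw [habs]; linarith
  · have := hm.2
    rw [habs] at this
    linarith

lemma ncard_le_two_of_injOn {f : ℝ → ℝ} (hf : FiniteLapMap f) {J A B : Set ℝ} (hJ : J ⊆ A ∪ B)
    (hA : InjOn f A) (hB : InjOn f B) (y : ℝ) :
    ({x ∈ (hf.fibre y : Set ℝ) | x ∈ J}).ncard ≤ 2 := by
  have hsub : {x ∈ (hf.fibre y : Set ℝ) | x ∈ J} ⊆
      ((hf.fibre y : Set ℝ) ∩ A) ∪ ((hf.fibre y : Set ℝ) ∩ B) := by
    rintro x ⟨hx, hxJ⟩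
    exact (hJ hxJ).imp (fun h => ⟨hx, h⟩) fun h => ⟨hx, h⟩
  have hone : ∀ {A : Set ℝ}, InjOn f A → ((hf.fibre y : Set ℝ) ∩ A).ncard ≤ 1 := by
    intro A hA
    rw [Set.ncard_le_one ((Finset.finite_toSet _).subset inter_subset_left)]
    rintro u ⟨hu, huA⟩ w ⟨hw, hwA⟩
    exact hA huA hwA ((hf.mem_fibre.1 hu).2.trans (hf.mem_fibre.1 hw).2.symm)
  have h1 := Set.ncard_le_ncard hsub
    (((Finset.finite_toSet _).subset inter_subset_left).union
      ((Finset.finite_toSet _).subset inter_subset_left))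
  have h2 := Set.ncard_union_le ((hf.fibre y : Set ℝ) ∩ A) ((hf.fibre y : Set ℝ) ∩ B)
  have h3 := hone hA
  have h4 := hone hB
  omega

/-- The first turning point of a decreasing-first map lies in an invariant interval bounded by a
fixed point `p` and its preimage `p'`. -/
structure FixedPlateau (f : ℝ → ℝ) (x : ℕ → ℝ) (p' p : ℝ) : Prop where
  lt₁ : -1 < p'
  lt₂ : p' < x 1
  lt₃ : x 1 < p
  lt₄ : p < x 2
  map_right : f p = p
  map_left : f p' = p
  le_val : p' ≤ f (x 1)

namespace FixedPlateau

variable {b : ℕ} {η v : ℝ} {f : ℝ → ℝ} {x : ℕ → ℝ} {p' p : ℝ}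

lemma anti_zero (h : NearCheb b (-1) η v f x) : StrictAntiOn f (Icc (x 0) (x 1)) := by
  intro s hs t ht hst
  have := h.mono_even (Nat.zero_le b) Even.zero hs ht hst
  simp only at this
  linarith

lemma mono_one (h : NearCheb b (-1) η v f x) : StrictMonoOn f (Icc (x 1) (x 2)) := by
  intro s hs t ht hst
  have := h.anti_odd (j := 1) (by have := h.two_le; omega) odd_one hs ht hst
  simp only at this
  linarith

lemma mem_zero (h : NearCheb b (-1) η v f x) {t : ℝ} (h1 : -1 ≤ t) (h2 : t ≤ x 1) : t ∈ Icc (x 0) (x 1) := ⟨by rwa [h.first], h2⟩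

lemma lt_one_sub (h : NearCheb b (-1) η v f x) (hp : FixedPlateau f x p' p) :
    p < 1 - η := by
  have := mono_one h ⟨hp.lt₃.le, hp.lt₄.le⟩ ⟨(hp.lt₃.trans hp.lt₄).le, le_rfl⟩ hp.lt₄
  rw [hp.map_right, h.val_two] at this
  linarith

lemma val_one_le (h : NearCheb b (-1) η v f x) (hp : FixedPlateau f x p' p)
    {t : ℝ} (h1 : -1 ≤ t) (h2 : t ≤ x 2) : f (x 1) ≤ f t := by
  rcases le_total t (x 1) with ht | ht
  · exact (anti_zero h).antitoneOn (mem_zero h h1 ht)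
      (mem_zero h (hp.lt₁.trans hp.lt₂).le le_rfl) ht
  · exact (mono_one h).monotoneOn ⟨le_rfl, (hp.lt₃.trans hp.lt₄).le⟩ ⟨ht, h2⟩ ht

lemma map_mem (h : NearCheb b (-1) η v f x) (hp : FixedPlateau f x p' p)
    {t : ℝ} (ht : t ∈ Icc p' p) : f t ∈ Icc p' p := by
  refine ⟨hp.le_val.trans (val_one_le h hp (hp.lt₁.le.trans ht.1) (ht.2.trans hp.lt₄.le)), ?_⟩
  rcases le_total t (x 1) with h1 | h1
  · rw [← hp.map_left]
    exact (anti_zero h).antitoneOn (mem_zero h hp.lt₁.le hp.lt₂.le)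
      (mem_zero h (hp.lt₁.le.trans ht.1) h1) ht.1
  · rw [← hp.map_right]
    exact (mono_one h).monotoneOn ⟨h1, ht.2.trans hp.lt₄.le⟩ ⟨hp.lt₃.le, hp.lt₄.le⟩ ht.2

/-- The weight adapted to a plateau around a fixed point. -/
noncomputable def weight (p' p β : ℝ) (t : ℝ) : ℝ := if t < p' then β else if p < t then 1 else 0

lemma transfer_le (h : NearCheb b (-1) η v f x) (hp : FixedPlateau f x p' p)
    {β y : ℝ} (hβ : 0 ≤ β) (hn : ∀ j ≤ b + 1, f (x j) ≠ y) (hy : y ∉ Icc p' p) :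
    ∑ t ∈ h.finiteLapMap.fibre y, weight p' p β t ≤
      if y < p' then (b - 1 : ℝ) else if 1 - η < y then β + b - 2 else β + b := by
  have hb := h.two_le
  have hw : ∀ t, x 2 < t → weight p' p β t = 1 := fun t ht => by
    have h1 := hp.lt₂; have h2 := hp.lt₃; have h3 := hp.lt₄
    rw [weight, if_neg (by linarith), if_pos (by linarith)]
  have hlap : ∀ j, 2 ≤ j → j ≤ b → ∀ t ∈ Ioo (x j) (x (j + 1)), weight p' p β t = 1 :=
    fun j h2 hj t ht => hw t ((h.node_le h2 (by omega)).trans_lt ht.1)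
  split_ifs with h1 h2
  · refine (h.sum_fibre_le (K := fun j => if j ≤ 1 then 0 else 1) hn
      (fun j _ => by split_ifs <;> norm_num) ?_).trans
      (le_of_eq ?_)
    · intro j hj t ht hty
      by_cases hj1 : j ≤ 1
      · exfalso
        have hle := val_one_le h hp (t := t) ?_ ?_
        · have := hp.le_val
          rw [hty] at hle
          linarith
        · exact (h.node_mem (j := j) (by omega)).1.trans ht.1.le
        · exact ht.2.le.trans (h.node_le (by omega) (by omega))
      · rw [if_neg hj1, hlap j (by omega) hj t ht]
    · rw [sum_laps_ones _ hb (fun j h3 _ => by rw [if_neg (by omega)])]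
      norm_num
      ring
  all_goals
    have hpy : p < y := by
      by_contra hc
      exact hy ⟨not_lt.1 h1, not_lt.1 hc⟩
    have hK0 : ∀ t ∈ Ioo (x 0) (x 1), f t = y → weight p' p β t ≤ β := fun t ht hty => by
      have : t < p' := by
        by_contra hc
        have := (anti_zero h).antitoneOn (mem_zero h hp.lt₁.le hp.lt₂.le)
          (Ioo_subset_Icc_self ht) (not_lt.1 hc)
        rw [hty, hp.map_left] at this
        linarith
      rw [weight, if_pos this]
  · refine (h.sum_fibre_le (K := fun j => if j = 0 then β else if j ≤ 2 then 0 else 1) hn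
      (fun j _ => by split_ifs <;> linarith) ?_).trans (le_of_eq ?_)
    · intro j hj t ht hty
      rcases Nat.lt_or_ge j 3 with h3 | h3
      · interval_cases j
        · simpa using hK0 t ht hty
        · have := h.lt_of_mem_lap_one ht
          rw [hty] at this
          linarith
        · have := h.lt_of_mem_lap_two ht
          rw [hty] at this
          linarith
      · rw [if_neg (by omega), if_neg (by omega), hlap j (by omega) hj t ht]
    · rw [sum_laps_ones _ hb (fun j h3 _ => by rw [if_neg (by omega), if_neg (by omega)])]
      norm_num
      ring
  · refine (h.sum_fibre_le (K := fun j => if j = 0 then β else 1) hn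
      (fun j _ => by split_ifs <;> linarith) ?_).trans (le_of_eq ?_)
    · intro j hj t ht hty
      rcases Nat.lt_or_ge j 2 with h3 | h3
      · interval_cases j
        · simpa using hK0 t ht hty
        · have : p < t := by
            by_contra hc
            have := (mono_one h).monotoneOn (Ioo_subset_Icc_self ht) ⟨hp.lt₃.le, hp.lt₄.le⟩
              (not_lt.1 hc)
            rw [hty, hp.map_right] at this
            linarith
          have h1 := hp.lt₂; have h2 := hp.lt₃
          rw [weight, if_neg (by linarith), if_pos this]
          norm_num
      · rw [if_neg (by omega), hlap j (by omega) hj t ht]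
    · rw [sum_laps_ones _ hb (fun j h3 _ => by rw [if_neg (by omega)])]
      norm_num
      ring

lemma le_transfer (h : NearCheb b (-1) η v f x) (hp : FixedPlateau f x p' p)
    {β y : ℝ} (hβ : 0 ≤ β) (hy1 : -1 < y) (hy2 : y < 1) (hyη : y ≠ 1 - η)
    (hy : y ∉ Icc p' p) :
    (if y < p' then (b - 1 : ℝ) else if 1 - η < y then β + b - 2 else β + b) ≤
      ∑ t ∈ h.finiteLapMap.fibre y, weight p' p β t := by
  have hb := h.two_le
  have hω : ∀ t ∈ Icc (-1 : ℝ) 1, 0 ≤ weight p' p β t := fun t _ => by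
    rw [weight]; split_ifs <;> linarith
  have hw : ∀ t, x 2 < t → weight p' p β t = 1 := fun t ht => by
    have h1 := hp.lt₂; have h2 := hp.lt₃; have h3 := hp.lt₄
    rw [weight, if_neg (by linarith), if_pos (by linarith)]
  have hlap : ∀ j, 2 ≤ j → j ≤ b → ∀ t ∈ Ioo (x j) (x (j + 1)), weight p' p β t = 1 :=
    fun j h2 hj t ht => hw t ((h.node_le h2 (by omega)).trans_lt ht.1)
  have hmid : ∀ j, 2 ≤ j → j ≤ b → (2 < j ∨ y < 1 - η) →
      ∃ t ∈ Ioo (x j) (x (j + 1)), f t = y ∧ 1 ≤ weight p' p β t := by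
    intro j h2 hj hor
    obtain ⟨t, ht, hty⟩ := h.exists_mem_lap h2 hj (y := y) (by linarith)
      (hor.imp (fun h3 => ⟨h3, by linarith⟩) fun h3 => by linarith)
    exact ⟨t, ht, hty, (hlap j h2 hj t ht).ge⟩
  have hlt := lt_one_sub h hp
  have h12 := hp.lt₂; have h23 := hp.lt₃; have h34 := hp.lt₄
  split_ifs with h1 h2
  · refine (le_of_eq ?_).trans (h.le_sum_fibre (K := fun j => if j ≤ 1 then 0 else 1) hω ?_)
    · rw [sum_laps_ones _ hb (fun j h3 _ => by rw [if_neg (by omega)])]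
      norm_num
      ring
    · intro j hj
      by_cases hj1 : j ≤ 1
      · left; simp [hj1]
      · right
        rw [if_neg hj1]
        exact hmid j (by omega) hj (Or.inr (by linarith))
  all_goals
    have hpy : p < y := by
      by_contra hc
      exact hy ⟨not_lt.1 h1, not_lt.1 hc⟩
    have hK0 : ∃ t ∈ Ioo (x 0) (x 1), f t = y ∧ β ≤ weight p' p β t := by
      obtain ⟨t, ht, hty⟩ := h.exists_between (u := x 0) (w := p') (y := y)
        (by rw [h.first]; exact hp.lt₁) (Or.inl (by rw [h.val_zero, hp.map_left]; constructor <;> linarith))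
      exact ⟨t, ⟨ht.1, ht.2.trans hp.lt₂⟩, hty, by rw [weight, if_pos ht.2]⟩
  · refine (le_of_eq ?_).trans
      (h.le_sum_fibre (K := fun j => if j = 0 then β else if j ≤ 2 then 0 else 1) hω ?_)
    · rw [sum_laps_ones _ hb (fun j h3 _ => by rw [if_neg (by omega), if_neg (by omega)])]
      norm_num
      ring
    · intro j hj
      rcases Nat.eq_zero_or_pos j with rfl | hj0
      · right; simpa using hK0
      · rw [if_neg (by omega)]
        by_cases hj2 : j ≤ 2
        · left; simp [hj2]
        · right; rw [if_neg hj2]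
          exact hmid j (by omega) hj (Or.inl (by omega))
  · have hyη' : y < 1 - η := lt_of_le_of_ne (not_lt.1 h2) hyη
    refine (le_of_eq ?_).trans
      (h.le_sum_fibre (K := fun j => if j = 0 then β else 1) hω ?_)
    · rw [sum_laps_ones _ hb (fun j h3 _ => by rw [if_neg (by omega)])]
      norm_num
      ring
    · intro j hj
      right
      rcases Nat.eq_zero_or_pos j with rfl | hj0
      · simpa using hK0
      · rw [if_neg (by omega)]
        by_cases hj2 : j = 1
        · subst hj2
          obtain ⟨t, ht, hty⟩ := h.exists_between (u := p) (w := x 2) (y := y) hp.lt₄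
            (Or.inr (by rw [h.val_two, hp.map_right]; constructor <;> linarith))
          refine ⟨t, ⟨hp.lt₃.trans ht.1, ht.2⟩, hty, ?_⟩
          rw [weight, if_neg (by linarith [ht.1]), if_pos ht.1]
        · exact hmid j (by omega) hj (Or.inr hyη')

lemma htop_le (h : NearCheb b (-1) η v f x) (hp : FixedPlateau f x p' p) {μ : ℝ} {k : ℕ}
    {S : ℕ → Set ℝ} (hμ : b < μ) (hs : ((b - 1) / μ + b - μ) * μ ^ k < 2)
    (hS0 : S 0 = endNhd 1 η)
    (hS : ∀ n < k, ∀ y ∈ S (n + 1), y ∈ Icc (-1 : ℝ) 1 → ∃ x ∈ S n, x ∈ Icc (-1 : ℝ) 1 ∧ f x = y)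
    (hR : Ioc p 1 ⊆ S k)
    (hloc : 3 ≤ b ∧ (∀ n < k, ∀ t ∈ S n, p' ≤ t) ∨ Even k ∧
      ∀ n < k, (Even n → ∀ t ∈ S n, p' ≤ t) ∧ (Odd n → ∀ t ∈ S n, t ≤ p)) :
    htop f ≤ (Real.log μ : ℝ) := by
  have hb : (2 : ℝ) ≤ b := by exact_mod_cast h.two_le
  have hμ0 : 0 < μ := by linarith
  have hμk : 0 < μ ^ k := by positivity
  set β : ℝ := (b - 1) / μ with hβ
  have hβ0 : 0 < β := div_pos (by linarith) hμ0
  have hμβ : μ * β = b - 1 := by rw [hβ]; field_simp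
  have hs' : β + b - μ < 2 * (μ ^ k)⁻¹ := by
    rw [← div_eq_mul_inv, lt_div_iff₀ hμk]; exact hs
  have hlt := lt_one_sub h hp
  have h12 := hp.lt₂; have h23 := hp.lt₃
  have hpp : p' < p := h12.trans h23
  obtain ⟨m, hm, hm1, hm2⟩ : ∃ m > 0, (∀ t < p', m + tailWeight S μ k t ≤ β) ∧
      ∀ t > p, m + tailWeight S μ k t ≤ 1 := by
    suffices ∃ t₁ t₂ : ℝ, t₁ < β ∧ t₂ < 1 ∧ (∀ t < p', tailWeight S μ k t ≤ t₁) ∧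
        ∀ t > p, tailWeight S μ k t ≤ t₂ by
      obtain ⟨t₁, t₂, h1, h2, h3, h4⟩ := this
      refine ⟨min (β - t₁) (1 - t₂), lt_min (by linarith) (by linarith), fun t ht => ?_,
        fun t ht => ?_⟩
      · linarith [h3 t ht, min_le_left (β - t₁) (1 - t₂)]
      · linarith [h4 t ht, min_le_right (β - t₁) (1 - t₂)]
    have hinv : 0 < (μ ^ k)⁻¹ := by positivity
    rcases hloc with ⟨hb3, hloc⟩ | ⟨⟨l, hl⟩, hloc⟩
    · have hb3 : (3 : ℝ) ≤ b := by exact_mod_cast hb3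
      refine ⟨0, _, hβ0, ?_, fun t ht => ?_, fun t _ => tailWeight_le S (by linarith) k t⟩
      · rw [div_lt_one (by linarith)]
        linarith
      · exact (tailWeight_eq_zero fun n hn hmem => by linarith [hloc n hn t hmem]).le
    · have hk : k = 2 * l := by omega
      have hμ2 : 0 < μ ^ 2 - 1 := by nlinarith
      have key : 2 * μ * (1 - (μ ^ k)⁻¹) < μ ^ 2 - 1 := by
        have : μ * (β + b - μ) = b - 1 + b * μ - μ ^ 2 := by linear_combination hμβ
        nlinarith
      subst hk
      refine ⟨_, _, ?_, ?_,
        fun t ht => tailWeight_odd_le (by linarith) fun n hn he hmem => ?_,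
        fun t ht => tailWeight_even_le (by linarith) fun n hn ho hmem => ?_⟩
      · rw [div_lt_iff₀ hμ2, ← mul_lt_mul_iff_right₀ hμ0, ← mul_assoc μ β, hμβ]
        nlinarith
      · rwa [div_lt_one hμ2]
      · linarith [(hloc n hn).1 he t hmem]
      · linarith [(hloc n hn).2 ho t hmem]
  set B := forwardOrbit f (x '' Icc 0 (b + 1)) with hB
  refine h.finiteLapMap.htop_le_of_weight (B := B) (J := Icc p' p) (R := Ioc p 1) (S := S)
    (ω := weight p' p β) (s := β + b - μ) (M := max β 1)
    (forwardOrbit_countable f (((finite_Icc _ _).image _).countable))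
    (fun t _ ht => map_mem_forwardOrbit ht) (fun t => map_mem h hp) h.card_fibre_le
    (ncard_le_two_of_injOn _ (A := Icc (x 0) (x 1)) (B := Icc (x 1) (x 2)) ?_
      (h.injOn (Nat.zero_le b)) (h.injOn (by have := h.two_le; omega)))
    (by linarith) ?_ hS (fun y _ _ hy => hR hy) hs.le hm ?_
  · intro t ht
    rcases le_total t (x 1) with h1 | h1
    · exact Or.inl ⟨by rw [h.first]; exact hp.lt₁.le.trans ht.1, h1⟩
    · exact Or.inr ⟨h1, ht.2.trans hp.lt₄.le⟩
  · intro y hyI hyB hyJ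
    refine (transfer_le h hp hβ0.le (fun j hj =>
      ne_of_notMem_forwardOrbit hyB ⟨j, ⟨Nat.zero_le j, hj⟩, rfl⟩) hyJ).trans (le_of_eq ?_)
    have hind := indicator_mem_endNhd hyI (η := η)
    rw [hS0]
    split_ifs with h1 h2
    · rw [weight, if_pos h1, indicator_of_notMem (fun h : y ∈ Ioc p 1 => by linarith [h.1]),
        hind.2 (by linarith)]
      linarith
    all_goals
      have hpy : p < y := by
        by_contra hc
        exact hyJ ⟨not_lt.1 h1, not_lt.1 hc⟩
      rw [weight, if_neg h1, if_pos hpy, indicator_of_mem (show y ∈ Ioc p 1 from ⟨hpy, hyI.2⟩)]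
    · rw [hind.1 h2]; simp only [Pi.one_apply]; ring
    · rw [hind.2 (not_lt.1 h2)]; simp only [Pi.one_apply]; ring
  · intro t ht htJ
    rw [weight]
    split_ifs with h1 h2
    · exact ⟨hm1 t h1, le_max_left _ _⟩
    · exact ⟨hm2 t h2, le_max_right _ _⟩
    · exact absurd ⟨not_lt.1 h1, not_lt.1 h2⟩ htJ

lemma le_htop (h : NearCheb b (-1) η v f x) (hp : FixedPlateau f x p' p) {μ : ℝ} {k : ℕ}
    {S : ℕ → Set ℝ} (hμ : b < μ) (hs : 2 ≤ ((b - 1) / μ + b - μ) * μ ^ k)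
    (hS0 : S 0 = endNhd 1 η) (hinj : ∀ n < k, InjOn f (S n))
    (hS : ∀ n < k, ∀ t ∈ S n, f t ∈ S (n + 1)) (hR : S k ⊆ Ioc p 1)
    (hloc : ∀ n < k, ∀ t ∈ S n, t ∉ Ioo (x 1) (x 2)) :
    (Real.log μ : ℝ) ≤ htop f := by
  have hb : (2 : ℝ) ≤ b := by exact_mod_cast h.two_le
  have hμ0 : 0 < μ := by linarith
  set β : ℝ := (b - 1) / μ with hβ
  have hβ0 : 0 < β := div_pos (by linarith) hμ0
  have hμβ : μ * β = b - 1 := by rw [hβ]; field_simp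
  have hlt := lt_one_sub h hp
  have h12 := hp.lt₂; have h23 := hp.lt₃
  have hpp : p' < p := h12.trans h23
  set Z : Set ℝ := {-1, 1, 1 - η} with hZ
  have hZc : (forwardOrbit f Z).Countable :=
    forwardOrbit_countable f (Set.Finite.countable (by simp [hZ]))
  obtain ⟨y₀, hy₀, hpy₀, hy₀x⟩ := (hZc.dense_compl ℝ).exists_between hp.lt₄
  have hx2 := h.node_mem (j := 2) (by have := h.two_le; omega)
  have hp1 := hp.lt₁
  refine h.finiteLapMap.le_htop_of_weight (B := forwardOrbit f Z ∪ Icc p' p) (R := Ioc p 1) (S := S)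
    (ω := weight p' p β) (s := β + b - μ) (M := max β 1) (y₀ := y₀) ?_ (by linarith) ?_ hinj hS hR hs
    ?_ ⟨by linarith, by linarith [hx2.2]⟩ ?_ ?_
  · rintro t - (ht | ht)
    · exact Or.inl (map_mem_forwardOrbit ht)
    · exact Or.inr (map_mem h hp ht)
  · intro y hyI hyB
    rw [mem_union, not_or] at hyB
    have hne : ∀ z ∈ Z, y ≠ z := fun z hz hyz => hyB.1 (subset_forwardOrbit f Z (hyz ▸ hz))
    refine (le_of_eq ?_).trans (le_transfer h hp hβ0.le
      (lt_of_le_of_ne hyI.1 (hne (-1) (by simp [hZ])).symm)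
      (lt_of_le_of_ne hyI.2 (hne 1 (by simp [hZ]))) (hne (1 - η) (by simp [hZ])) hyB.2)
    have hind := indicator_mem_endNhd hyI (η := η)
    rw [hS0]
    split_ifs with h1 h2
    · rw [weight, if_pos h1, indicator_of_notMem (fun h : y ∈ Ioc p 1 => by linarith [h.1]),
        hind.2 (by linarith)]
      linarith
    all_goals
      have hpy : p < y := by
        by_contra hc
        exact hyB.2 ⟨not_lt.1 h1, not_lt.1 hc⟩
      rw [weight, if_neg h1, if_pos hpy, indicator_of_mem (show y ∈ Ioc p 1 from ⟨hpy, hyI.2⟩)]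
    · rw [hind.1 h2]; simp only [Pi.one_apply]; ring
    · rw [hind.2 (not_lt.1 h2)]; simp only [Pi.one_apply]; ring
  · intro t _
    rw [weight]
    split_ifs
    · exact le_max_left _ _
    · exact le_max_right _ _
    · exact le_max_of_le_right zero_le_one
  · rintro (h1 | h1)
    · exact hy₀ h1
    · linarith [h1.2]
  · rw [tailWeight_eq_zero fun n hn hmem => hloc n hn y₀ hmem ⟨by linarith, hy₀x⟩, weight,
      if_neg (by linarith), if_pos hpy₀]
    exact one_pos

end FixedPlateau

/-- The first turning point of an increasing-first map lies in an interval `[p', p]` which is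
exchanged with the interval `[r, v]` inside the last lap. -/
structure CyclePlateau (b : ℕ) (η v : ℝ) (f : ℝ → ℝ) (x : ℕ → ℝ) (p' p r : ℝ) : Prop where
  eta_lt : -1 + η < p'
  lt₂ : p' < x 1
  lt₃ : x 1 < p
  lt₄ : p < x 2
  map_left : f p' = r
  map_right : f p = r
  lt_r : x b < r
  val_lt : v < 1
  map_top : Even b ∧ f r = p' ∧ f v ≤ p ∨ Odd b ∧ f r = p ∧ p' ≤ f v

namespace CyclePlateau

variable {b : ℕ} {η v : ℝ} {f : ℝ → ℝ} {x : ℕ → ℝ} {p' p r : ℝ}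

lemma mono_zero (h : NearCheb b 1 η v f x) : StrictMonoOn f (Icc (x 0) (x 1)) := by
  simpa using h.mono_even (Nat.zero_le b) Even.zero

lemma anti_one (h : NearCheb b 1 η v f x) : StrictAntiOn f (Icc (x 1) (x 2)) := by
  simpa using h.anti_odd (j := 1) (by have := h.two_le; omega) odd_one

lemma val_one_eq (h : NearCheb b 1 η v f x) : f (x 1) = v := by simpa using h.val_one

lemma lt₁ (h : NearCheb b 1 η v f x) (hp : CyclePlateau b η v f x p' p r) : -1 < p' := by
  linarith [h.eta_nonneg, hp.eta_lt]

lemma left_mem (h : NearCheb b 1 η v f x) (hp : CyclePlateau b η v f x p' p r) :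
    p' ∈ Icc (x 0) (x 1) := ⟨by rw [h.first]; exact (lt₁ h hp).le, hp.lt₂.le⟩

lemma right_mem (hp : CyclePlateau b η v f x p' p r) : p ∈ Icc (x 1) (x 2) :=
  ⟨hp.lt₃.le, hp.lt₄.le⟩

lemma r_lt (h : NearCheb b 1 η v f x) (hp : CyclePlateau b η v f x p' p r) : r < v := by
  have := mono_zero h (left_mem h hp) ⟨(h.lt 0 (Nat.zero_le b)).le, le_rfl⟩ hp.lt₂
  rwa [hp.map_left, val_one_eq h] at this

lemma node_two_lt (h : NearCheb b 1 η v f x) (hp : CyclePlateau b η v f x p' p r) : x 2 < r :=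
  (h.node_le h.two_le (by omega)).trans_lt hp.lt_r

lemma map_mem_top (h : NearCheb b 1 η v f x) (hp : CyclePlateau b η v f x p' p r) {t : ℝ}
    (ht : t ∈ Icc p' p) : f t ∈ Icc r v := by
  have h01 := h.lt 0 (Nat.zero_le b)
  have h12 := h.lt 1 (by have := h.two_le; omega)
  rw [← val_one_eq h]
  rcases le_total t (x 1) with h1 | h1
  · have htm : t ∈ Icc (x 0) (x 1) := ⟨(left_mem h hp).1.trans ht.1, h1⟩
    refine ⟨?_, (mono_zero h).monotoneOn htm ⟨h01.le, le_rfl⟩ h1⟩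
    rw [← hp.map_left]
    exact (mono_zero h).monotoneOn (left_mem h hp) htm ht.1
  · have htm : t ∈ Icc (x 1) (x 2) := ⟨h1, ht.2.trans hp.lt₄.le⟩
    refine ⟨?_, (anti_one h).antitoneOn ⟨le_rfl, h12.le⟩ htm h1⟩
    rw [← hp.map_right]
    exact (anti_one h).antitoneOn htm (right_mem hp) ht.2

lemma top_subset (h : NearCheb b 1 η v f x) (hp : CyclePlateau b η v f x p' p r) :
    Icc r v ⊆ Icc (x b) (x (b + 1)) :=
  Icc_subset_Icc hp.lt_r.le (by rw [h.last]; exact hp.val_lt.le)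

lemma map_mem_bot (h : NearCheb b 1 η v f x) (hp : CyclePlateau b η v f x p' p r) {t : ℝ}
    (ht : t ∈ Icc r v) : f t ∈ Icc p' p := by
  have hr := left_mem_Icc.2 (r_lt h hp).le
  have hv := right_mem_Icc.2 (r_lt h hp).le
  have hsub := top_subset h hp
  rcases hp.map_top with ⟨he, h1, h2⟩ | ⟨ho, h1, h2⟩
  · have hm : MonotoneOn f (Icc (x b) (x (b + 1))) := by
      simpa using (h.mono_even le_rfl he).monotoneOn
    exact ⟨h1 ▸ hm (hsub hr) (hsub ht) ht.1, (hm (hsub ht) (hsub hv) ht.2).trans h2⟩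
  · have hm : AntitoneOn f (Icc (x b) (x (b + 1))) := by
      simpa using (h.anti_odd le_rfl ho).antitoneOn
    exact ⟨h2.trans (hm (hsub ht) (hsub hv) ht.2), h1 ▸ hm (hsub hr) (hsub ht) ht.1⟩

lemma map_mem (h : NearCheb b 1 η v f x) (hp : CyclePlateau b η v f x p' p r) {t : ℝ}
    (ht : t ∈ Icc p' p ∪ Icc r v) : f t ∈ Icc p' p ∪ Icc r v :=
  ht.elim (fun ht => Or.inr (map_mem_top h hp ht)) fun ht => Or.inl (map_mem_bot h hp ht)

lemma ncard_le_two (h : NearCheb b 1 η v f x) (hp : CyclePlateau b η v f x p' p r) (y : ℝ) :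
    ({t ∈ (h.finiteLapMap.fibre y : Set ℝ) | t ∈ Icc p' p ∪ Icc r v}).ncard ≤ 2 := by
  have h4 := hp.lt₄
  have h2 := node_two_lt h hp
  have hfin : ∀ A : Set ℝ, {t ∈ (h.finiteLapMap.fibre y : Set ℝ) | t ∈ A}.Finite := fun A =>
    (Finset.finite_toSet _).subset fun t ht => ht.1
  by_cases hy : y ∈ Icc p' p
  · refine (Set.ncard_le_ncard (t := {t ∈ (h.finiteLapMap.fibre y : Set ℝ) | t ∈ Icc r v}) ?_
      (hfin _)).trans (ncard_le_two_of_injOn _ (A := Icc r v) (B := ∅) (by simp)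
        ((h.injOn le_rfl).mono (top_subset h hp)) (injOn_empty _) y)
    rintro t ⟨ht, htJ | htJ⟩
    · have := map_mem_top h hp htJ
      rw [(h.finiteLapMap.mem_fibre.1 ht).2] at this
      linarith [this.1, hy.2]
    · exact ⟨ht, htJ⟩
  · refine (Set.ncard_le_ncard (t := {t ∈ (h.finiteLapMap.fibre y : Set ℝ) | t ∈ Icc p' p}) ?_
      (hfin _)).trans (ncard_le_two_of_injOn _ (A := Icc (x 0) (x 1)) (B := Icc (x 1) (x 2)) ?_
        (h.injOn (Nat.zero_le b)) (h.injOn (by have := h.two_le; omega)) y)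
    · rintro t ⟨ht, htJ | htJ⟩
      · exact ⟨ht, htJ⟩
      · have := map_mem_bot h hp htJ
        rw [(h.finiteLapMap.mem_fibre.1 ht).2] at this
        exact absurd this hy
    · intro t ht
      rcases le_total t (x 1) with h1 | h1
      · exact Or.inl ⟨(left_mem h hp).1.trans ht.1, h1⟩
      · exact Or.inr ⟨h1, ht.2.trans hp.lt₄.le⟩

/-- The weight adapted to a plateau of period two. -/
noncomputable def weight (p' p r v α β : ℝ) (t : ℝ) : ℝ :=
  if t < p' then α else if t ≤ p then 0 else if t < r then 1 else if t ≤ v then 0 else β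

/-- The weights of the two outer parts of the last lap, ordered by the position of their
images: those below `p'`, and those above `p`. -/
def LastWeights (b : ℕ) (β κ₁ κ₂ : ℝ) : Prop :=
  Even b ∧ κ₁ = 1 ∧ κ₂ = β ∨ Odd b ∧ κ₁ = β ∧ κ₂ = 1

/-- Contribution of the lap `j` to the transfer operator at `y`. -/
noncomputable def lapWeight (b : ℕ) (p' r η α κ₁ κ₂ y : ℝ) (j : ℕ) : ℝ :=
  if j = 0 then (if y < r then α else 0)
  else if j = 1 then (if -1 + η ≤ y ∧ y < r then 1 else 0)
  else if j = 2 ∧ y < -1 + η then 0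
  else if j = b then (if y < p' then κ₁ else κ₂)
  else 1

lemma sum_lapWeight (hb : 2 ≤ b) {α β κ₁ κ₂ y : ℝ} (hκ : LastWeights b β κ₁ κ₂)
    (h1 : -1 + η < p') (h2 : p' < r) :
    ∑ j ∈ Finset.range (b + 1), lapWeight b p' r η α κ₁ κ₂ y j =
      if y < p' then α + (b - 1) + κ₁ - 2 * (if y < -1 + η then 1 else 0)
      else if y < r then α + (b - 1) + κ₂ else b - 2 + κ₂ := by
  simp only [lapWeight]
  generalize -1 + η = e at *
  rcases hb.eq_or_lt with rfl | hb3
  · have hκ1 : κ₁ = 1 := by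
      rcases hκ with h | h
      · exact h.2.1
      · exact absurd h.1 (by decide)
    rw [sum_laps _ le_rfl]
    norm_num
    rcases lt_or_ge y e with h3 | h3
    · simp [h3, not_le.2 h3, h3.trans h1, (h3.trans h1).trans h2, hκ1]; ring
    · rcases lt_or_ge y p' with h4 | h4
      · simp [h3, not_lt.2 h3, h4, h4.trans h2]
      · rcases lt_or_ge y r with h5 | h5
        · simp [h3, not_lt.2 h3, not_lt.2 h4, h5]
        · simp [h3, not_lt.2 h3, not_lt.2 h4, not_lt.2 h5]
  · rw [sum_laps_last _ hb3 fun j hj3 hjb => by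
      rw [if_neg (by omega), if_neg (by omega), if_neg (by omega), if_neg (by omega)]]
    have e1 : b ≠ 0 := by omega
    have e2 : b ≠ 1 := by omega
    have e3 : b ≠ 2 := by omega
    have e4 : 2 ≠ b := by omega
    simp only [e1, e2, e3, e4, if_false, if_true, false_and]
    norm_num
    rcases lt_or_ge y e with h3 | h3
    · simp [h3, not_le.2 h3, h3.trans h1, (h3.trans h1).trans h2]; ring
    · rcases lt_or_ge y p' with h4 | h4
      · simp [h3, not_lt.2 h3, h4, h4.trans h2]; ring
      · rcases lt_or_ge y r with h5 | h5
        · simp [h3, not_lt.2 h3, not_lt.2 h4, h5]; ring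
        · simp [h3, not_lt.2 h3, not_lt.2 h4, not_lt.2 h5]; ring

lemma transfer_le (h : NearCheb b 1 η v f x) (hp : CyclePlateau b η v f x p' p r)
    {α β κ₁ κ₂ y : ℝ} (hα : 0 ≤ α) (hβ : 0 ≤ β) (hκ : LastWeights b β κ₁ κ₂)
    (hn : ∀ j ≤ b + 1, f (x j) ≠ y) (hy : y ∉ Icc p' p ∪ Icc r v) :
    ∑ t ∈ h.finiteLapMap.fibre y, weight p' p r v α β t ≤
      if y < p' then α + (b - 1) + κ₁ - 2 * (if y < -1 + η then 1 else 0)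
      else if y < r then α + (b - 1) + κ₂ else b - 2 + κ₂ := by
  have hb := h.two_le
  have h12 := hp.lt₂; have h23 := hp.lt₃; have h34 := hp.lt₄
  have h45 := node_two_lt h hp
  have hrv := r_lt h hp
  have hpy : p' ≤ y → p < y := fun h1 => by
    by_contra hc
    exact hy (Or.inl ⟨h1, not_lt.1 hc⟩)
  have hrr : r ≤ y → v < y := fun h1 => by
    by_contra hc
    exact hy (Or.inr ⟨h1, not_lt.1 hc⟩)
  have h01 := h.lt 0 (Nat.zero_le b)
  rw [← sum_lapWeight hb hκ hp.eta_lt (by linarith)]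
  have hκ0 : 0 ≤ κ₁ ∧ 0 ≤ κ₂ := by
    rcases hκ with ⟨_, h1, h2⟩ | ⟨_, h1, h2⟩ <;> rw [h1, h2] <;> constructor <;> linarith
  refine h.sum_fibre_le hn (fun j _ => by rw [lapWeight]; split_ifs <;> linarith) ?_
  intro j hj t ht hty
  rw [lapWeight]
  split_ifs with c0 c0' c1 c1' c2 c3 c3'
  · subst c0
    have : t < p' := by
      by_contra hc
      have := (mono_zero h).monotoneOn (left_mem h hp) (Ioo_subset_Icc_self ht) (not_lt.1 hc)
      rw [hty, hp.map_left] at this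
      linarith
    rw [weight, if_pos this]
  · subst c0
    have := mono_zero h (Ioo_subset_Icc_self ht) ⟨h01.le, le_rfl⟩ ht.2
    rw [hty, val_one_eq h] at this
    linarith [hrr (not_lt.1 c0')]
  · subst c1
    have h1 : p < t := by
      by_contra hc
      have := (anti_one h).antitoneOn (Ioo_subset_Icc_self ht) (right_mem hp) (not_lt.1 hc)
      rw [hty, hp.map_right] at this
      linarith
    have h2 : t < x 2 := ht.2
    rw [weight, if_neg (by linarith), if_neg (by linarith), if_pos (by linarith)]
  · subst c1
    exfalso
    have h1 := h.lt_of_mem_lap_one ht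
    rw [hty, one_mul] at h1
    have h2 := anti_one h ⟨le_rfl, by linarith⟩ (Ioo_subset_Icc_self ht) ht.1
    rw [hty, val_one_eq h] at h2
    refine c1' ⟨h1.le, ?_⟩
    by_contra hc
    linarith [hrr (not_lt.1 hc)]
  · obtain ⟨rfl, c2⟩ := c2
    have h1 := h.lt_of_mem_lap_two ht
    rw [hty, one_mul] at h1
    linarith
  · subst c3
    have hxt : x 2 < t := (h.node_le hb (by omega)).trans_lt ht.1
    rcases hκ with ⟨he, h1, -⟩ | ⟨ho, h1, -⟩
    · have hm := (h.mono_even le_rfl he).monotoneOn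
      have htr : t < r := by
        by_contra hc
        have := hm (top_subset h hp (left_mem_Icc.2 hrv.le)) (Ioo_subset_Icc_self ht) (not_lt.1 hc)
        simp only [one_mul, hty] at this
        have h3 := map_mem_bot h hp (left_mem_Icc.2 hrv.le)
        linarith [h3.1]
      rw [weight, if_neg (by linarith), if_neg (by linarith), if_pos htr, h1]
    · have hm := (h.anti_odd le_rfl ho).antitoneOn
      have htr : v < t := by
        by_contra hc
        have := hm (Ioo_subset_Icc_self ht) (top_subset h hp (right_mem_Icc.2 hrv.le)) (not_lt.1 hc)
        simp only [one_mul, hty] at this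
        have h3 := map_mem_bot h hp (right_mem_Icc.2 hrv.le)
        linarith [h3.1]
      rw [weight, if_neg (by linarith), if_neg (by linarith), if_neg (by linarith),
        if_neg (by linarith), h1]
  · subst c3
    have hxt : x 2 < t := (h.node_le hb (by omega)).trans_lt ht.1
    have hpy := hpy (not_lt.1 c3')
    rcases hκ with ⟨he, -, h1⟩ | ⟨ho, -, h1⟩
    · have hm := (h.mono_even le_rfl he).monotoneOn
      have htr : v < t := by
        by_contra hc
        have := hm (Ioo_subset_Icc_self ht) (top_subset h hp (right_mem_Icc.2 hrv.le)) (not_lt.1 hc)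
        simp only [one_mul, hty] at this
        have h3 := map_mem_bot h hp (right_mem_Icc.2 hrv.le)
        linarith [h3.2]
      rw [weight, if_neg (by linarith), if_neg (by linarith), if_neg (by linarith),
        if_neg (by linarith), h1]
    · have hm := (h.anti_odd le_rfl ho).antitoneOn
      have htr : t < r := by
        by_contra hc
        have := hm (top_subset h hp (left_mem_Icc.2 hrv.le)) (Ioo_subset_Icc_self ht) (not_lt.1 hc)
        simp only [one_mul, hty] at this
        have h3 := map_mem_bot h hp (left_mem_Icc.2 hrv.le)
        linarith [h3.2]
      rw [weight, if_neg (by linarith), if_neg (by linarith), if_pos htr, h1]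
  · have hxt : x 2 < t := (h.node_le (by omega) (by omega)).trans_lt ht.1
    have htx : t < x b := ht.2.trans_le (h.node_le (by omega) (by omega))
    have := hp.lt_r
    rw [weight, if_neg (by linarith), if_neg (by linarith), if_pos (by linarith)]

lemma le_transfer (h : NearCheb b 1 η v f x) (hp : CyclePlateau b η v f x p' p r)
    {α β κ₁ κ₂ y : ℝ} (hα : 0 ≤ α) (hβ : 0 ≤ β) (hκ : LastWeights b β κ₁ κ₂)
    (hy1 : -1 < y) (hy2 : y < 1) (hyη : y ≠ -1 + η) (hy : y ∉ Icc p' p ∪ Icc r v) :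
    (if y < p' then α + (b - 1) + κ₁ - 2 * (if y < -1 + η then 1 else 0)
      else if y < r then α + (b - 1) + κ₂ else b - 2 + κ₂) ≤
    ∑ t ∈ h.finiteLapMap.fibre y, weight p' p r v α β t := by
  have hb := h.two_le
  have h12 := hp.lt₂; have h23 := hp.lt₃; have h34 := hp.lt₄
  have h45 := node_two_lt h hp
  have hrv := r_lt h hp
  have hpy : p' ≤ y → p < y := fun h1 => by
    by_contra hc
    exact hy (Or.inl ⟨h1, not_lt.1 hc⟩)
  have h01 := h.lt 0 (Nat.zero_le b)
  rw [← sum_lapWeight hb hκ hp.eta_lt (by linarith)]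
  refine h.le_sum_fibre (fun t _ => by rw [weight]; split_ifs <;> linarith) ?_
  intro j hj
  rw [lapWeight]
  split_ifs with c0 c0' c1 c1' c2 c3 c3'
  · subst c0
    right
    obtain ⟨t, ht, hty⟩ := h.exists_between (u := x 0) (w := p') (y := y)
      (by rw [h.first]; exact lt₁ h hp)
      (Or.inl (by rw [h.val_zero, hp.map_left]; constructor <;> linarith))
    exact ⟨t, ⟨ht.1, ht.2.trans hp.lt₂⟩, hty, by rw [weight, if_pos ht.2]⟩
  · exact Or.inl le_rfl
  · subst c1
    right
    obtain ⟨t, ht, hty⟩ := h.exists_between (u := p) (w := x 2) (y := y) hp.lt₄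
      (Or.inr ⟨by rw [h.theta_val_two]; linarith [lt_of_le_of_ne c1'.1 hyη.symm],
        by rw [hp.map_right]; linarith⟩)
    refine ⟨t, ⟨hp.lt₃.trans ht.1, ht.2⟩, hty, ?_⟩
    have := ht.1; have := ht.2
    rw [weight, if_neg (by linarith), if_neg (by linarith), if_pos (by linarith)]
  · exact Or.inl le_rfl
  · exact Or.inl le_rfl
  · subst c3
    right
    have hxb : x 2 ≤ x j := h.node_le hb (by omega)
    have hxr := hp.lt_r
    rcases hκ with ⟨he, h1, -⟩ | ⟨ho, h1, -⟩
    · have hend : 1 * f (x j) < 1 * y := by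
        rcases hb.eq_or_lt with rfl | hb3
        · rw [h.theta_val_two, one_mul]
          exact lt_of_le_of_ne (by by_contra hc; exact c2 ⟨rfl, not_le.1 hc⟩) hyη.symm
        · rw [h.theta_val hb3 (by omega), he.add_one.neg_one_pow, one_mul]
          exact hy1
      obtain ⟨t, ht, hty⟩ := h.exists_between (u := x j) (w := r) (y := y) hp.lt_r
        (Or.inl ⟨hend, by rw [one_mul, one_mul]; linarith [(map_mem_bot h hp (left_mem_Icc.2 hrv.le)).1]⟩)
      have := ht.1; have := ht.2; have := hp.val_lt
      refine ⟨t, ⟨ht.1, by rw [h.last]; linarith⟩, hty, ?_⟩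
      rw [weight, if_neg (by linarith), if_neg (by linarith), if_pos (by linarith), h1]
    · have hend : 1 * f (x (j + 1)) < 1 * y := by
        rw [h.theta_val (by rcases ho with ⟨k, rfl⟩; omega) le_rfl, ho.add_one.add_one.neg_one_pow, one_mul]
        exact hy1
      obtain ⟨t, ht, hty⟩ := h.exists_between (u := v) (w := x (j + 1)) (y := y)
        (by rw [h.last]; exact hp.val_lt)
        (Or.inr ⟨hend, by rw [one_mul, one_mul]; linarith [(map_mem_bot h hp (right_mem_Icc.2 hrv.le)).1]⟩)
      have := ht.1
      refine ⟨t, ⟨by linarith, ht.2⟩, hty, ?_⟩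
      rw [weight, if_neg (by linarith), if_neg (by linarith), if_neg (by linarith),
        if_neg (by linarith), h1]
  · subst c3
    right
    have hpy := hpy (not_lt.1 c3')
    have hxb : x 2 ≤ x j := h.node_le hb (by omega)
    have hxr := hp.lt_r
    rcases hκ with ⟨he, -, h1⟩ | ⟨ho, -, h1⟩
    · have hend : 1 * y < 1 * f (x (j + 1)) := by
        rw [h.theta_val (by omega) le_rfl, he.add_one.add_one.neg_one_pow, one_mul]
        exact hy2
      obtain ⟨t, ht, hty⟩ := h.exists_between (u := v) (w := x (j + 1)) (y := y)
        (by rw [h.last]; exact hp.val_lt)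
        (Or.inl ⟨by rw [one_mul, one_mul]; linarith [(map_mem_bot h hp (right_mem_Icc.2 hrv.le)).2], hend⟩)
      have := ht.1
      refine ⟨t, ⟨by linarith, ht.2⟩, hty, ?_⟩
      rw [weight, if_neg (by linarith), if_neg (by linarith), if_neg (by linarith),
        if_neg (by linarith), h1]
    · have hend : 1 * y < 1 * f (x j) := by
        rw [h.theta_val_odd hb (by omega) ho, one_mul]
        exact hy2
      obtain ⟨t, ht, hty⟩ := h.exists_between (u := x j) (w := r) (y := y) hp.lt_r
        (Or.inr ⟨by rw [one_mul, one_mul]; linarith [(map_mem_bot h hp (left_mem_Icc.2 hrv.le)).2], hend⟩)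
      have := ht.1; have := ht.2; have := hp.val_lt
      refine ⟨t, ⟨ht.1, by rw [h.last]; linarith⟩, hty, ?_⟩
      rw [weight, if_neg (by linarith), if_neg (by linarith), if_pos (by linarith), h1]
  · right
    obtain ⟨t, ht, hty⟩ := h.exists_mem_lap (j := j) (y := y) (by omega) hj (by linarith) (by
      rw [not_and_or] at c2
      rcases c2 with c2 | c2
      · exact Or.inl ⟨by omega, by linarith⟩
      · right; rw [one_mul]; exact lt_of_le_of_ne (not_lt.1 c2) hyη.symm)
    have hxt : x 2 < t := (h.node_le (by omega) (by omega)).trans_lt ht.1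
    have htx : t < x b := ht.2.trans_le (h.node_le (by omega) (by omega))
    have := hp.lt_r
    exact ⟨t, ht, hty, by rw [weight, if_neg (by linarith), if_neg (by linarith), if_pos (by linarith)]⟩

end CyclePlateau

lemma indicator_mem_endNhd_neg {η y : ℝ} (hy : y ∈ Icc (-1 : ℝ) 1) :
    (endNhd (-1) η).indicator (1 : ℝ → ℝ) y = if y < -1 + η then 1 else 0 := by
  have habs : |y - -1| = y + 1 := by rw [abs_of_nonneg (by linarith [hy.1])]; ring
  split_ifs with h
  · exact indicator_of_mem (show y ∈ endNhd (-1) η from ⟨hy, by rw [habs]; linarith⟩) _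
  · refine indicator_of_notMem (fun hm : y ∈ endNhd (-1) η => ?_) _
    have := hm.2
    rw [habs] at this
    linarith

namespace CyclePlateau

variable {b : ℕ} {η v : ℝ} {f : ℝ → ℝ} {x : ℕ → ℝ} {p' p r : ℝ}

lemma htop_le_of_weights (h : NearCheb b 1 η v f x) (hp : CyclePlateau b η v f x p' p r)
    {μ α β κ₁ κ₂ : ℝ} {k : ℕ} {S : ℕ → Set ℝ} (hκ : LastWeights b β κ₁ κ₂) (hβ : 0 < β)
    (hμ : 2 < μ) (hmid : α + (b - 1) + κ₂ ≤ μ) (htp : b - 2 + κ₂ ≤ μ * β) (hκ2 : 2 ≤ b - 1 + κ₁)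
    (hs : (b - 1 + κ₁ - (μ - 1) * α) * μ ^ k < 2) (hS0 : S 0 = endNhd (-1) η)
    (hS : ∀ n < k, ∀ y ∈ S (n + 1), y ∈ Icc (-1 : ℝ) 1 → ∃ x ∈ S n, x ∈ Icc (-1 : ℝ) 1 ∧ f x = y)
    (hR : Ico (-1) p' ⊆ S k) (hloc : ∀ n < k, ∀ t ∈ S n, t ≤ p) :
    htop f ≤ (Real.log μ : ℝ) := by
  have hμ0 : 0 < μ := by linarith
  have hμk : 0 < μ ^ k := by positivity
  have hμk1 : 1 ≤ μ ^ k := one_le_pow₀ (by linarith)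
  have hinv : (μ ^ k)⁻¹ ≤ 1 := inv_le_one_of_one_le₀ hμk1
  have hs' : b - 1 + κ₁ - (μ - 1) * α < 2 * (μ ^ k)⁻¹ := by
    rw [← div_eq_mul_inv, lt_div_iff₀ hμk]; exact hs
  have hgap : 2 * (1 - (μ ^ k)⁻¹) / (μ - 1) < α := by
    rw [div_lt_iff₀ (by linarith)]; linarith
  have hα : 0 < α := lt_of_le_of_lt (div_nonneg (by linarith) (by linarith)) hgap
  have h12 := hp.lt₂; have h23 := hp.lt₃; have h34 := hp.lt₄
  have h45 := node_two_lt h hp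
  have hrv := r_lt h hp
  set m := min (α - 2 * (1 - (μ ^ k)⁻¹) / (μ - 1)) (min 1 β) with hm
  refine h.finiteLapMap.htop_le_of_weight (B := forwardOrbit f (x '' Icc 0 (b + 1)))
    (J := Icc p' p ∪ Icc r v) (R := Ico (-1) p') (S := S) (m := m)
    (ω := weight p' p r v α β) (s := b - 1 + κ₁ - (μ - 1) * α) (M := max α (max 1 β))
    (forwardOrbit_countable f (((finite_Icc _ _).image _).countable))
    (fun t _ ht => map_mem_forwardOrbit ht) (fun t => map_mem h hp) h.card_fibre_le
    (ncard_le_two h hp) hμ ?_ hS (fun y _ _ hy => hR hy) hs.le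
    (lt_min (by linarith) (lt_min one_pos hβ)) ?_
  · intro y hyI hyB hyJ
    refine (transfer_le h hp hα.le hβ.le hκ (fun j hj =>
      ne_of_notMem_forwardOrbit hyB ⟨j, ⟨Nat.zero_le j, hj⟩, rfl⟩) hyJ).trans ?_
    rw [hS0, indicator_mem_endNhd_neg hyI]
    have heta := hp.eta_lt
    have hpy : p' ≤ y → p < y := fun h1 => by
      by_contra hc
      exact hyJ (Or.inl ⟨h1, not_lt.1 hc⟩)
    have hrr : r ≤ y → v < y := fun h1 => by
      by_contra hc
      exact hyJ (Or.inr ⟨h1, not_lt.1 hc⟩)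
    split_ifs with h1 h2 h3 h4 h5
    · rw [weight, if_pos h1, indicator_of_mem (show y ∈ Ico (-1) p' from ⟨hyI.1, h1⟩),
        Pi.one_apply]
      linarith
    · rw [weight, if_pos h1, indicator_of_mem (show y ∈ Ico (-1) p' from ⟨hyI.1, h1⟩),
        Pi.one_apply]
      linarith
    · linarith
    · have := hpy (not_lt.1 h1)
      rw [weight, if_neg h1, if_neg (by linarith), if_pos h3,
        indicator_of_notMem (fun h : y ∈ Ico (-1) p' => h1 h.2)]
      linarith
    · linarith
    · have := hpy (not_lt.1 h1)
      have := hrr (not_lt.1 h3)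
      rw [weight, if_neg h1, if_neg (by linarith), if_neg h3, if_neg (by linarith),
        indicator_of_notMem (fun h : y ∈ Ico (-1) p' => h1 h.2)]
      linarith
  · intro t _ htJ
    have hm1 : m ≤ α - 2 * (1 - (μ ^ k)⁻¹) / (μ - 1) := min_le_left _ _
    have hm2 : m ≤ 1 := (min_le_right _ _).trans (min_le_left _ _)
    have hm3 : m ≤ β := (min_le_right _ _).trans (min_le_right _ _)
    rw [weight]
    split_ifs with h1 h2 h3 h4
    · exact ⟨by linarith [tailWeight_le S (show 1 < μ by linarith) k t], le_max_left _ _⟩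
    · exact absurd (Or.inl ⟨not_lt.1 h1, h2⟩) htJ
    · rw [tailWeight_eq_zero fun n hn hmem => h2 (hloc n hn t hmem)]
      exact ⟨by linarith, (le_max_left _ _).trans (le_max_right _ _)⟩
    · exact absurd (Or.inr ⟨not_lt.1 h3, h4⟩) htJ
    · rw [tailWeight_eq_zero fun n hn hmem => h2 (hloc n hn t hmem)]
      exact ⟨by linarith, (le_max_right _ _).trans (le_max_right _ _)⟩

lemma le_htop_of_weights (h : NearCheb b 1 η v f x) (hp : CyclePlateau b η v f x p' p r)
    {μ α β κ₁ κ₂ : ℝ} {k : ℕ} {S : ℕ → Set ℝ} (hκ : LastWeights b β κ₁ κ₂) (hα : 0 ≤ α)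
    (hβ : 0 ≤ β) (hμ : 1 < μ) (hmid : μ ≤ α + (b - 1) + κ₂) (htp : μ * β ≤ b - 2 + κ₂)
    (hs : 2 ≤ (b - 1 + κ₁ - (μ - 1) * α) * μ ^ k) (hS0 : S 0 = endNhd (-1) η)
    (hinj : ∀ n < k, InjOn f (S n)) (hS : ∀ n < k, ∀ t ∈ S n, f t ∈ S (n + 1))
    (hR : S k ⊆ Ico (-1) p') (hloc : ∀ n < k, ∀ t ∈ S n, t ∉ Ioo (x 1) (x 2)) :
    (Real.log μ : ℝ) ≤ htop f := by
  have h12 := hp.lt₂; have h23 := hp.lt₃; have h34 := hp.lt₄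
  have h45 := node_two_lt h hp
  have hrv := r_lt h hp
  have hp1 := lt₁ h hp
  have hv1 := hp.val_lt
  set Z : Set ℝ := {-1, 1, -1 + η} with hZ
  have hZc : (forwardOrbit f Z).Countable :=
    forwardOrbit_countable f (Set.Finite.countable (by simp [hZ]))
  obtain ⟨y₀, hy₀, hpy₀, hy₀x⟩ := (hZc.dense_compl ℝ).exists_between hp.lt₄
  refine h.finiteLapMap.le_htop_of_weight (B := forwardOrbit f Z ∪ (Icc p' p ∪ Icc r v))
    (R := Ico (-1) p') (S := S) (ω := weight p' p r v α β) (s := b - 1 + κ₁ - (μ - 1) * α)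
    (M := max α (max 1 β)) (y₀ := y₀) ?_ hμ ?_ hinj hS hR hs
    ?_ ⟨by linarith, by linarith⟩ ?_ ?_
  · rintro t - (ht | ht)
    · exact Or.inl (map_mem_forwardOrbit ht)
    · exact Or.inr (map_mem h hp ht)
  · intro y hyI hyB
    rw [mem_union, not_or] at hyB
    have hne : ∀ z ∈ Z, y ≠ z := fun z hz hyz => hyB.1 (subset_forwardOrbit f Z (hyz ▸ hz))
    refine le_trans ?_ (le_transfer h hp hα hβ hκ
      (lt_of_le_of_ne hyI.1 (hne (-1) (by simp [hZ])).symm)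
      (lt_of_le_of_ne hyI.2 (hne 1 (by simp [hZ]))) (hne (-1 + η) (by simp [hZ])) hyB.2)
    rw [hS0, indicator_mem_endNhd_neg hyI]
    have heta := hp.eta_lt
    have hpy : p' ≤ y → p < y := fun h1 => by
      by_contra hc
      exact hyB.2 (Or.inl ⟨h1, not_lt.1 hc⟩)
    have hrr : r ≤ y → v < y := fun h1 => by
      by_contra hc
      exact hyB.2 (Or.inr ⟨h1, not_lt.1 hc⟩)
    split_ifs with h1 h2 h3 h4 h5
    · rw [weight, if_pos (by linarith), indicator_of_mem (show y ∈ Ico (-1) p' from ⟨hyI.1, by linarith⟩),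
        Pi.one_apply]
      linarith
    · linarith
    · linarith
    · rw [weight, if_pos h4, indicator_of_mem (show y ∈ Ico (-1) p' from ⟨hyI.1, h4⟩),
        Pi.one_apply]
      linarith
    · have := hpy (not_lt.1 h4)
      rw [weight, if_neg h4, if_neg (by linarith), if_pos h5,
        indicator_of_notMem (fun h : y ∈ Ico (-1) p' => h4 h.2)]
      linarith
    · have hpy := hpy (not_lt.1 h4)
      have hrr := hrr (not_lt.1 h5)
      rw [weight, if_neg h4, if_neg (by linarith), if_neg h5, if_neg (by linarith),
        indicator_of_notMem (fun h : y ∈ Ico (-1) p' => h4 h.2)]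
      linarith
  · intro t _
    rw [weight]
    have h1 := le_max_left α (max 1 β)
    have h2 := (le_max_left 1 β).trans (le_max_right α (max 1 β))
    have h3 := (le_max_right 1 β).trans (le_max_right α (max 1 β))
    split_ifs <;> linarith
  · rintro (h1 | h1 | h1)
    · exact hy₀ h1
    · linarith [h1.2]
    · linarith [h1.1]
  · rw [tailWeight_eq_zero fun n hn hmem => hloc n hn y₀ hmem ⟨by linarith, hy₀x⟩, weight,
      if_neg (by linarith), if_neg (by linarith), if_pos (by linarith)]
    exact one_pos

/-- The defect at `μ` of the weight adapted to a plateau of period two. -/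
noncomputable def defect (b : ℕ) (μ : ℝ) : ℝ :=
  if Even b then b - (μ - 1) * (μ - b + 1) + (b - 2) else b - 1 + (b - 1) / μ - (μ - 1) * (μ - b)

lemma htop_le (h : NearCheb b 1 η v f x) (hp : CyclePlateau b η v f x p' p r)
    {μ : ℝ} {k : ℕ} {S : ℕ → Set ℝ} (hμ : b < μ)
    (hs : defect b μ * μ ^ k < 2) (hS0 : S 0 = endNhd (-1) η)
    (hS : ∀ n < k, ∀ y ∈ S (n + 1), y ∈ Icc (-1 : ℝ) 1 → ∃ x ∈ S n, x ∈ Icc (-1 : ℝ) 1 ∧ f x = y)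
    (hR : Ico (-1) p' ⊆ S k) (hloc : ∀ n < k, ∀ t ∈ S n, t ≤ p) :
    htop f ≤ (Real.log μ : ℝ) := by
  have hb : (2 : ℝ) ≤ b := by exact_mod_cast h.two_le
  have hμ0 : 0 < μ := by linarith
  have hμ1 : 0 < μ - 1 := by linarith
  have hμk : 0 < μ ^ k := by positivity
  rcases Nat.even_or_odd b with he | ho
  · rw [defect, if_pos he] at hs
    set d := b - (μ - 1) * (μ - b + 1) + (b - 2) with hd
    set τ : ℝ := (2 - d * μ ^ k) / (2 * (μ - 1) * μ ^ k) with hτ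
    have hτ0 : 0 < τ := div_pos (by linarith) (by positivity)
    have hτe : τ * (μ - 1) * μ ^ k = (2 - d * μ ^ k) / 2 := by rw [hτ]; field_simp
    set β : ℝ := (b - 2) / (μ - 1) + τ with hβ
    have hβe : (μ - 1) * β = b - 2 + τ * (μ - 1) := by rw [hβ]; field_simp
    have hβ0 : 0 < β := add_pos_of_nonneg_of_pos (div_nonneg (by linarith) hμ1.le) hτ0
    refine htop_le_of_weights h hp (μ := μ) (α := μ - b + 1 - β) (β := β) (κ₁ := 1) (κ₂ := β)
      (Or.inl ⟨he, rfl, rfl⟩) hβ0 (by linarith) (by linarith) ?_ (by linarith) ?_ hS0 hS hR hloc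
    · have := mul_pos hτ0 hμ1
      linarith
    · have : (b - 1 + 1 - (μ - 1) * (μ - b + 1 - β)) = d + τ * (μ - 1) := by
        rw [hd]; linear_combination hβe
      rw [this, add_mul, hτe]
      linarith
  · rw [defect, if_neg (Nat.not_even_iff_odd.2 ho)] at hs
    have hb3 : (3 : ℝ) ≤ b := by
      have : 3 ≤ b := by have := h.two_le; rcases ho with ⟨k, rfl⟩; omega
      exact_mod_cast this
    have hβ0 : 0 < (b - 1) / μ := div_pos (by linarith) hμ0
    have hβe : μ * ((b - 1) / μ) = b - 1 := by field_simp
    exact htop_le_of_weights h hp (μ := μ) (α := μ - b) (Or.inr ⟨ho, rfl, rfl⟩) hβ0 (by linarith)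
      (by linarith) (by linarith) (by linarith) hs hS0 hS hR hloc

lemma le_htop (h : NearCheb b 1 η v f x) (hp : CyclePlateau b η v f x p' p r)
    {μ : ℝ} {k : ℕ} {S : ℕ → Set ℝ} (hμ : b < μ)
    (hs : 2 ≤ defect b μ * μ ^ k) (hS0 : S 0 = endNhd (-1) η)
    (hinj : ∀ n < k, InjOn f (S n)) (hS : ∀ n < k, ∀ t ∈ S n, f t ∈ S (n + 1))
    (hR : S k ⊆ Ico (-1) p') (hloc : ∀ n < k, ∀ t ∈ S n, t ∉ Ioo (x 1) (x 2)) :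
    (Real.log μ : ℝ) ≤ htop f := by
  have hb : (2 : ℝ) ≤ b := by exact_mod_cast h.two_le
  have hμ0 : 0 < μ := by linarith
  have hμ1 : 0 < μ - 1 := by linarith
  rcases Nat.even_or_odd b with he | ho
  · rw [defect, if_pos he] at hs
    set β : ℝ := (b - 2) / (μ - 1) with hβ
    have hβe : (μ - 1) * β = b - 2 := by rw [hβ]; field_simp
    have hβ0 : 0 ≤ β := div_nonneg (by linarith) hμ1.le
    have hβ1 : β ≤ 1 := (div_le_one hμ1).2 (by linarith)
    refine le_htop_of_weights h hp (μ := μ) (α := μ - b + 1 - β) (β := β) (κ₁ := 1) (κ₂ := β)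
      (Or.inl ⟨he, rfl, rfl⟩) (by linarith) hβ0 (by linarith) (by linarith) (by linarith) ?_
      hS0 hinj hS hR hloc
    convert hs using 2
    linear_combination hβe
  · rw [defect, if_neg (Nat.not_even_iff_odd.2 ho)] at hs
    have hβ0 : 0 ≤ (b - 1) / μ := div_nonneg (by linarith) hμ0.le
    have hβe : μ * ((b - 1) / μ) = b - 1 := by field_simp
    exact le_htop_of_weights h hp (μ := μ) (α := μ - b) (Or.inr ⟨ho, rfl, rfl⟩) (by linarith) hβ0
      (by linarith) (by linarith) (by linarith) hs hS0 hinj hS hR hloc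

end CyclePlateau

lemma indicator_mem_endNhd_sign {θ η y : ℝ} (hθ : θ = 1 ∨ θ = -1) (hy : y ∈ Icc (-1 : ℝ) 1) :
    (endNhd (-θ) η).indicator (1 : ℝ → ℝ) y = if θ * y < -1 + η then 1 else 0 := by
  rcases hθ with rfl | rfl
  · simpa using indicator_mem_endNhd_neg hy
  · rw [neg_neg]
    split_ifs with h
    · exact (indicator_mem_endNhd hy).1 (by linarith)
    · exact (indicator_mem_endNhd hy).2 (by linarith)

lemma NearCheb.le_htop {b : ℕ} {θ η : ℝ} {f : ℝ → ℝ} {x : ℕ → ℝ} (h : NearCheb b θ η 1 f x)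
    {μ : ℝ} {k : ℕ} {S : ℕ → Set ℝ} (hμ : 1 < μ) (hs : 2 ≤ (b + 1 - μ) * μ ^ k)
    (hS0 : S 0 = endNhd (-θ) η)
    (hinj : ∀ n < k, InjOn f (S n)) (hS : ∀ n < k, ∀ t ∈ S n, f t ∈ S (n + 1))
    (hloc : ∀ n < k, ∀ t ∈ S n, t ∉ Ioo (x 1) (x 2)) :
    (Real.log μ : ℝ) ≤ htop f := by
  have hb := h.two_le
  have hθ2 := h.theta_sq
  set Z : Set ℝ := {-1, 1, θ * (-1 + η)} with hZ
  have hZc : (forwardOrbit f Z).Countable :=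
    forwardOrbit_countable f (Set.Finite.countable (by simp [hZ]))
  obtain ⟨y₀, hy₀, hy₀1, hy₀2⟩ := (hZc.dense_compl ℝ).exists_between (h.lt 1 (by omega))
  have hx1 := h.node_mem (j := 1) (by omega)
  have hx2 := h.node_mem (j := 2) (by omega)
  refine h.finiteLapMap.le_htop_of_weight (B := forwardOrbit f Z)
    (R := univ) (S := S) (ω := fun _ => 1) (s := b + 1 - μ)
    (M := 1) (y₀ := y₀) (fun t _ ht => map_mem_forwardOrbit ht) hμ ?_ hinj hS (subset_univ _) hs
    (fun _ _ => le_rfl) ⟨hx1.1.trans hy₀1.le, hy₀2.le.trans hx2.2⟩ hy₀ ?_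
  · intro y hyI hyB
    have hne : ∀ z ∈ Z, y ≠ z := fun z hz hyz => hyB (subset_forwardOrbit f Z (hyz ▸ hz))
    have hy1 : -1 < y := lt_of_le_of_ne hyI.1 (hne (-1) (by simp [hZ])).symm
    have hy2 : y < 1 := lt_of_le_of_ne hyI.2 (hne 1 (by simp [hZ]))
    have hyη : θ * y ≠ -1 + η := fun he => hne (θ * (-1 + η)) (by simp [hZ]) (by
      rw [← he, ← mul_assoc, hθ2, one_mul])
    have hθy : -1 < θ * y ∧ θ * y < 1 := by
      rcases h.sign with h | h <;> rw [h] <;> constructor <;> linarith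
    refine le_trans (le_of_eq ?_) (h.le_sum_fibre
      (K := fun j => if (j = 1 ∨ j = 2) ∧ θ * y < -1 + η then 0 else 1) (fun _ _ => zero_le_one) ?_)
    · rw [sum_laps_ones _ hb fun j hj _ => by rw [if_neg (by omega)], hS0,
        indicator_mem_endNhd_sign h.sign hyI]
      by_cases hc : θ * y < -1 + η
      · simp [hc]; ring
      · simp [hc]; ring
    · intro j hj
      by_cases hc : (j = 1 ∨ j = 2) ∧ θ * y < -1 + η
      · left; rw [if_pos hc]
      · right
        rw [if_neg hc]
        suffices ∃ t ∈ Ioo (x j) (x (j + 1)), f t = y by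
          obtain ⟨t, ht, hty⟩ := this
          exact ⟨t, ht, hty, le_rfl⟩
        rw [not_and_or] at hc
        have hv : θ * f (x 1) = 1 := by rw [h.val_one, mul_one, hθ2]
        rcases Nat.lt_or_ge j 2 with h2 | h2
        · interval_cases j
          · exact h.exists_between (h.lt 0 hj)
              (Or.inl ⟨by rw [h.val_zero, mul_neg, hθ2]; exact hθy.1, by rw [hv]; exact hθy.2⟩)
          · have hc := lt_of_le_of_ne (not_lt.1 (hc.resolve_left (by simp))) hyη.symm
            exact h.exists_between (h.lt 1 hj)
              (Or.inr ⟨by rw [h.theta_val_two]; exact hc, by rw [hv]; exact hθy.2⟩)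
        · refine h.exists_mem_lap h2 hj hθy.2 ?_
          rcases hc with hc | hc
          · exact Or.inl ⟨by omega, hθy.1⟩
          · exact Or.inr (lt_of_le_of_ne (not_lt.1 hc) hyη.symm)
  · rw [tailWeight_eq_zero fun n hn hmem => hloc n hn y₀ hmem ⟨hy₀1, hy₀2⟩]
    exact one_pos

/-- The derivative of the polynomial with coefficient vector `a`. -/
noncomputable def derivP {n : ℕ} (a : Fin n → ℝ) (x : ℝ) : ℝ :=
  ∑ i, a i * ((i : ℕ) * x ^ ((i : ℕ) - 1))

/-- The polynomial with coefficient vector `a`. -/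
noncomputable def toPoly {n : ℕ} (a : Fin n → ℝ) : Polynomial ℝ :=
  ∑ i : Fin n, Polynomial.monomial (i : ℕ) (a i)

section

variable {n : ℕ} (a : Fin n → ℝ)

lemma eval_toPoly (x : ℝ) : (toPoly a).eval x = evalP a x := by
  simp [toPoly, evalP, Polynomial.eval_finsetSum, Polynomial.eval_monomial]

lemma eval_derivative_toPoly (x : ℝ) : (toPoly a).derivative.eval x = derivP a x := by
  simp [toPoly, derivP, Polynomial.eval_finsetSum, Polynomial.eval_monomial,
    Polynomial.derivative_monomial, mul_assoc]

lemma hasDerivAt_evalP (x : ℝ) : HasDerivAt (evalP a) (derivP a x) x := by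
  have := (toPoly a).hasDerivAt x
  rw [eval_derivative_toPoly] at this
  exact this.congr_of_eventuallyEq (Eventually.of_forall fun t => (eval_toPoly a t).symm)

lemma continuous_evalP : Continuous (evalP a) :=
  continuous_iff_continuousAt.2 fun x => (hasDerivAt_evalP a x).continuousAt

lemma coeff_toPoly (m : ℕ) : (toPoly a).coeff m = if h : m < n then a ⟨m, h⟩ else 0 := by
  simp only [toPoly, Polynomial.finsetSum_coeff, Polynomial.coeff_monomial]
  split_ifs with h
  · rw [Finset.sum_eq_single ⟨m, h⟩ (fun i _ hi => if_neg fun h' => hi (Fin.ext h')) (by simp)]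
    simp
  · exact Finset.sum_eq_zero fun i _ => if_neg fun hi : (i : ℕ) = m => h (hi ▸ i.2)

lemma degree_toPoly_lt : (toPoly a).degree < n := by
  rw [Polynomial.degree_lt_iff_coeff_zero]
  intro m hm
  rw [coeff_toPoly, dif_neg (not_lt.2 hm)]

lemma toPoly_injective : Function.Injective (toPoly : (Fin n → ℝ) → Polynomial ℝ) := by
  intro a c h
  funext i
  have := congrArg (fun q => Polynomial.coeff q i) h
  simpa [coeff_toPoly] using this

lemma evalP_smul (r : ℝ) (t : ℝ) : evalP (r • a) t = r * evalP a t := by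
  simp [evalP, Finset.mul_sum, mul_assoc]

lemma continuous_evalP_uncurry : Continuous fun q : (Fin n → ℝ) × ℝ => evalP q.1 q.2 := by
  unfold evalP; fun_prop

lemma continuous_derivP_uncurry : Continuous fun q : (Fin n → ℝ) × ℝ => derivP q.1 q.2 := by
  unfold derivP; fun_prop

lemma eq_zero_of_evalP_eq_zero {a : Fin n → ℝ} {s : Finset ℝ} (hs : n ≤ s.card)
    (h : ∀ t ∈ s, evalP a t = 0) : a = 0 := by
  apply toPoly_injective
  have h0 : toPoly (0 : Fin n → ℝ) = 0 := by simp [toPoly]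
  rw [h0]
  refine Polynomial.eq_zero_of_degree_lt_of_eval_finset_eq_zero s
    ((degree_toPoly_lt a).trans_le (by exact_mod_cast hs)) fun t ht => ?_
  rw [eval_toPoly, h t ht]

end

/-- The polynomial `a` has turning points at the interior nodes `x`, with node values `y`. -/
structure IsSol {b : ℕ} (a x y : Fin (b + 2) → ℝ) : Prop where
  mono : StrictMono x
  first : x 0 = -1
  last : x (Fin.last (b + 1)) = 1
  val : ∀ j, evalP a (x j) = y j
  crit : ∀ i : Fin b, derivP a (x i.succ.castSucc) = 0

/-- Node values which go up and down alternately. -/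
def Alternating {b : ℕ} (y : Fin (b + 2) → ℝ) : Prop :=
  ∀ j : Fin (b + 1), 0 < (-1 : ℝ) ^ (j : ℕ) * (y j.succ - y j.castSucc)

namespace IsSol

variable {b : ℕ} {a x y : Fin (b + 2) → ℝ}

lemma derivP_eq_prod (h : IsSol a x y) (t : ℝ) :
    derivP a t = (b + 1) * a (Fin.last (b + 1)) * ∏ i : Fin b, (t - x i.succ.castSucc) := by
  classical
  set Q : Polynomial ℝ := ∏ i : Fin b, (Polynomial.X - Polynomial.C (x i.succ.castSucc)) with hQ
  set c : ℝ := (b + 1) * a (Fin.last (b + 1)) with hc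
  have hQm : Q.Monic := Polynomial.monic_prod_of_monic _ _ fun i _ => Polynomial.monic_X_sub_C _
  have hQd : Q.natDegree = b := by
    rw [hQ, Polynomial.natDegree_prod_of_monic _ _ fun i _ => Polynomial.monic_X_sub_C _]
    simp
  have hinj : Function.Injective fun i : Fin b => x i.succ.castSucc := fun i j hij => by
    have := h.mono.injective hij
    simpa [Fin.ext_iff] using this
  have key : (toPoly a).derivative = Polynomial.C c * Q := by
    refine Polynomial.eq_of_degree_sub_lt_of_eval_finset_eq
      (Finset.univ.image fun i : Fin b => x i.succ.castSucc) ?_ ?_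
    · rw [Finset.card_image_of_injective _ hinj, Finset.card_univ, Fintype.card_fin,
        Polynomial.degree_lt_iff_coeff_zero]
      intro m hm
      rw [Polynomial.coeff_sub, Polynomial.coeff_derivative, Polynomial.coeff_C_mul, coeff_toPoly]
      rcases hm.eq_or_lt with rfl | hm
      · have : Q.coeff b = 1 := by
          have := hQm.coeff_natDegree
          rwa [hQd] at this
        rw [this, dif_pos (by omega), hc]
        have : (⟨b + 1, by omega⟩ : Fin (b + 2)) = Fin.last (b + 1) := rfl
        rw [this]
        ring
      · rw [dif_neg (by omega), Polynomial.coeff_eq_zero_of_natDegree_lt (by rw [hQd]; exact hm)]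
        ring
    · intro t ht
      obtain ⟨i, -, rfl⟩ := Finset.mem_image.1 ht
      rw [eval_derivative_toPoly, h.crit i, Polynomial.eval_mul, hQ, Polynomial.eval_prod,
        Finset.prod_eq_zero (Finset.mem_univ i) (by simp), mul_zero]
  rw [← eval_derivative_toPoly, key]
  simp [hQ, Polynomial.eval_prod]

lemma mem_Icc (h : IsSol a x y) (j : Fin (b + 2)) : x j ∈ Icc (-1 : ℝ) 1 :=
  ⟨h.first ▸ h.mono.monotone (Fin.zero_le j), h.last ▸ h.mono.monotone (Fin.le_last j)⟩

lemma last_ne_zero (h : IsSol a x y) (hy : Alternating y) : a (Fin.last (b + 1)) ≠ 0 := by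
  intro h0
  have hd : ∀ t, derivP a t = 0 := fun t => by rw [h.derivP_eq_prod, h0]; ring
  have hconst := is_const_of_deriv_eq_zero (f := evalP a)
    (fun t => (hasDerivAt_evalP a t).differentiableAt)
    (fun t => by rw [(hasDerivAt_evalP a t).deriv, hd t]) (x (Fin.succ 0)) (x (Fin.castSucc 0))
  rw [h.val, h.val] at hconst
  have := hy 0
  rw [hconst] at this
  simp at this

lemma derivP_eq_zero_iff (h : IsSol a x y) (hy : Alternating y) (t : ℝ) :
    derivP a t = 0 ↔ ∃ i : Fin b, x i.succ.castSucc = t := by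
  have hb : ((b : ℝ) + 1) ≠ 0 := by positivity
  rw [h.derivP_eq_prod, mul_eq_zero, or_iff_right (mul_ne_zero hb (h.last_ne_zero hy)),
    Finset.prod_eq_zero_iff]
  simp [sub_eq_zero, eq_comm]

lemma derivP_ne_zero (h : IsSol a x y) (hy : Alternating y) {j : Fin (b + 1)} {t : ℝ}
    (ht : t ∈ Ioo (x j.castSucc) (x j.succ)) : derivP a t ≠ 0 := by
  rw [Ne, h.derivP_eq_zero_iff hy]
  rintro ⟨i, rfl⟩
  have h1 := h.mono.lt_iff_lt.1 ht.1
  have h2 := h.mono.lt_iff_lt.1 ht.2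
  simp only [Fin.lt_def, Fin.val_castSucc, Fin.val_succ] at h1 h2
  omega

lemma strictMonoOn_lap (h : IsSol a x y) (hy : Alternating y) (j : Fin (b + 1)) :
    StrictMonoOn (fun t => (-1 : ℝ) ^ (j : ℕ) * evalP a t) (Icc (x j.castSucc) (x j.succ)) := by
  have hlt : x j.castSucc < x j.succ := h.mono (Fin.castSucc_lt_succ)
  have hd : ∀ t, HasDerivAt (fun t => (-1 : ℝ) ^ (j : ℕ) * evalP a t)
      ((-1 : ℝ) ^ (j : ℕ) * derivP a t) t := fun t => (hasDerivAt_evalP a t).const_mul _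
  have hc : ContinuousOn (fun t => (-1 : ℝ) ^ (j : ℕ) * evalP a t)
      (Icc (x j.castSucc) (x j.succ)) := (continuous_const.mul (continuous_evalP a)).continuousOn
  have hinj : InjOn (fun t => (-1 : ℝ) ^ (j : ℕ) * evalP a t)
      (Icc (x j.castSucc) (x j.succ)) := by
    have aux : ∀ s ∈ Icc (x j.castSucc) (x j.succ), ∀ t ∈ Icc (x j.castSucc) (x j.succ), s < t →
        (fun t => (-1 : ℝ) ^ (j : ℕ) * evalP a t) s ≠ (-1 : ℝ) ^ (j : ℕ) * evalP a t := by
      intro s hs t ht hst heq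
      obtain ⟨c, hc, hc0⟩ := exists_hasDerivAt_eq_zero hst
        (hc.mono (Icc_subset_Icc hs.1 ht.2)) heq fun u _ => hd u
      refine h.derivP_ne_zero hy ⟨hs.1.trans_lt hc.1, hc.2.trans_le ht.2⟩ ?_
      exact (mul_eq_zero.1 hc0).resolve_left (pow_ne_zero _ (by norm_num))
    intro s hs t ht heq
    rcases lt_trichotomy s t with hst | hst | hst
    · exact absurd heq (aux s hs t ht hst)
    · exact hst
    · exact absurd heq.symm (aux t ht s hs hst)
  refine (hc.strictMonoOn_of_injOn_Icc' hlt.le hinj).resolve_right fun hanti => ?_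
  have := hanti (left_mem_Icc.2 hlt.le) (right_mem_Icc.2 hlt.le) hlt
  simp only [h.val] at this
  have := hy j
  linarith

lemma mem_uIcc (h : IsSol a x y) (hy : Alternating y) {j : Fin (b + 1)} {t : ℝ}
    (ht : t ∈ Icc (x j.castSucc) (x j.succ)) :
    evalP a t ∈ uIcc (y j.castSucc) (y j.succ) := by
  have hle := ht.1.trans ht.2
  have hm := (h.strictMonoOn_lap hy j).monotoneOn
  have h1 := hm (left_mem_Icc.2 hle) ht ht.1
  have h2 := hm ht (right_mem_Icc.2 hle) ht.2
  simp only [h.val] at h1 h2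
  rw [Set.mem_uIcc]
  rcases neg_one_pow_eq_or ℝ (j : ℕ) with e | e <;> rw [e] at h1 h2
  · left; constructor <;> linarith
  · right; constructor <;> linarith

lemma exists_lap (h : IsSol a x y) {t : ℝ} (ht : t ∈ Icc (-1 : ℝ) 1) :
    ∃ j : Fin (b + 1), t ∈ Icc (x j.castSucc) (x j.succ) := by
  by_contra hcon
  have hstep : ∀ j : Fin (b + 1), x j.castSucc ≤ t → x j.succ < t := fun j hj => by
    by_contra hc
    exact hcon ⟨j, hj, not_lt.1 hc⟩
  have : ∀ j : Fin (b + 2), x j ≤ t := fun j => by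
    induction j using Fin.induction with
    | zero => rw [h.first]; exact ht.1
    | succ j ih => exact (hstep j ih).le
  have h1 := hstep (Fin.last b) (this _)
  rw [Fin.succ_last, h.last] at h1
  linarith [ht.2]

lemma abs_evalP_le (h : IsSol a x y) (hy : Alternating y) {M : ℝ} (hM : ∀ j, |y j| ≤ M) {t : ℝ}
    (ht : t ∈ Icc (-1 : ℝ) 1) : |evalP a t| ≤ M := by
  obtain ⟨j, hj⟩ := h.exists_lap ht
  have := h.mem_uIcc hy hj
  rw [Set.mem_uIcc] at this
  have h1 := abs_le.1 (hM j.castSucc)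
  have h2 := abs_le.1 (hM j.succ)
  rw [abs_le]
  rcases this with h | h <;> constructor <;> linarith [h.1, h.2]

lemma nodes_unique {x' y' : Fin (b + 2) → ℝ} (h : IsSol a x y) (hy : Alternating y)
    (h' : IsSol a x' y') (hy' : Alternating y') : x = x' := by
  have hsm : ∀ {x y : Fin (b + 2) → ℝ}, IsSol a x y →
      StrictMono fun i : Fin b => x i.succ.castSucc := fun h i j hij =>
    h.mono (Fin.castSucc_lt_castSucc_iff.2 (Fin.succ_lt_succ_iff.2 hij))
  have hr : (fun i : Fin b => x i.succ.castSucc) = fun i : Fin b => x' i.succ.castSucc := by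
    refine (StrictMono.range_inj (hsm h) (hsm h')).1 ?_
    ext t
    exact (h.derivP_eq_zero_iff hy t).symm.trans (h'.derivP_eq_zero_iff hy' t)
  funext j
  rcases Fin.eq_castSucc_or_eq_last j with ⟨i, rfl⟩ | rfl
  · rcases Fin.eq_zero_or_eq_succ i with rfl | ⟨k, rfl⟩
    · exact h.first.trans h'.first.symm
    · exact congrFun hr k
  · rw [h.last, h'.last]

lemma le_node (h : IsSol a x y) {t : ℝ} (ht : t ≤ x (Fin.succ 0)) (i : Fin b) :
    t ≤ x i.succ.castSucc :=
  ht.trans (h.mono.monotone (by rw [Fin.le_def]; simp))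

lemma node_le (h : IsSol a x y) {t : ℝ} (ht : x (Fin.last b).castSucc ≤ t) (i : Fin b) :
    x i.succ.castSucc ≤ t :=
  (h.mono.monotone (by rw [Fin.le_def]; simp)).trans ht

lemma derivP_eq_prod' (h : IsSol a x y) (t : ℝ) :
    derivP a t = ((-1) ^ b * ((b + 1) * a (Fin.last (b + 1)))) *
      ∏ i : Fin b, (x i.succ.castSucc - t) := by
  have : ∏ i : Fin b, (t - x i.succ.castSucc) =
      (-1) ^ b * ∏ i : Fin b, (x i.succ.castSucc - t) := by
    have hc : ((-1 : ℝ)) ^ b = ∏ _i : Fin b, (-1 : ℝ) := by simp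
    rw [hc, ← Finset.prod_mul_distrib]
    exact Finset.prod_congr rfl fun i _ => by ring
  rw [h.derivP_eq_prod, this]
  ring

lemma lead_pos (h : IsSol a x y) (hy : Alternating y) :
    0 < (-1) ^ b * ((b + 1) * a (Fin.last (b + 1))) := by
  have hlt : x (Fin.castSucc 0) < x (Fin.succ (0 : Fin (b + 1))) := h.mono Fin.castSucc_lt_succ
  obtain ⟨t, ht, hd⟩ := exists_hasDerivAt_eq_slope (evalP a) (derivP a) hlt
    (continuous_evalP a).continuousOn fun t _ => hasDerivAt_evalP a t
  have h1 : 0 < derivP a t := by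
    rw [hd, h.val, h.val]
    have := hy 0
    simp only [Fin.val_zero, pow_zero, one_mul] at this
    exact div_pos this (sub_pos.2 hlt)
  rw [h.derivP_eq_prod'] at h1
  refine pos_of_mul_pos_left h1 (Finset.prod_nonneg fun i _ => sub_nonneg.2 (h.le_node ht.2.le i))

lemma derivP_neg_one_pos (h : IsSol a x y) (hy : Alternating y) : 0 < derivP a (-1) := by
  rw [h.derivP_eq_prod']
  refine mul_pos (h.lead_pos hy) (Finset.prod_pos fun i _ => sub_pos.2 ?_)
  rw [← h.first]
  exact h.mono (by rw [Fin.lt_def]; simp)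

lemma derivP_one_pos (h : IsSol a x y) (hy : Alternating y) : 0 < (-1) ^ b * derivP a 1 := by
  rw [h.derivP_eq_prod, ← mul_assoc]
  refine mul_pos (h.lead_pos hy) (Finset.prod_pos fun i _ => sub_pos.2 ?_)
  rw [← h.last]
  exact h.mono (by rw [Fin.lt_def]; simp)

lemma concaveOn_first (h : IsSol a x y) (hy : Alternating y) :
    ConcaveOn ℝ (Icc (-1) (x (Fin.succ 0))) (evalP a) := by
  refine AntitoneOn.concaveOn_of_deriv (convex_Icc _ _) (continuous_evalP a).continuousOn
    (fun t _ => (hasDerivAt_evalP a t).differentiableAt.differentiableWithinAt) ?_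
  intro s hs t ht hst
  rw [(hasDerivAt_evalP a s).deriv, (hasDerivAt_evalP a t).deriv, h.derivP_eq_prod',
    h.derivP_eq_prod']
  refine mul_le_mul_of_nonneg_left (Finset.prod_le_prod (fun i _ => ?_) fun i _ => ?_)
    (h.lead_pos hy).le
  · exact sub_nonneg.2 (h.le_node (interior_subset ht).2 i)
  · linarith

lemma convexOn_last (h : IsSol a x y) (hy : Alternating y) :
    ConvexOn ℝ (Icc (x (Fin.last b).castSucc) 1) (fun t => (-1) ^ b * evalP a t) := by
  have hd : ∀ t, HasDerivAt (fun t => (-1 : ℝ) ^ b * evalP a t)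
      ((-1 : ℝ) ^ b * derivP a t) t := fun t => (hasDerivAt_evalP a t).const_mul _
  refine MonotoneOn.convexOn_of_deriv (convex_Icc _ _)
    (continuous_const.mul (continuous_evalP a)).continuousOn
    (fun t _ => (hd t).differentiableAt.differentiableWithinAt) ?_
  intro s hs t ht hst
  rw [(hd s).deriv, (hd t).deriv, h.derivP_eq_prod, h.derivP_eq_prod, ← mul_assoc,
    ← mul_assoc ((-1 : ℝ) ^ b) _ (∏ i : Fin b, (t - x i.succ.castSucc))]
  refine mul_le_mul_of_nonneg_left (Finset.prod_le_prod (fun i _ => ?_) fun i _ => ?_)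
    (h.lead_pos hy).le
  · exact sub_nonneg.2 (h.node_le (interior_subset hs).1 i)
  · linarith

end IsSol

/-- The sign of the product of the differences of `t i` to the other nodes. -/
lemma prod_sub_sign {n : ℕ} {t : Fin (n + 1) → ℝ} (ht : StrictMono t) (i : Fin (n + 1)) :
    0 < (-1 : ℝ) ^ (n - (i : ℕ)) * ∏ j ∈ Finset.univ.erase i, (t i - t j) := by
  classical
  have hs : (Finset.univ.erase i : Finset (Fin (n + 1))) = Finset.Iio i ∪ Finset.Ioi i := by
    ext j
    simp [lt_or_lt_iff_ne]
  have hd : Disjoint (Finset.Iio i) (Finset.Ioi i) := by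
    rw [Finset.disjoint_left]
    intro j h1 h2
    exact lt_asymm (Finset.mem_Iio.1 h1) (Finset.mem_Ioi.1 h2)
  have hc : ((-1 : ℝ)) ^ (n - (i : ℕ)) = ∏ _j ∈ Finset.Ioi i, (-1 : ℝ) := by
    rw [Finset.prod_const, Fin.card_Ioi]
    congr 1
  rw [hs, Finset.prod_union hd, mul_left_comm, hc, ← Finset.prod_mul_distrib]
  refine mul_pos (Finset.prod_pos fun j hj => sub_pos.2 (ht (Finset.mem_Iio.1 hj)))
    (Finset.prod_pos fun j hj => ?_)
  have := ht (Finset.mem_Ioi.1 hj)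
  linarith

/-- A polynomial of degree less than `n` which alternates weakly in sign at `n + 1` points is
zero. -/
lemma eq_zero_of_alternating {n : ℕ} {Q : Polynomial ℝ} (hQ : Q.degree < n)
    {t : Fin (n + 1) → ℝ} (ht : StrictMono t)
    (h : ∀ i : Fin (n + 1), 0 ≤ (-1 : ℝ) ^ (i : ℕ) * Q.eval (t i)) : Q = 0 := by
  classical
  have hsum := Lagrange.coeff_eq_sum (s := Finset.univ) (v := t) (ht.injective.injOn) (P := Q)
    (by simpa using hQ.trans (by exact_mod_cast Nat.lt_succ_self n))
  have h0 : Q.coeff (Finset.univ.card (α := Fin (n + 1)) - 1) = 0 := by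
    refine Polynomial.coeff_eq_zero_of_degree_lt ?_
    simpa using hQ
  rw [h0] at hsum
  have hterm : ∀ i ∈ (Finset.univ : Finset (Fin (n + 1))),
      0 ≤ (-1 : ℝ) ^ n * (Q.eval (t i) / ∏ j ∈ Finset.univ.erase i, (t i - t j)) := by
    intro i _
    have hp := prod_sub_sign ht i
    have hn : (-1 : ℝ) ^ n = (-1) ^ (n - (i : ℕ)) * (-1) ^ (i : ℕ) := by
      rw [← pow_add]; congr 1; have := i.2; omega
    have e : (-1 : ℝ) ^ (n - (i : ℕ)) * (-1) ^ (n - (i : ℕ)) = 1 := by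
      rw [← mul_pow]; norm_num
    have : (-1 : ℝ) ^ n * (Q.eval (t i) / ∏ j ∈ Finset.univ.erase i, (t i - t j)) =
        ((-1) ^ (i : ℕ) * Q.eval (t i)) /
          ((-1 : ℝ) ^ (n - (i : ℕ)) * ∏ j ∈ Finset.univ.erase i, (t i - t j)) := by
      have hne := (right_ne_zero_of_mul hp.ne')
      have hne' := (left_ne_zero_of_mul hp.ne')
      rw [hn]
      field_simp
      rw [sq, e, one_mul]
    rw [this]
    exact div_nonneg (h i) hp.le
  have hz := (Finset.sum_eq_zero_iff_of_nonneg hterm).1 (by rw [← Finset.mul_sum, ← hsum, mul_zero])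
  refine Polynomial.eq_zero_of_degree_lt_of_eval_index_eq_zero (v := t) Finset.univ
    ht.injective.injOn (by simpa using hQ.trans (by exact_mod_cast Nat.lt_succ_self n))
    fun i hi => ?_
  have h1 := (mul_eq_zero.1 (hz i hi)).resolve_left (pow_ne_zero _ (by norm_num))
  exact (div_eq_zero_iff.1 h1).resolve_right (right_ne_zero_of_mul (ne_of_gt (prod_sub_sign ht i)))

/-- The node values used for the maps under consideration: extremal values, except for the value
`v` at the first turning point and the value `-1 + η` at the second one. -/
noncomputable def yvec (b : ℕ) (v η : ℝ) : Fin (b + 2) → ℝ := fun j =>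
  if (j : ℕ) = 0 then -1 else if (j : ℕ) = 1 then v else if (j : ℕ) = 2 then -1 + η
  else (-1) ^ ((j : ℕ) + 1)

lemma alternating_yvec {b : ℕ} {v η : ℝ} (h1 : -1 + η < v) (h0 : 0 ≤ η) (hη : η < 2) :
    Alternating (yvec b v η) := by
  rintro ⟨j, hj⟩
  simp only [yvec, Fin.val_succ, Fin.val_castSucc]
  rcases j with _ | _ | _ | j
  · simp; linarith
  · simp; linarith
  · norm_num; linarith
  · simp only [Nat.add_eq_zero_iff, Nat.add_eq_right, Nat.reduceEqDiff, one_ne_zero, and_false,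
      if_false]
    rcases neg_one_pow_eq_or ℝ j with e | e <;> simp [pow_succ, e]

lemma abs_yvec_le {b : ℕ} {v η : ℝ} (hv : |v| ≤ 1) (h0 : 0 ≤ η) (hη : η < 2) (j : Fin (b + 2)) :
    |yvec b v η j| ≤ 1 := by
  simp only [yvec]
  split_ifs
  · simp
  · exact hv
  · rw [abs_le]; constructor <;> linarith
  · simp

lemma continuous_yvec (b : ℕ) : Continuous fun q : ℝ × ℝ => yvec b q.1 q.2 := by
  refine continuous_pi fun j => ?_
  simp only [yvec]
  split_ifs <;> fun_prop

/-- Factoring a polynomial which vanishes at `-1` and `1`. -/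
lemma exists_eq_mul_of_vanish {n : ℕ} {D : Polynomial ℝ} (hD : D.degree < (n + 2 : ℕ))
    (h1 : D.eval 1 = 0) (h2 : D.eval (-1) = 0) :
    ∃ Q : Polynomial ℝ, D = (Polynomial.X ^ 2 - 1) * Q ∧ Q.degree < n := by
  have e1 := (Polynomial.mul_divByMonic_eq_iff_isRoot (a := 1) (p := D)).2 h1
  set Q₁ := D /ₘ (Polynomial.X - Polynomial.C 1) with hQ₁
  have h3 : Q₁.eval (-1) = 0 := by
    rw [← e1] at h2
    simp only [Polynomial.eval_mul, Polynomial.eval_sub, Polynomial.eval_X,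
      Polynomial.eval_C] at h2
    linarith
  have e2 := (Polynomial.mul_divByMonic_eq_iff_isRoot (a := -1) (p := Q₁)).2 h3
  set Q := Q₁ /ₘ (Polynomial.X - Polynomial.C (-1)) with hQ
  have e : D = (Polynomial.X ^ 2 - 1) * Q := by
    rw [← e1, ← e2]
    simp only [map_neg, map_one]
    ring
  refine ⟨Q, e, ?_⟩
  have hd : (Polynomial.X ^ 2 - 1 : Polynomial ℝ).degree = 2 := by
    have := Polynomial.degree_X_pow_sub_C (R := ℝ) (n := 2) (by norm_num) 1
    simpa using this
  rw [e, Polynomial.degree_mul, hd] at hD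
  by_cases h0 : Q = 0
  · rw [h0, Polynomial.degree_zero]; exact WithBot.bot_lt_coe n
  · rw [Polynomial.degree_eq_natDegree h0] at hD ⊢
    have : 2 + Q.natDegree < n + 2 := by exact_mod_cast hD
    exact_mod_cast (by omega : Q.natDegree < n)

section Comparison

variable {b : ℕ} {v v' : ℝ} {a x a' x' : Fin (b + 2) → ℝ}

lemma yvec_zero (h : 0 < b + 2) (v η : ℝ) : yvec b v η ⟨0, h⟩ = -1 := by simp [yvec]

lemma yvec_one (h : 1 < b + 2) (v η : ℝ) : yvec b v η ⟨1, h⟩ = v := by simp [yvec]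

lemma yvec_two (h : 2 < b + 2) (v η : ℝ) : yvec b v η ⟨2, h⟩ = -1 + η := by simp [yvec]

lemma yvec_of_three_le {j : ℕ} (h : j < b + 2) (hj : 3 ≤ j) (v η : ℝ) :
    yvec b v η ⟨j, h⟩ = (-1) ^ (j + 1) := by
  simp only [yvec]
  rw [if_neg (by omega), if_neg (by omega), if_neg (by omega)]

lemma yvec_zero_of_two_le {j : ℕ} (h : j < b + 2) (hj : 2 ≤ j) (v : ℝ) :
    yvec b v 0 ⟨j, h⟩ = (-1) ^ (j + 1) := by
  rcases hj.eq_or_lt with rfl | hj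
  · rw [yvec_two]; norm_num
  · exact yvec_of_three_le h hj v 0

/-- An auxiliary point at which the polynomial with smaller first critical value lies below. -/
lemma exists_crossing (hb : 2 ≤ b) (hv : -1 < v) (hvv : v ≤ v') (hv' : v' ≤ 1)
    (h : IsSol a x (yvec b v 0)) (h' : IsSol a' x' (yvec b v' 0)) :
    ∃ z, -1 < z ∧ z < x' ⟨2, by omega⟩ ∧ evalP a z ≤ evalP a' z := by
  have hA := alternating_yvec (b := b) (v := v) (η := 0) (by linarith) le_rfl (by norm_num)
  have hA' := alternating_yvec (b := b) (v := v') (η := 0) (by linarith) le_rfl (by norm_num)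
  rcases le_or_gt (x' ⟨1, by omega⟩) (x ⟨2, by omega⟩) with hle | hlt
  · refine ⟨x' ⟨1, by omega⟩, ?_, h'.mono (by simp [Fin.lt_def]), ?_⟩
    · rw [← h'.first]; exact h'.mono (by simp)
    · rw [h'.val, yvec_one]
      refine le_trans ?_ hvv
      have hm := (h'.mem_Icc ⟨1, by omega⟩).1
      rcases le_total (x' ⟨1, by omega⟩) (x ⟨1, by omega⟩) with h1 | h1
      · have := h.mem_uIcc hA (j := ⟨0, by omega⟩) (t := x' ⟨1, by omega⟩)
          ⟨h.first.le.trans hm, h1⟩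
        simp only [Fin.castSucc_mk, Fin.succ_mk, yvec_zero, zero_add, yvec_one] at this
        rw [uIcc_of_le hv.le] at this
        exact this.2
      · have := h.mem_uIcc hA (j := ⟨1, by omega⟩) (t := x' ⟨1, by omega⟩) ⟨h1, hle⟩
        simp only [Fin.castSucc_mk, Fin.succ_mk, yvec_one, Nat.reduceAdd, yvec_two,
          add_zero] at this
        rw [uIcc_of_ge hv.le] at this
        exact this.2
  · refine ⟨x ⟨2, by omega⟩, ?_, hlt.trans (h'.mono (by simp [Fin.lt_def])), ?_⟩
    · rw [← h.first]; exact h.mono (by simp [Fin.lt_def])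
    · rw [h.val, yvec_two, add_zero]
      have := h'.abs_evalP_le hA' (M := 1) (t := x ⟨2, by omega⟩)
        (fun j => abs_yvec_le (abs_le.2 ⟨by linarith, hv'⟩) le_rfl (by norm_num) j)
        (h.mem_Icc _)
      exact (abs_le.1 this).1

lemma IsSol.compare (hb : 2 ≤ b) (hv : -1 < v) (hvv : v ≤ v') (hv' : v' ≤ 1)
    (h : IsSol a x (yvec b v 0)) (h' : IsSol a' x' (yvec b v' 0)) (hne : a ≠ a') :
    derivP a (-1) < derivP a' (-1) ∧ (-1) ^ b * derivP a 1 < (-1) ^ b * derivP a' 1 := by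
  have hA := alternating_yvec (b := b) (v := v) (η := 0) (by linarith) le_rfl (by norm_num)
  obtain ⟨z, hz1, hz2, hz⟩ := exists_crossing hb hv hvv hv' h h'
  have hv1 : evalP a (-1) = evalP a' (-1) := by
    have e1 := h.val 0
    have e2 := h'.val 0
    rw [h.first] at e1
    rw [h'.first] at e2
    rw [e1, e2]; simp [yvec]
  have hv2 : evalP a 1 = evalP a' 1 := by
    have e1 := h.val (Fin.last _)
    have e2 := h'.val (Fin.last _)
    rw [h.last] at e1
    rw [h'.last] at e2
    have e3 : (Fin.last (b + 1)) = ⟨b + 1, by omega⟩ := rfl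
    rw [e1, e2, e3, yvec_zero_of_two_le _ (by omega), yvec_zero_of_two_le _ (by omega)]
  have heval : ∀ t, (toPoly a - toPoly a').eval t = evalP a t - evalP a' t := fun t => by
    rw [Polynomial.eval_sub, eval_toPoly, eval_toPoly]
  obtain ⟨Q, hQ, hQd⟩ := exists_eq_mul_of_vanish (n := b) (D := toPoly a - toPoly a')
    (lt_of_le_of_lt (Polynomial.degree_sub_le _ _) (max_lt (degree_toPoly_lt a)
      (degree_toPoly_lt a'))) (by rw [heval, hv2, sub_self]) (by rw [heval, hv1, sub_self])
  have hQ0 : Q ≠ 0 := fun h0 => hne <| toPoly_injective <| by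
    rw [h0, mul_zero] at hQ
    exact sub_eq_zero.1 hQ
  have hDQ : ∀ t, evalP a t - evalP a' t = (t ^ 2 - 1) * Q.eval t := fun t => by
    rw [← heval, hQ]; simp
  have hD' : ∀ t, derivP a t - derivP a' t =
      2 * t * Q.eval t + (t ^ 2 - 1) * Q.derivative.eval t := fun t => by
    rw [← eval_derivative_toPoly, ← eval_derivative_toPoly, ← Polynomial.eval_sub,
      ← Polynomial.derivative_sub, hQ]
    simp [one_add_one_eq_two]
  have hQz : 0 ≤ Q.eval z := by
    have h1 := hDQ z
    have h2 : z < 1 := hz2.trans_le (h'.mem_Icc _).2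
    by_contra hneg
    have : 0 < (z ^ 2 - 1) * Q.eval z := mul_pos_of_neg_of_neg (by nlinarith) (not_le.1 hneg)
    linarith
  have hQj : ∀ (j : ℕ) (hj : j < b + 2), 2 ≤ j → j ≤ b → 0 ≤ (-1) ^ (j + 1) * Q.eval (x' ⟨j, hj⟩) := by
    intro j hj h2 hjb
    have h1 := hDQ (x' ⟨j, hj⟩)
    rw [h'.val, yvec_zero_of_two_le _ h2] at h1
    have h3 : -1 < x' ⟨j, hj⟩ := by
      rw [← h'.first]; exact h'.mono (by rw [Fin.lt_def]; simp; omega)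
    have h4 : x' ⟨j, hj⟩ < 1 := by
      rw [← h'.last]; exact h'.mono (by rw [Fin.lt_def]; simp; omega)
    have h5 := abs_le.1 (h.abs_evalP_le hA (M := 1) (t := x' ⟨j, hj⟩)
        (fun j => abs_yvec_le (abs_le.2 ⟨by linarith, by linarith⟩) le_rfl (by norm_num) j)
        (h'.mem_Icc _))
    by_contra hneg
    have h6 : 0 < (x' ⟨j, hj⟩ ^ 2 - 1) * ((-1) ^ (j + 1) * Q.eval (x' ⟨j, hj⟩)) :=
      mul_pos_of_neg_of_neg (by nlinarith) (not_le.1 hneg)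
    rw [mul_left_comm, ← h1] at h6
    rcases neg_one_pow_eq_or ℝ (j + 1) with e | e <;> rw [e] at h6 <;> linarith [h5.1, h5.2]
  constructor
  · by_contra hcon
    have h0 : 0 ≤ -Q.eval (-1) := by
      have := hD' (-1)
      norm_num at this
      linarith
    refine hQ0 (neg_eq_zero.1 (eq_zero_of_alternating (n := b) (Q := -Q)
      (by rwa [Polynomial.degree_neg])
      (t := fun i : Fin (b + 1) => if (i : ℕ) = 0 then -1 else if (i : ℕ) = 1 then z
        else x' i.castSucc) ?_ ?_))
    · rw [Fin.strictMono_iff_lt_succ]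
      rintro ⟨i, hi⟩
      rcases i with _ | _ | i
      · simpa using hz1
      · simpa using hz2
      · simpa using h'.mono (by simp [Fin.lt_def])
    · rintro ⟨i, hi⟩
      rcases i with _ | _ | i
      · simpa using h0
      · simpa using hQz
      · have := hQj (i + 2) (by omega) (by omega) (by omega)
        simpa [pow_succ] using this
  · by_contra hcon
    have h0 : 0 ≤ (-1) ^ b * Q.eval 1 := by
      have := hD' 1
      norm_num at this
      have h3 : (-1) ^ b * derivP a 1 - (-1) ^ b * derivP a' 1 = 2 * ((-1) ^ b * Q.eval 1) := by
        rw [← mul_sub, this]; ring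
      linarith
    refine hQ0 (eq_zero_of_alternating (n := b) hQd
      (t := fun i : Fin (b + 1) => if (i : ℕ) = 0 then z else x' i.succ) ?_ ?_)
    · rw [Fin.strictMono_iff_lt_succ]
      rintro ⟨i, hi⟩
      rcases i with _ | i
      · simpa using hz2
      · simpa using h'.mono (by simp [Fin.lt_def])
    · rintro ⟨i, hi⟩
      rcases i with _ | i
      · simpa using hQz
      · rcases (by omega : i + 1 ≤ b).eq_or_lt with hib | hib
        · have : (Fin.succ ⟨i + 1, hi⟩ : Fin (b + 2)) = Fin.last (b + 1) := by
            ext; simp; omega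
          simp only [this, h'.last]
          rw [if_neg (Nat.succ_ne_zero i)]
          simpa [hib] using h0
        · have := hQj (i + 2) (by omega) (by omega) (by omega)
          simpa [pow_succ] using this

lemma IsSol.unique (hb : 2 ≤ b) (hv : -1 < v) (hv' : v ≤ 1)
    (h : IsSol a x (yvec b v 0)) (h' : IsSol a' x' (yvec b v 0)) : a = a' ∧ x = x' := by
  have hA := alternating_yvec (b := b) (v := v) (η := 0) (by linarith) le_rfl (by norm_num)
  have : a = a' := by
    by_contra hne
    have h1 := (h.compare hb hv le_rfl hv' h' hne).1
    have h2 := (h'.compare hb hv le_rfl hv' h (Ne.symm hne)).1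
    exact lt_asymm h1 h2
  subst this
  exact ⟨rfl, h.nodes_unique hA h' hA⟩

lemma IsSol.ne_of_lt (hb : 2 ≤ b) (hv : -1 < v) (hvv : v < v')
    (h : IsSol a x (yvec b v 0)) (h' : IsSol a' x' (yvec b v' 0)) : a ≠ a' := by
  rintro rfl
  have hA := alternating_yvec (b := b) (v := v) (η := 0) (by linarith) le_rfl (by norm_num)
  have hA' := alternating_yvec (b := b) (v := v') (η := 0) (by linarith) le_rfl (by norm_num)
  have hx := h.nodes_unique hA h' hA'
  have h1 := h.val ⟨1, by omega⟩
  rw [hx, h'.val, yvec_one, yvec_one] at h1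
  exact hvv.ne' h1

end Comparison

/-- Coefficients are controlled by the values on `[-1,1]`. -/
lemma exists_norm_le_of_abs_evalP_le (n : ℕ) :
    ∃ K : ℝ, 0 ≤ K ∧ ∀ (a : Fin n → ℝ) (M : ℝ), 0 ≤ M →
      (∀ t ∈ Icc (-1 : ℝ) 1, |evalP a t| ≤ M) → ‖a‖ ≤ K * M := by
  classical
  set node : Fin n → ℝ := fun j => (j : ℝ) / n with hnode
  let L : (Fin n → ℝ) →ₗ[ℝ] (Fin n → ℝ) :=
    { toFun := fun a j => evalP a (node j)
      map_add' := fun a c => by funext j; simp [evalP, add_mul, Finset.sum_add_distrib]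
      map_smul' := fun r a => by funext j; simp [evalP_smul] }
  have hnI : ∀ j, node j ∈ Icc (-1 : ℝ) 1 := fun j => by
    have hj : (j : ℝ) ≤ n := by exact_mod_cast j.2.le
    have h0 : (0 : ℝ) ≤ node j := by simp only [hnode]; positivity
    exact ⟨by linarith, div_le_one_of_le₀ hj (by positivity)⟩
  have hker : LinearMap.ker L = ⊥ := by
    rw [LinearMap.ker_eq_bot']
    intro a ha
    have hinj : Function.Injective node := fun i j hij => by
      have hn : (n : ℝ) ≠ 0 := by exact_mod_cast (Fin.pos i).ne'
      have : (i : ℝ) = j := by simpa [hnode, div_left_inj' hn] using hij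
      exact Fin.ext (by exact_mod_cast this)
    refine eq_zero_of_evalP_eq_zero (s := Finset.univ.image node) ?_ ?_
    · rw [Finset.card_image_of_injective _ hinj]; simp
    · intro t ht
      obtain ⟨j, -, rfl⟩ := Finset.mem_image.1 ht
      exact congrFun ha j
  obtain ⟨K, -, hK⟩ := L.exists_antilipschitzWith hker
  refine ⟨K, K.2, fun a M hM h => ?_⟩
  have h1 := hK.le_mul_dist a 0
  rw [dist_zero_right, map_zero, dist_zero_right] at h1
  refine h1.trans (mul_le_mul_of_nonneg_left ?_ K.2)
  rw [pi_norm_le_iff_of_nonneg hM]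
  exact fun j => h _ (hnI j)

/-- Polynomials with convergent alternating node values subconverge. -/
lemma IsSol.exists_subseq {b : ℕ} {a x y : ℕ → Fin (b + 2) → ℝ} {y₀ : Fin (b + 2) → ℝ}
    (hy : Tendsto y atTop (𝓝 y₀)) (hA : ∀ n, Alternating (y n))
    (h : ∀ n, IsSol (a n) (x n) (y n)) :
    ∃ (a₀ x₀ : Fin (b + 2) → ℝ) (φ : ℕ → ℕ), StrictMono φ ∧
      Tendsto (a ∘ φ) atTop (𝓝 a₀) ∧ Tendsto (x ∘ φ) atTop (𝓝 x₀) ∧ Monotone x₀ ∧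
      x₀ 0 = -1 ∧ x₀ (Fin.last (b + 1)) = 1 ∧ (∀ j, evalP a₀ (x₀ j) = y₀ j) ∧
      ∀ i : Fin b, derivP a₀ (x₀ i.succ.castSucc) = 0 := by
  obtain ⟨K, hK0, hK⟩ := exists_norm_le_of_abs_evalP_le (b + 2)
  obtain ⟨M, hM⟩ := (Metric.isBounded_range_of_tendsto y hy).exists_norm_le
  have hM' : ∀ n, ‖y n‖ ≤ M := fun n => hM _ (mem_range_self n)
  have hM0 : 0 ≤ M := (norm_nonneg _).trans (hM' 0)
  have hmem : ∀ n, (a n, x n) ∈ Metric.closedBall (0 : Fin (b + 2) → ℝ) (K * M) ×ˢ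
      Metric.closedBall (0 : Fin (b + 2) → ℝ) 1 := fun n => by
    refine ⟨?_, ?_⟩
    · rw [mem_closedBall_zero_iff]
      exact hK _ _ hM0 fun t ht => (h n).abs_evalP_le (hA n)
        (fun j => (norm_le_pi_norm (y n) j).trans (hM' n)) ht
    · rw [mem_closedBall_zero_iff, pi_norm_le_iff_of_nonneg zero_le_one]
      exact fun j => abs_le.2 ((h n).mem_Icc j)
  obtain ⟨⟨a₀, x₀⟩, -, φ, hφ, hlim⟩ :=
    ((isCompact_closedBall _ _).prod (isCompact_closedBall _ _)).tendsto_subseq hmem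
  have ha : Tendsto (a ∘ φ) atTop (𝓝 a₀) := (continuous_fst.tendsto _).comp hlim
  have hx : Tendsto (x ∘ φ) atTop (𝓝 x₀) := (continuous_snd.tendsto _).comp hlim
  have hxj : ∀ j, Tendsto (fun n => x (φ n) j) atTop (𝓝 (x₀ j)) := fun j =>
    (continuous_apply j).tendsto _ |>.comp hx
  refine ⟨a₀, x₀, φ, hφ, ha, hx, ?_, ?_, ?_, ?_, ?_⟩
  · exact fun i j hij => le_of_tendsto_of_tendsto' (hxj i) (hxj j) fun n =>
      (h (φ n)).mono.monotone hij
  · refine tendsto_nhds_unique (hxj 0) ?_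
    simp only [(h _).first]
    exact tendsto_const_nhds
  · refine tendsto_nhds_unique (hxj _) ?_
    simp only [(h _).last]
    exact tendsto_const_nhds
  · intro j
    have h1 : Tendsto (fun n => evalP (a (φ n)) (x (φ n) j)) atTop (𝓝 (evalP a₀ (x₀ j))) :=
      (continuous_evalP_uncurry.tendsto (a₀, x₀ j)).comp (ha.prodMk_nhds (hxj j))
    refine tendsto_nhds_unique h1 ?_
    simp only [(h _).val]
    exact ((continuous_apply j).tendsto _).comp (hy.comp hφ.tendsto_atTop)
  · intro i
    have h1 : Tendsto (fun n => derivP (a (φ n)) (x (φ n) i.succ.castSucc)) atTop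
        (𝓝 (derivP a₀ (x₀ i.succ.castSucc))) :=
      (continuous_derivP_uncurry.tendsto (a₀, x₀ i.succ.castSucc)).comp (ha.prodMk_nhds (hxj _))
    refine tendsto_nhds_unique h1 ?_
    simp only [(h _).crit]
    exact tendsto_const_nhds

lemma isSol_of_monotone {b : ℕ} {a x y : Fin (b + 2) → ℝ} (hy : Alternating y) (hm : Monotone x)
    (h0 : x 0 = -1) (h1 : x (Fin.last (b + 1)) = 1) (hv : ∀ j, evalP a (x j) = y j)
    (hc : ∀ i : Fin b, derivP a (x i.succ.castSucc) = 0) : IsSol a x y := by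
  refine ⟨?_, h0, h1, hv, hc⟩
  rw [Fin.strictMono_iff_lt_succ]
  intro j
  refine lt_of_le_of_ne (hm Fin.castSucc_lt_succ.le) fun heq => ?_
  have := hy j
  rw [← hv, ← hv, heq, sub_self, mul_zero] at this
  exact lt_irrefl _ this

/-- Solutions depend continuously on the node values, near node values with a unique solution. -/
lemma eventually_forall_isSol {b : ℕ} {a₀ x₀ y₀ : Fin (b + 2) → ℝ} (hy₀ : Alternating y₀)
    (huniq : ∀ a x, IsSol a x y₀ → a = a₀ ∧ x = x₀)
    {p : (Fin (b + 2) → ℝ) × (Fin (b + 2) → ℝ) → Prop} (hp : ∀ᶠ q in 𝓝 (a₀, x₀), p q) :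
    ∀ᶠ y in 𝓝 y₀, ∀ a x, Alternating y → IsSol a x y → p (a, x) := by
  by_contra hcon
  rw [not_eventually] at hcon
  obtain ⟨y, hy, hbad⟩ := exists_seq_forall_of_frequently hcon
  push Not at hbad
  choose a x hA hs hnp using hbad
  obtain ⟨a', x', φ, -, ha, hx, hm, h0, h1, hv, hc⟩ := IsSol.exists_subseq hy hA hs
  obtain ⟨rfl, rfl⟩ := huniq a' x' (isSol_of_monotone hy₀ hm h0 h1 hv hc)
  obtain ⟨n, hn⟩ := ((ha.prodMk_nhds hx).eventually hp).exists
  exact hnp _ hn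

/-- The node equations, as a map of coefficients and nodes. -/
noncomputable def nodeMap (b : ℕ) (q : (Fin (b + 2) → ℝ) × (Fin (b + 2) → ℝ)) :
    (Fin (b + 2) → ℝ) × (Fin (b + 2) → ℝ) :=
  (fun j => evalP q.1 (q.2 j),
    fun j => if j = 0 ∨ j = Fin.last (b + 1) then q.2 j else derivP q.1 (q.2 j))

lemma contDiff_nodeMap (b : ℕ) : ContDiff ℝ 1 (nodeMap b) := by
  refine ContDiff.prodMk (contDiff_pi.2 fun j => ?_) (contDiff_pi.2 fun j => ?_)
  · unfold evalP; fun_prop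
  · split_ifs
    · fun_prop
    · unfold derivP; fun_prop

/-- The second derivative of the polynomial with coefficient vector `a`. -/
lemma exists_hasDerivAt_derivP {n : ℕ} (a : Fin n → ℝ) (t : ℝ) :
    ∃ d, HasDerivAt (derivP a) d t := by
  have := (toPoly a).derivative.hasDerivAt t
  exact ⟨_, this.congr_of_eventuallyEq
    (Eventually.of_forall fun t => (eval_derivative_toPoly a t).symm)⟩

lemma IsSol.hasDerivAt_derivP_ne_zero {b : ℕ} {a x y : Fin (b + 2) → ℝ} (h : IsSol a x y)
    (hy : Alternating y) (i : Fin b) {d : ℝ} (hd : HasDerivAt (derivP a) d (x i.succ.castSucc)) :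
    d ≠ 0 := by
  classical
  set R : ℝ → ℝ := fun t => (b + 1) * a (Fin.last (b + 1)) *
    ∏ k ∈ Finset.univ.erase i, (t - x k.succ.castSucc) with hR
  have hfac : derivP a = fun t => (t - x i.succ.castSucc) * R t := by
    funext t
    rw [h.derivP_eq_prod, ← Finset.mul_prod_erase _ _ (Finset.mem_univ i)]
    simp only [hR]; ring
  have hRc : DifferentiableAt ℝ R (x i.succ.castSucc) := by
    simp only [hR]; fun_prop
  have h2 := ((hasDerivAt_id (x i.succ.castSucc)).sub_const (x i.succ.castSucc)).mul
    hRc.hasDerivAt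
  have h3 : d = R (x i.succ.castSucc) := by
    rw [hfac] at hd
    have := hd.unique h2
    simpa using this
  rw [h3]
  have hb : ((b : ℝ) + 1) ≠ 0 := by positivity
  refine mul_ne_zero (mul_ne_zero hb (h.last_ne_zero hy)) (Finset.prod_ne_zero_iff.2 fun k hk => ?_)
  refine sub_ne_zero.2 fun heq => (Finset.mem_erase.1 hk).1 ?_
  have := h.mono.injective heq
  simpa [Fin.ext_iff] using this.symm

lemma fin_cases_node {b : ℕ} {j : Fin (b + 2)} (hj : ¬ (j = 0 ∨ j = Fin.last (b + 1))) :
    ∃ i : Fin b, j = i.succ.castSucc := by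
  push Not at hj
  rcases Fin.eq_castSucc_or_eq_last j with ⟨i, rfl⟩ | rfl
  · rcases Fin.eq_zero_or_eq_succ i with rfl | ⟨k, rfl⟩
    · exact absurd rfl hj.1
    · exact ⟨k, rfl⟩
  · exact absurd rfl hj.2

lemma IsSol.ker_fderiv_nodeMap {b : ℕ} {a x y : Fin (b + 2) → ℝ} (h : IsSol a x y)
    (hy : Alternating y) : LinearMap.ker (fderiv ℝ (nodeMap b) (a, x)).toLinearMap = ⊥ := by
  classical
  rw [LinearMap.ker_eq_bot']
  rintro ⟨α, ξ⟩ hz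
  have hF : HasFDerivAt (nodeMap b) (fderiv ℝ (nodeMap b) (a, x)) (a, x) :=
    ((contDiff_nodeMap b).differentiable (by norm_num)).differentiableAt.hasFDerivAt
  have hline : HasDerivAt (fun s : ℝ => (a, x) + s • (α, ξ)) (α, ξ) 0 := by
    simpa using ((hasDerivAt_id (0 : ℝ)).smul_const (α, ξ)).const_add (a, x)
  have hcomp : HasDerivAt (fun s : ℝ => nodeMap b ((a, x) + s • (α, ξ))) 0 0 := by
    have h1 : HasFDerivAt (nodeMap b) (fderiv ℝ (nodeMap b) (a, x))
      ((fun s : ℝ => (a, x) + s • (α, ξ)) 0) := by simpa using hF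
    have := h1.comp_hasDerivAt (0 : ℝ) hline
    have hz' : fderiv ℝ (nodeMap b) (a, x) (α, ξ) = 0 := hz
    rwa [hz'] at this
  have hc1 : ∀ j, HasDerivAt (fun s : ℝ => evalP (a + s • α) (x j + s * ξ j)) 0 0 := fun j => by
    have := ((ContinuousLinearMap.proj (R := ℝ) (φ := fun _ : Fin (b + 2) => ℝ) j).comp
      (ContinuousLinearMap.fst ℝ (Fin (b + 2) → ℝ) (Fin (b + 2) → ℝ))).hasFDerivAt.comp_hasDerivAt
        (0 : ℝ) hcomp
    simpa [nodeMap, Function.comp_def] using this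
  have hc2 : ∀ j, HasDerivAt (fun s : ℝ => if j = 0 ∨ j = Fin.last (b + 1) then x j + s * ξ j
      else derivP (a + s • α) (x j + s * ξ j)) 0 0 := fun j => by
    have := ((ContinuousLinearMap.proj (R := ℝ) (φ := fun _ : Fin (b + 2) => ℝ) j).comp
      (ContinuousLinearMap.snd ℝ (Fin (b + 2) → ℝ) (Fin (b + 2) → ℝ))).hasFDerivAt.comp_hasDerivAt
        (0 : ℝ) hcomp
    simpa [nodeMap, Function.comp_def] using this
  have hadd : ∀ (s t : ℝ), evalP (a + s • α) t = evalP a t + s * evalP α t := fun s t => by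
    simp [evalP, add_mul, Finset.sum_add_distrib, Finset.mul_sum, mul_assoc]
  have hadd' : ∀ (s t : ℝ), derivP (a + s • α) t = derivP a t + s * derivP α t := fun s t => by
    simp [derivP, add_mul, Finset.sum_add_distrib, Finset.mul_sum, mul_assoc]
  have hinner : ∀ j, HasDerivAt (fun s : ℝ => x j + s * ξ j) (ξ j) 0 := fun j => by
    simpa using ((hasDerivAt_id (0 : ℝ)).mul_const (ξ j)).const_add (x j)
  have hchain : ∀ j (F : ℝ → ℝ) (d : ℝ), HasDerivAt F d (x j) →
      HasDerivAt (fun s : ℝ => F (x j + s * ξ j)) (d * ξ j) 0 := fun j F d hFd => by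
    have h1 : HasDerivAt F d ((fun s : ℝ => x j + s * ξ j) 0) := by simpa using hFd
    exact h1.comp (0 : ℝ) (hinner j)
  have hend : ∀ j, j = 0 ∨ j = Fin.last (b + 1) → ξ j = 0 := fun j hj => by
    have := hc2 j
    simp only [if_pos hj] at this
    exact (hinner j).unique this
  have hα : ∀ j, evalP α (x j) = 0 := fun j => by
    have h1 := hc1 j
    simp only [hadd] at h1
    have h2 := (hchain j _ _ (hasDerivAt_evalP a (x j))).add
      ((hasDerivAt_id (0 : ℝ)).mul (hchain j _ _ (hasDerivAt_evalP α (x j))))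
    have h3 := h2.unique h1
    have h4 : derivP a (x j) * ξ j = 0 := by
      by_cases hj : j = 0 ∨ j = Fin.last (b + 1)
      · rw [hend j hj, mul_zero]
      · obtain ⟨i, rfl⟩ := fin_cases_node hj
        rw [h.crit, zero_mul]
    rw [h4] at h3
    simpa using h3
  have hα0 : α = 0 := by
    refine eq_zero_of_evalP_eq_zero (s := Finset.univ.image x) ?_ ?_
    · rw [Finset.card_image_of_injective _ h.mono.injective]; simp
    · intro t ht
      obtain ⟨j, -, rfl⟩ := Finset.mem_image.1 ht
      exact hα j
  refine Prod.ext hα0 (funext fun j => ?_)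
  by_cases hj : j = 0 ∨ j = Fin.last (b + 1)
  · exact hend j hj
  · obtain ⟨i, rfl⟩ := fin_cases_node hj
    obtain ⟨d, hd⟩ := exists_hasDerivAt_derivP a (x i.succ.castSucc)
    have h1 := hc2 i.succ.castSucc
    simp only [if_neg hj, hα0, smul_zero, add_zero] at h1
    have h2 := (hchain _ _ _ hd).unique h1
    exact (mul_eq_zero.1 h2).resolve_left (h.hasDerivAt_derivP_ne_zero hy i hd)

/-- Solvability of the node equations is an open condition. -/
lemma IsSol.eventually_exists {b : ℕ} {a x y : Fin (b + 2) → ℝ} (h : IsSol a x y)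
    (hy : Alternating y) : ∀ᶠ y' in 𝓝 y, ∃ a' x', IsSol a' x' y' := by
  classical
  have hstrict : HasStrictFDerivAt (nodeMap b) (fderiv ℝ (nodeMap b) (a, x)) (a, x) :=
    (contDiff_nodeMap b).contDiffAt.hasStrictFDerivAt (by norm_num)
  have hsurj : (fderiv ℝ (nodeMap b) (a, x)).range = ⊤ :=
    LinearMap.ker_eq_bot_iff_range_eq_top.1 (h.ker_fderiv_nodeMap hy)
  have hmap := hstrict.map_nhds_eq_of_surj hsurj
  set e : Fin (b + 2) → ℝ := fun j => if j = 0 then -1 else if j = Fin.last (b + 1) then 1 else 0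
    with he
  have hval : nodeMap b (a, x) = (y, e) := by
    refine Prod.ext (funext h.val) (funext fun j => ?_)
    simp only [nodeMap, he]
    by_cases hj : j = 0 ∨ j = Fin.last (b + 1)
    · rw [if_pos hj]
      rcases hj with rfl | rfl
      · simp [h.first]
      · rw [if_neg (Fin.last_pos' ).ne', if_pos rfl, h.last]
    · rw [if_neg hj]
      rw [if_neg (fun h => hj (Or.inl h)), if_neg (fun h => hj (Or.inr h))]
      obtain ⟨i, rfl⟩ := fin_cases_node hj
      exact h.crit i
  have hopen : {q : (Fin (b + 2) → ℝ) × (Fin (b + 2) → ℝ) |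
      ∀ j : Fin (b + 1), q.2 j.castSucc < q.2 j.succ} ∈ 𝓝 (a, x) := by
    refine IsOpen.mem_nhds ?_ fun j => h.mono Fin.castSucc_lt_succ
    simp only [ofPred_forall]
    exact isOpen_iInter_of_finite fun j => isOpen_lt (by fun_prop) (by fun_prop)
  have himg := image_mem_map hopen (m := nodeMap b)
  rw [hmap, hval] at himg
  have hcurve : Tendsto (fun y' : Fin (b + 2) → ℝ => (y', e)) (𝓝 y) (𝓝 (y, e)) :=
    (Continuous.prodMk_left e).tendsto y
  filter_upwards [hcurve himg] with y' hy'
  obtain ⟨⟨a', x'⟩, hmono, heq⟩ := hy'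
  have h1 := congrArg Prod.fst heq
  have h2 := congrArg Prod.snd heq
  have h2j : ∀ j, (if j = 0 ∨ j = Fin.last (b + 1) then x' j else derivP a' (x' j)) = e j :=
    fun j => congrFun h2 j
  refine ⟨a', x', Fin.strictMono_iff_lt_succ.2 hmono, ?_, ?_, fun j => congrFun h1 j, fun i => ?_⟩
  · have := h2j 0
    simpa [he] using this
  · have := h2j (Fin.last (b + 1))
    rw [if_pos (Or.inr rfl)] at this
    simpa [he] using this
  · have := h2j i.succ.castSucc
    have n1 : i.succ.castSucc ≠ 0 := by simp [Fin.ext_iff]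
    have n2 : i.succ.castSucc ≠ Fin.last (b + 1) := by
      have := i.2
      simp [Fin.ext_iff]; omega
    simpa [he, n1, n2] using this

/-- Every polynomial is the derivative of a polynomial. -/
lemma exists_derivP_eq {b : ℕ} {R : Polynomial ℝ} (hR : R.natDegree < b + 1) :
    ∃ a : Fin (b + 2) → ℝ, ∀ t, derivP a t = R.eval t := by
  refine ⟨fun j => R.coeff ((j : ℕ) - 1) / (j : ℕ), fun t => ?_⟩
  rw [Polynomial.eval_eq_sum_range' hR, derivP, Fin.sum_univ_succ,
    ← Fin.sum_univ_eq_sum_range (fun i => R.coeff i * t ^ i)]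
  simp only [Fin.val_zero, Nat.cast_zero, zero_mul, mul_zero, zero_add, Fin.val_succ,
    Nat.add_sub_cancel]
  refine Finset.sum_congr rfl fun i _ => ?_
  have : ((i : ℕ) + 1 : ℕ) ≠ (0 : ℝ) := by positivity
  field_simp

lemma exists_isSol_alternating (b : ℕ) :
    ∃ a x y : Fin (b + 2) → ℝ, Alternating y ∧ IsSol a x y := by
  classical
  set x : Fin (b + 2) → ℝ := fun j => -1 + 2 * (j : ℕ) / (b + 1) with hx
  have hb : (0 : ℝ) < b + 1 := by positivity
  have hmono : StrictMono x := fun i j hij => by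
    have : ((i : ℕ) : ℝ) < (j : ℕ) := by exact_mod_cast hij
    simp only [hx]
    gcongr
  obtain ⟨a, ha⟩ := exists_derivP_eq (b := b)
    (R := ∏ i : Fin b, (Polynomial.C (x i.succ.castSucc) - Polynomial.X)) (by
      refine Nat.lt_succ_of_le ((Polynomial.natDegree_prod_le _ _).trans ?_)
      refine (Finset.sum_le_card_nsmul _ _ 1 fun i _ => ?_).trans (by simp)
      exact (Polynomial.natDegree_sub_le _ _).trans (by simp))
  have hd : ∀ t, derivP a t = ∏ i : Fin b, (x i.succ.castSucc - t) := fun t => by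
    rw [ha, Polynomial.eval_prod]; simp
  refine ⟨a, x, fun j => evalP a (x j), fun j => ?_, hmono, by simp [hx], ?_, fun _ => rfl,
    fun i => ?_⟩
  · have hlt : x j.castSucc < x j.succ := hmono Fin.castSucc_lt_succ
    obtain ⟨t, ht, hs⟩ := exists_hasDerivAt_eq_slope (evalP a) (derivP a) hlt
      (continuous_evalP a).continuousOn fun t _ => hasDerivAt_evalP a t
    rw [eq_div_iff (sub_pos.2 hlt).ne'] at hs
    rw [← hs, ← mul_assoc]
    refine mul_pos ?_ (sub_pos.2 hlt)
    have hsign : (-1 : ℝ) ^ (j : ℕ) = ∏ i : Fin b, if (i : ℕ) < j then (-1 : ℝ) else 1 := by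
      rw [Finset.prod_ite, Finset.prod_const, Finset.prod_const_one, mul_one,
        Fin.card_filter_val_lt, min_eq_right (by have := j.2; omega)]
    rw [hd, hsign, ← Finset.prod_mul_distrib]
    refine Finset.prod_pos fun i _ => ?_
    split_ifs with hij
    · have : x i.succ.castSucc ≤ x j.castSucc := hmono.monotone (by rw [Fin.le_def]; simpa using hij)
      linarith [ht.1]
    · have : x j.succ ≤ x i.succ.castSucc := hmono.monotone (by rw [Fin.le_def]; simpa using hij)
      linarith [ht.2]
  · simp only [hx, Fin.val_last]
    push_cast
    field_simp
    ring
  · rw [hd]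
    exact Finset.prod_eq_zero (Finset.mem_univ i) (sub_self _)

/-- Any alternating sequence of node values is realised by a polynomial. -/
theorem exists_isSol {b : ℕ} {y : Fin (b + 2) → ℝ} (hy : Alternating y) :
    ∃ a x, IsSol a x y := by
  set s : Set (Fin (b + 2) → ℝ) := {y | Alternating y} with hs
  have hopen : IsOpen s := by
    simp only [hs, Alternating, ofPred_forall]
    exact isOpen_iInter_of_finite fun j => isOpen_lt (by fun_prop) (by fun_prop)
  have hconv : Convex ℝ s := by
    intro y hy z hz r q hr hq hrq j
    have h1 := hy j
    have h2 := hz j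
    have e : (-1 : ℝ) ^ (j : ℕ) * ((r • y + q • z) j.succ - (r • y + q • z) j.castSucc) =
        r * ((-1 : ℝ) ^ (j : ℕ) * (y j.succ - y j.castSucc)) +
          q * ((-1 : ℝ) ^ (j : ℕ) * (z j.succ - z j.castSucc)) := by
      simp only [Pi.add_apply, Pi.smul_apply, smul_eq_mul]
      ring
    rw [e]
    rcases hr.eq_or_lt with rfl | hr
    · have : q = 1 := by linarith
      subst this
      simpa using h2
    · exact add_pos_of_pos_of_nonneg (mul_pos hr h1) (mul_nonneg hq h2.le)
  set u : Set (Fin (b + 2) → ℝ) := {y | Alternating y ∧ ∃ a x, IsSol a x y} with hu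
  have huo : IsOpen u := by
    rw [isOpen_iff_mem_nhds]
    rintro y ⟨hA, a, x, h⟩
    filter_upwards [hopen.mem_nhds hA, h.eventually_exists hA] with z hz hz' using ⟨hz, hz'⟩
  have hne : (s ∩ u).Nonempty := by
    obtain ⟨a, x, y, hA, h⟩ := exists_isSol_alternating b
    exact ⟨y, hA, hA, a, x, h⟩
  refine (hconv.isPreconnected.subset_of_closure_inter_subset huo hne ?_ hy).2
  rintro z ⟨hz, hA⟩
  obtain ⟨w, hw, hlim⟩ := mem_closure_iff_seq_limit.1 hz
  choose hwA a x hsol using hw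
  obtain ⟨a₀, x₀, φ, -, -, -, hm, h0, h1, hv, hc⟩ := IsSol.exists_subseq hlim hwA hsol
  exact ⟨hA, a₀, x₀, isSol_of_monotone hA hm h0 h1 hv hc⟩

/-- Nodes indexed by natural numbers. -/
noncomputable def nd {b : ℕ} (x : Fin (b + 2) → ℝ) (j : ℕ) : ℝ := x (Fin.ofNat (b + 2) j)

lemma nd_eq {b : ℕ} (x : Fin (b + 2) → ℝ) {j : ℕ} (hj : j < b + 2) : nd x j = x ⟨j, hj⟩ := by
  unfold nd
  congr 1
  exact Fin.ext (Nat.mod_eq_of_lt hj)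

lemma continuous_nd {b : ℕ} (j : ℕ) : Continuous fun x : Fin (b + 2) → ℝ => nd x j :=
  continuous_apply _

section

variable {b : ℕ} {v η : ℝ} {a x : Fin (b + 2) → ℝ}

lemma IsSol.nd_zero {y} (h : IsSol a x y) : nd x 0 = -1 := by
  rw [nd_eq x (by omega)]; exact h.first

lemma IsSol.nd_last {y} (h : IsSol a x y) : nd x (b + 1) = 1 := by
  rw [nd_eq x (by omega)]; exact h.last

lemma IsSol.nd_lt {y} (h : IsSol a x y) {i j : ℕ} (hij : i < j) (hj : j < b + 2) :
    nd x i < nd x j := by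
  rw [nd_eq x (hij.trans hj), nd_eq x hj]
  exact h.mono (by simpa [Fin.lt_def] using hij)

lemma IsSol.nd_le {y} (h : IsSol a x y) {i j : ℕ} (hij : i ≤ j) (hj : j < b + 2) :
    nd x i ≤ nd x j := by
  rcases hij.eq_or_lt with rfl | hij
  · rfl
  · exact (h.nd_lt hij hj).le

lemma IsSol.nd_mem {y} (h : IsSol a x y) {j : ℕ} (hj : j < b + 2) : nd x j ∈ Icc (-1 : ℝ) 1 := by
  rw [nd_eq x hj]; exact h.mem_Icc _

lemma IsSol.evalP_nd_one (h : IsSol a x (yvec b v η)) : evalP a (nd x 1) = v := by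
  rw [nd_eq x (by omega), h.val, yvec_one]

lemma IsSol.evalP_nd_two (hb : 1 ≤ b) (h : IsSol a x (yvec b v η)) :
    evalP a (nd x 2) = -1 + η := by
  rw [nd_eq x (by omega), h.val, yvec_two]

lemma IsSol.evalP_nd (h : IsSol a x (yvec b v η)) {j : ℕ} (hj : j < b + 2) (h3 : 3 ≤ j) :
    evalP a (nd x j) = (-1) ^ (j + 1) := by
  rw [nd_eq x hj, h.val, yvec_of_three_le _ h3]

lemma IsSol.evalP_neg_one (h : IsSol a x (yvec b v η)) : evalP a (-1) = -1 := by
  have := h.val 0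
  rwa [h.first, show yvec b v η 0 = -1 from yvec_zero (by omega) v η] at this

lemma IsSol.evalP_one (hb : 2 ≤ b) (h : IsSol a x (yvec b v η)) : evalP a 1 = (-1) ^ b := by
  have := h.evalP_nd (j := b + 1) (by omega) (by omega)
  rw [h.nd_last, pow_succ, pow_succ] at this
  simpa using this

lemma IsSol.evalP_mem (h : IsSol a x (yvec b v η)) (hv : -1 + η < v) (hv1 : v ≤ 1) (h0 : 0 ≤ η)
    {t : ℝ} (ht : t ∈ Icc (-1 : ℝ) 1) : evalP a t ∈ Icc (-1 : ℝ) 1 :=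
  abs_le.1 (h.abs_evalP_le (alternating_yvec hv h0 (by linarith))
    (fun j => abs_yvec_le (abs_le.2 ⟨by linarith, hv1⟩) h0 (by linarith) j) ht)

/-- The maps considered satisfy the hypotheses of the entropy estimates. -/
lemma IsSol.nearCheb (hb : 2 ≤ b) (h : IsSol a x (yvec b v η)) (hv : -1 + η < v) (hv1 : v ≤ 1)
    (h0 : 0 ≤ η) {θ : ℝ} (hθ : θ = 1 ∨ θ = -1) : NearCheb b θ η v (evalP (θ • a)) (nd x) := by
  have hA : Alternating (yvec b v η) := alternating_yvec hv h0 (by linarith)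
  have hθ2 : θ * θ = 1 := by rcases hθ with rfl | rfl <;> norm_num
  refine ⟨⟨continuous_evalP _, fun t ht => ?_, h.nd_zero, h.nd_last,
    fun j hj => h.nd_lt (Nat.lt_succ_self j) (by omega), fun j hj => ?_⟩, hb, hθ, ?_, ?_, ?_, ?_, h0⟩
  · have := h.evalP_mem hv hv1 h0 ht
    rw [evalP_smul]
    rcases hθ with rfl | rfl
    · simpa using this
    · constructor <;> linarith [this.1, this.2]
  · have := h.strictMonoOn_lap hA ⟨j, by omega⟩
    rw [nd_eq x (by omega), nd_eq x (by omega)]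
    refine StrictMonoOn.congr (f₁ := fun t => (-1 : ℝ) ^ j * evalP a t) ?_ ?_
    · simpa using this
    · intro t _
      simp only [evalP_smul]
      linear_combination (-(-1 : ℝ) ^ j * evalP a t) * hθ2
  · rw [h.nd_zero, evalP_smul, h.evalP_neg_one]; ring
  · rw [evalP_smul, h.evalP_nd_one]
  · rw [evalP_smul, h.evalP_nd_two (by omega)]
  · intro j h3 hj
    rw [evalP_smul, h.evalP_nd (by omega) h3]

end

/-- The neighbourhood of size `d'` of the end `e'` is covered by the image of the neighbourhood of
size `d` of the end `e`. -/
def Cov (f : ℝ → ℝ) (e d e' d' : ℝ) : Prop := ∀ y ∈ endNhd e' d', ∃ t ∈ endNhd e d, f t = y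

/-- The neighbourhood of size `d₁` of the end `e₁` is mapped into that of size `d₂` of `e₂`. -/
def Hit (f : ℝ → ℝ) (e₁ d₁ e₂ d₂ : ℝ) : Prop := ∀ t ∈ endNhd e₁ d₁, f t ∈ endNhd e₂ d₂

/-- The sequence alternating between `e₀` and `e₁`. -/
noncomputable def endSeq (e₀ e₁ : ℝ) (n : ℕ) : ℝ := if Even n then e₀ else e₁

lemma endSeq_add_two (e₀ e₁ : ℝ) (n : ℕ) : endSeq e₀ e₁ (n + 2) = endSeq e₀ e₁ n := by
  simp [endSeq, Nat.even_add]

/-- Radii of a chain of coverings. -/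
structure CovChain (f : ℝ → ℝ) (e₀ e₁ w₀ w₁ : ℝ) (k : ℕ) (d D : ℝ) (r : ℕ → ℝ) : Prop where
  zero : r 0 = d
  last : r k = D
  even : Even k
  cov : ∀ n < k, Cov f (endSeq e₀ e₁ n) (r n) (endSeq e₀ e₁ (n + 1)) (r (n + 1))
  le : ∀ n < k, r n ≤ endSeq w₀ w₁ n

/-- Radii of a chain of inclusions. -/
structure HitChain (f : ℝ → ℝ) (e₀ e₁ δ : ℝ) (k : ℕ) (d : ℝ) (r : ℕ → ℝ) : Prop where
  zero : r 0 = d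
  even : Even k
  hit : ∀ n < k, Hit f (endSeq e₀ e₁ n) (r n) (endSeq e₀ e₁ (n + 1)) (r (n + 1))
  le : ∀ n ≤ k, r n ≤ δ

lemma CovChain.cons {f : ℝ → ℝ} {e₀ e₁ w₀ w₁ d d' d'' D : ℝ} {k : ℕ}
    (h : ∃ r, CovChain f e₀ e₁ w₀ w₁ k d'' D r) (h0 : Cov f e₀ d e₁ d') (h1 : Cov f e₁ d' e₀ d'')
    (hd : d ≤ w₀) (hd' : d' ≤ w₁) : ∃ r, CovChain f e₀ e₁ w₀ w₁ (k + 2) d D r := by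
  obtain ⟨r, hr⟩ := h
  refine ⟨fun n => match n with | 0 => d | 1 => d' | n + 2 => r n, rfl, hr.last, ?_, ?_, ?_⟩
  · exact hr.even.add (by decide)
  · rintro (_ | _ | n) hn
    · simpa [endSeq] using h0
    · simpa [endSeq, hr.zero] using h1
    · have := hr.cov n (by omega)
      rw [← endSeq_add_two e₀ e₁ n, ← endSeq_add_two e₀ e₁ (n + 1)] at this
      exact this
  · rintro (_ | _ | n) hn
    · simpa [endSeq] using hd
    · simpa [endSeq] using hd'
    · have := hr.le n (by omega)
      rwa [← endSeq_add_two] at this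

lemma HitChain.cons {f : ℝ → ℝ} {e₀ e₁ δ d d' d'' : ℝ} {k : ℕ}
    (h : ∃ r, HitChain f e₀ e₁ δ k d'' r) (h0 : Hit f e₀ d e₁ d') (h1 : Hit f e₁ d' e₀ d'')
    (hd : d ≤ δ) (hd' : d' ≤ δ) : ∃ r, HitChain f e₀ e₁ δ (k + 2) d r := by
  obtain ⟨r, hr⟩ := h
  refine ⟨fun n => match n with | 0 => d | 1 => d' | n + 2 => r n, rfl, ?_, ?_, ?_⟩
  · exact hr.even.add (by decide)
  · rintro (_ | _ | n) hn
    · simpa [endSeq] using h0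
    · simpa [endSeq, hr.zero] using h1
    · have := hr.hit n (by omega)
      rw [← endSeq_add_two e₀ e₁ n, ← endSeq_add_two e₀ e₁ (n + 1)] at this
      exact this
  · rintro (_ | _ | n) hn
    · exact hd
    · exact hd'
    · exact hr.le n (by omega)

lemma exists_covChain {f : ℝ → ℝ} {e₀ e₁ w₀ w₁ D L₀ L₁ ρ : ℝ} {M : ℕ}
    (hw₀ : 0 < w₀) (hw₁ : 0 < w₁) (hD : w₀ < D) (hL : 1 < L₀ * L₁) (hL₀ : 0 < L₀)
    (hρ : ρ = w₀ / (D / w₀) ^ M) (hρw : L₀ * ρ ≤ w₁)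
    (hloc₀ : ∀ d, 0 < d → d ≤ ρ → Cov f e₀ d e₁ (L₀ * d))
    (hloc₁ : ∀ d, 0 < d → d ≤ L₀ * ρ → Cov f e₁ d e₀ (L₁ * d))
    (hbig₀ : ∀ t, 0 < t → t ≤ 1 → Cov f e₀ (t * w₀) e₁ (t * w₁))
    (hbig₁ : ∀ t, 0 < t → t ≤ 1 → Cov f e₁ (t * w₁) e₀ (t * D)) (n : ℕ) :
    ∃ r, CovChain f e₀ e₁ w₀ w₁ (2 * (n + M + 1)) (ρ / (L₀ * L₁) ^ n) D r := by
  have hΛ : 1 < D / w₀ := (one_lt_div hw₀).2 hD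
  have hle : ∀ j : ℕ, w₀ / (D / w₀) ^ j ≤ w₀ := fun j =>
    div_le_self hw₀.le (one_le_pow₀ hΛ.le)
  have hbase : ∃ r, CovChain f e₀ e₁ w₀ w₁ 0 D D r :=
    ⟨fun _ => D, rfl, rfl, by decide, fun n hn => by omega, fun n hn => by omega⟩
  have hbig : ∀ j : ℕ, ∃ r, CovChain f e₀ e₁ w₀ w₁ (2 * (j + 1)) (w₀ / (D / w₀) ^ j) D r := by
    intro j
    induction j with
    | zero =>
      refine CovChain.cons (d' := w₁) hbase ?_ ?_ (hle 0) le_rfl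
      · simpa using hbig₀ 1 one_pos le_rfl
      · simpa using hbig₁ 1 one_pos le_rfl
    | succ j ih =>
      have hp : 0 < (D / w₀) ^ (j + 1) := by positivity
      have ht1 : 1 / (D / w₀) ^ (j + 1) ≤ 1 :=
        (div_le_one hp).2 (one_le_pow₀ hΛ.le)
      refine CovChain.cons (d' := 1 / (D / w₀) ^ (j + 1) * w₁) ih ?_ ?_ (hle _) ?_
      · have := hbig₀ (1 / (D / w₀) ^ (j + 1)) (by positivity) ht1
        rwa [one_div_mul_eq_div] at this
      · have := hbig₁ (1 / (D / w₀) ^ (j + 1)) (by positivity) ht1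
        convert this using 1
        have hD0 : 0 < D := hw₀.trans hD
        rw [pow_succ]
        field_simp
      · exact mul_le_of_le_one_left hw₁.le ht1
  have hρ0 : 0 < ρ := by rw [hρ]; positivity
  induction n with
  | zero =>
    have := hbig M
    rw [← hρ] at this
    simpa using this
  | succ n ih =>
    have hp : 0 < (L₀ * L₁) ^ (n + 1) := by positivity
    have hle1 : ρ / (L₀ * L₁) ^ (n + 1) ≤ ρ := div_le_self hρ0.le (one_le_pow₀ hL.le)
    have e : 2 * (n + 1 + M + 1) = 2 * (n + M + 1) + 2 := by ring
    rw [e]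
    refine CovChain.cons (d' := L₀ * (ρ / (L₀ * L₁) ^ (n + 1))) ih
      (hloc₀ _ (by positivity) hle1) ?_ (hle1.trans (hρ ▸ hle M)) ?_
    · have := hloc₁ (L₀ * (ρ / (L₀ * L₁) ^ (n + 1))) (by positivity) (by gcongr)
      convert this using 1
      have : L₁ ≠ 0 := by rintro rfl; norm_num at hL
      rw [pow_succ]
      field_simp
    · exact (mul_le_mul_of_nonneg_left hle1 hL₀.le).trans hρw

lemma exists_hitChain {f : ℝ → ℝ} {e₀ e₁ δ l₀ l₁ C : ℝ} (hl : 1 < l₀ * l₁) (hC : 1 ≤ C)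
    (hC₀ : l₀ ≤ C) (hl₀ : 0 < l₀)
    (h₀ : ∀ d, 0 < d → d ≤ δ → Hit f e₀ d e₁ (l₀ * d))
    (h₁ : ∀ d, 0 < d → d ≤ δ → Hit f e₁ d e₀ (l₁ * d)) (m : ℕ) {d : ℝ} (hd : 0 < d)
    (hdδ : C * (l₀ * l₁) ^ m * d ≤ δ) : ∃ r, HitChain f e₀ e₁ δ (2 * m) d r := by
  induction m generalizing d with
  | zero =>
    refine ⟨fun _ => d, rfl, by decide, fun n hn => by omega, fun n _ => ?_⟩
    have : 1 * d ≤ C * d := by gcongr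
    simp at hdδ
    linarith
  | succ m ih =>
    have h1 : C * d ≤ C * (l₀ * l₁) ^ (m + 1) * d := by
      have : C * 1 * d ≤ C * (l₀ * l₁) ^ (m + 1) * d := by
        gcongr
        exact one_le_pow₀ hl.le
      linarith
    have h2 : d ≤ δ := by nlinarith
    have h3 : l₀ * d ≤ δ := by nlinarith
    refine HitChain.cons (d' := l₀ * d) (d'' := l₁ * (l₀ * d)) (ih (by nlinarith) ?_) (h₀ d hd h2)
      (h₁ _ (by positivity) h3) h2 h3
    calc C * (l₀ * l₁) ^ m * (l₁ * (l₀ * d)) = C * (l₀ * l₁) ^ (m + 1) * d := by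
          rw [pow_succ]; ring
      _ ≤ δ := hdδ

lemma cov_of_le_abs {f : ℝ → ℝ} (hf : Continuous f) {e e' d d' : ℝ} (he : e = 1 ∨ e = -1)
    (he' : e' = 1 ∨ e' = -1) (hd : 0 < d) (hd2 : d ≤ 2) (hfe : f e = e')
    (hI : f (e * (1 - d)) ∈ Icc (-1 : ℝ) 1) (hd' : d' ≤ |f (e * (1 - d)) - e'|) :
    Cov f e d e' d' := by
  rintro y ⟨hyI, hy⟩
  have hlt : |y - e'| < |f (e * (1 - d)) - e'| := hy.trans_le hd'
  have hmem : y ∈ uIcc (f e) (f (e * (1 - d))) := by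
    rw [hfe, Set.mem_uIcc]
    rcases he' with rfl | rfl
    · right
      rw [abs_of_nonpos (by linarith [hyI.2]), abs_of_nonpos (by linarith [hI.2])] at hlt
      exact ⟨by linarith, hyI.2⟩
    · left
      rw [abs_of_nonneg (by linarith [hyI.1]), abs_of_nonneg (by linarith [hI.1])] at hlt
      exact ⟨hyI.1, by linarith⟩
  obtain ⟨t, ht, rfl⟩ := intermediate_value_uIcc hf.continuousOn hmem
  have hne : t ≠ e * (1 - d) := by rintro rfl; exact lt_irrefl _ hlt
  refine ⟨t, ?_, rfl⟩
  rw [Set.mem_uIcc] at ht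
  rcases he with rfl | rfl
  · have h1 : 1 * (1 - d) ≤ t ∧ t ≤ 1 := by
      rcases ht with h | h
      · exact ⟨by linarith [h.1, h.2], by linarith [h.1, h.2]⟩
      · exact h
    have h2 : 1 * (1 - d) < t := lt_of_le_of_ne h1.1 hne.symm
    refine ⟨⟨by linarith, h1.2⟩, ?_⟩
    rw [abs_of_nonpos (by linarith)]; linarith
  · have h1 : -1 ≤ t ∧ t ≤ -1 * (1 - d) := by
      rcases ht with h | h
      · exact h
      · exact ⟨by linarith [h.1, h.2], by linarith [h.1, h.2]⟩
    have h2 : t < -1 * (1 - d) := lt_of_le_of_ne h1.2 hne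
    refine ⟨⟨h1.1, by linarith⟩, ?_⟩
    rw [abs_of_nonneg (by linarith)]; linarith

lemma cov_of_le_abs_derivP {n : ℕ} {c : Fin n → ℝ} {e e' d L : ℝ} (he : e = 1 ∨ e = -1)
    (he' : e' = 1 ∨ e' = -1) (hd : 0 < d) (hd2 : d ≤ 2) (hfe : evalP c e = e')
    (hI : MapsTo (evalP c) (Icc (-1) 1) (Icc (-1) 1))
    (hL : ∀ t, |t - e| ≤ d → L ≤ |derivP c t|) : Cov (evalP c) e d e' (L * d) := by
  have hmem : e * (1 - d) ∈ Icc (-1 : ℝ) 1 := by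
    rcases he with rfl | rfl <;> constructor <;> linarith
  refine cov_of_le_abs (continuous_evalP c) he he' hd hd2 hfe (hI hmem) ?_
  rw [← hfe]
  rcases he with rfl | rfl
  · obtain ⟨t, ht, hs⟩ := exists_hasDerivAt_eq_slope (evalP c) (derivP c)
      (show 1 * (1 - d) < 1 by linarith) (continuous_evalP c).continuousOn
      fun t _ => hasDerivAt_evalP c t
    have h1 := hL t (by rw [abs_of_nonpos (by linarith [ht.2])]; linarith [ht.1])
    rw [hs, abs_div, abs_of_pos (by linarith : (0 : ℝ) < 1 - 1 * (1 - d)),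
      le_div_iff₀ (by linarith), abs_sub_comm] at h1
    linarith
  · obtain ⟨t, ht, hs⟩ := exists_hasDerivAt_eq_slope (evalP c) (derivP c)
      (show -1 < -1 * (1 - d) by linarith) (continuous_evalP c).continuousOn
      fun t _ => hasDerivAt_evalP c t
    have h1 := hL t (by rw [abs_of_nonneg (by linarith [ht.1])]; linarith [ht.2])
    rw [hs, abs_div, abs_of_pos (by linarith : (0 : ℝ) < -1 * (1 - d) - -1),
      le_div_iff₀ (by linarith)] at h1
    linarith

lemma hit_of_abs_derivP_le {n : ℕ} {c : Fin n → ℝ} {e e' d l : ℝ} (hd : 0 < d) (hl : 0 < l)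
    (hfe : evalP c e = e') (hI : MapsTo (evalP c) (Icc (-1) 1) (Icc (-1) 1))
    (h : ∀ t, |t - e| ≤ d → |derivP c t| ≤ l) : Hit (evalP c) e d e' (l * d) := by
  rintro t ⟨htI, ht⟩
  refine ⟨hI htI, ?_⟩
  have h1 := (convex_ball e d).norm_image_sub_le_of_norm_hasDerivWithin_le
    (f := evalP c) (f' := derivP c) (C := l) (x := e) (y := t)
    (fun s _ => (hasDerivAt_evalP c s).hasDerivWithinAt)
    (fun s hs => h s (by rw [Metric.mem_ball, Real.dist_eq] at hs; exact hs.le))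
    (Metric.mem_ball_self hd) (by rw [Metric.mem_ball, Real.dist_eq]; exact ht)
  rw [hfe, Real.norm_eq_abs, Real.norm_eq_abs] at h1
  exact h1.trans_lt (mul_lt_mul_of_pos_left ht hl)

lemma exists_forall_of_eventually_prod {X : Type*} [TopologicalSpace X] {x₀ : X} {e : ℝ}
    {p : X → ℝ → Prop} (h : ∀ᶠ q in 𝓝 (x₀, e), p q.1 q.2) :
    ∃ ρ > 0, ∀ᶠ x in 𝓝 x₀, ∀ t, |t - e| ≤ ρ → p x t := by
  rw [nhds_prod_eq, eventually_prod_iff] at h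
  obtain ⟨pa, hpa, pb, hpb, h⟩ := h
  obtain ⟨ρ, hρ, hball⟩ := Metric.eventually_nhds_iff.1 hpb
  refine ⟨ρ / 2, by positivity, hpa.mono fun x hx t ht => h hx (hball ?_)⟩
  rw [Real.dist_eq]; linarith

lemma eventually_le_abs_derivP {n : ℕ} {a₀ : Fin n → ℝ} {e L : ℝ} (h : L < |derivP a₀ e|) :
    ∃ ρ > 0, ∀ᶠ a in 𝓝 a₀, ∀ t, |t - e| ≤ ρ → L ≤ |derivP a t| := by
  apply exists_forall_of_eventually_prod
  exact ((continuous_abs.comp continuous_derivP_uncurry).tendsto (a₀, e)).eventually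
    ((lt_mem_nhds h).mono fun _ => le_of_lt)

lemma eventually_abs_derivP_le {n : ℕ} {a₀ : Fin n → ℝ} {e l : ℝ} (h : |derivP a₀ e| < l) :
    ∃ ρ > 0, ∀ᶠ a in 𝓝 a₀, ∀ t, |t - e| ≤ ρ → |derivP a t| ≤ l := by
  apply exists_forall_of_eventually_prod
  exact ((continuous_abs.comp continuous_derivP_uncurry).tendsto (a₀, e)).eventually
    ((gt_mem_nhds h).mono fun _ => le_of_lt)

lemma derivP_smul {n : ℕ} (r : ℝ) (a : Fin n → ℝ) (t : ℝ) :
    derivP (r • a) t = r * derivP a t := by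
  simp [derivP, Finset.mul_sum, mul_assoc]

/-- A family of solutions with extremal values except for the first one. -/
structure SolFamily (b : ℕ) (A X : ℝ → Fin (b + 2) → ℝ) : Prop where
  isSol : ∀ v, -1 < v → IsSol (A v) (X v) (yvec b v 0)

lemma exists_solFamily (b : ℕ) : ∃ A X, SolFamily b A X := by
  have : ∀ v : ℝ, ∃ a x, -1 < v → IsSol a x (yvec b v 0) := fun v => by
    by_cases hv : -1 < v
    · obtain ⟨a, x, h⟩ := exists_isSol (alternating_yvec (b := b) (v := v) (η := 0)
        (by linarith) le_rfl (by norm_num))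
      exact ⟨a, x, fun _ => h⟩
    · exact ⟨0, 0, fun h => absurd h hv⟩
  choose A X h using this
  exact ⟨A, X, ⟨h⟩⟩

namespace SolFamily

variable {b : ℕ} {A X : ℝ → Fin (b + 2) → ℝ}

/-- Solutions near a member of the family. -/
lemma eventually (F : SolFamily b A X) (hb : 2 ≤ b) {v : ℝ} (hv : v ∈ Ioc (-1 : ℝ) 1)
    {p : (Fin (b + 2) → ℝ) × (Fin (b + 2) → ℝ) → Prop} (hp : ∀ᶠ q in 𝓝 (A v, X v), p q) :
    ∀ᶠ w in 𝓝 (v, (0 : ℝ)), -1 + w.2 < w.1 → 0 ≤ w.2 → w.1 ≤ 1 →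
      ∀ a x, IsSol a x (yvec b w.1 w.2) → p (a, x) := by
  have h1 := eventually_forall_isSol (alternating_yvec (b := b) (v := v) (η := 0)
    (by linarith [hv.1]) le_rfl (by norm_num))
    (fun a x h => h.unique hb hv.1 hv.2 (F.isSol v hv.1)) hp
  filter_upwards [(continuous_yvec b).tendsto (v, (0 : ℝ)) |>.eventually h1] with w hw h2 h3 h4 a x h
  exact hw a x (alternating_yvec h2 h3 (by linarith)) h

lemma continuousOn (F : SolFamily b A X) (hb : 2 ≤ b)
    {G : (Fin (b + 2) → ℝ) × (Fin (b + 2) → ℝ) → ℝ} (hG : Continuous G) :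
    ContinuousOn (fun v => G (A v, X v)) (Ioc (-1) 1) := by
  intro v hv s hs
  have h1 := F.eventually hb hv (hG.tendsto (A v, X v) hs)
  have h2 : Tendsto (fun w : ℝ => (w, (0 : ℝ))) (𝓝[Ioc (-1) 1] v) (𝓝 (v, 0)) :=
    ((Continuous.prodMk_left (0 : ℝ)).tendsto v).mono_left nhdsWithin_le_nhds
  change ∀ᶠ w in 𝓝[Ioc (-1) 1] v, G (A w, X w) ∈ s
  filter_upwards [h2.eventually h1, self_mem_nhdsWithin] with w hw hwI
  exact hw (by linarith [hwI.1]) le_rfl hwI.2 _ _ (F.isSol w hwI.1)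

end SolFamily

set_option maxHeartbeats 1000000 in
/-- For a small first critical value, the first turning point is far to the left. -/
lemma exists_small_value {b : ℕ} (hb : 2 ≤ b) : ∃ v ∈ Ioo (-1 : ℝ) 0, ∀ a x,
    IsSol a x (yvec b v 0) → nd x 1 < 0 ∧ v < nd x 1 := by
  by_contra hcon
  push Not at hcon
  set v : ℕ → ℝ := fun n => -1 + 1 / ((n : ℝ) + 2) with hv
  have hv1 : ∀ n, v n ∈ Ioo (-1 : ℝ) 0 := fun n => by
    have h1 : (0 : ℝ) < 1 / ((n : ℝ) + 2) := by positivity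
    have h2 : 1 / ((n : ℝ) + 2) < 1 := by
      rw [div_lt_one (by positivity)]
      have : (0 : ℝ) ≤ n := Nat.cast_nonneg n
      linarith
    constructor <;> simp only [hv] <;> linarith
  have hvlim : Tendsto v atTop (𝓝 (-1)) := by
    have h1 : Tendsto (fun n : ℕ => 1 / ((n : ℝ) + 2)) atTop (𝓝 0) :=
      tendsto_const_nhds.div_atTop (tendsto_atTop_add_const_right _ _ tendsto_natCast_atTop_atTop)
    simpa [hv] using h1.const_add (-1)
  choose a x hsol hbad using fun n => hcon (v n) (hv1 n)
  have hA : ∀ n, Alternating (yvec b (v n) 0) := fun n =>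
    alternating_yvec (by linarith [(hv1 n).1]) le_rfl (by norm_num)
  have hylim : Tendsto (fun n => yvec b (v n) 0) atTop (𝓝 (yvec b (-1) 0)) :=
    ((continuous_yvec b).tendsto (-1, 0)).comp (hvlim.prodMk_nhds tendsto_const_nhds)
  obtain ⟨a₀, x₀, φ, hφ, ha, hx, hm, h0, h1, hval, hc⟩ := IsSol.exists_subseq hylim hA hsol
  have hx1 : Tendsto (fun n => nd (x (φ n)) 1) atTop (𝓝 (nd x₀ 1)) :=
    ((continuous_nd 1).tendsto _).comp hx
  have hconst : ∀ s ∈ Icc (0 : ℝ) 1, evalP a₀ (-1 + s * (nd x₀ 1 + 1)) = -1 := fun s hs => by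
    have hl : Tendsto (fun n => evalP (a (φ n)) (-1 + s * (nd (x (φ n)) 1 + 1))) atTop
        (𝓝 (evalP a₀ (-1 + s * (nd x₀ 1 + 1)))) :=
      (continuous_evalP_uncurry.tendsto (a₀, _)).comp
        (ha.prodMk_nhds (((hx1.add_const 1).const_mul s).const_add (-1)))
    have hmem : ∀ n, -1 ≤ evalP (a (φ n)) (-1 + s * (nd (x (φ n)) 1 + 1)) ∧
        evalP (a (φ n)) (-1 + s * (nd (x (φ n)) 1 + 1)) ≤ v (φ n) := fun n => by
      have hs1 := hsol (φ n)
      have hge := (hs1.nd_mem (j := 1) (by omega)).1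
      have := hs1.mem_uIcc (hA (φ n)) (j := ⟨0, by omega⟩)
        (t := -1 + s * (nd (x (φ n)) 1 + 1)) (by
          constructor
          · have e : x (φ n) (Fin.castSucc ⟨0, by omega⟩) = -1 := hs1.first
            rw [e]; nlinarith [hs.1]
          · have e : x (φ n) (Fin.succ ⟨0, by omega⟩) = nd (x (φ n)) 1 :=
              (nd_eq _ (by omega)).symm
            rw [e]; nlinarith [hs.2])
      simp only [Fin.castSucc_mk, Fin.succ_mk, yvec_zero, zero_add, yvec_one] at this
      rwa [uIcc_of_le (hv1 _).1.le] at this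
    exact le_antisymm (le_of_tendsto_of_tendsto' hl (hvlim.comp hφ.tendsto_atTop)
      fun n => (hmem n).2) (ge_of_tendsto' hl fun n => (hmem n).1)
  have hge : -1 ≤ nd x₀ 1 := by
    rw [← h0]
    exact hm (Fin.zero_le _)
  have hx0 : nd x₀ 1 = -1 := by
    by_contra hne
    have hgt : -1 < nd x₀ 1 := lt_of_le_of_ne hge (Ne.symm hne)
    have heq : toPoly a₀ = Polynomial.C (-1) := by
      refine Polynomial.eq_of_infinite_eval_eq _ _ ((Icc_infinite hgt).mono fun t ht => ?_)
      have := hconst ((t + 1) / (nd x₀ 1 + 1)) ⟨div_nonneg (by linarith [ht.1]) (by linarith),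
        (div_le_one (by linarith)).2 (by linarith [ht.2])⟩
      rw [div_mul_cancel₀ _ (by linarith)] at this
      simp only [mem_ofPred_eq, eval_toPoly, Polynomial.eval_C]
      rw [← this]
      congr 1
      ring
    have h3 := hval ⟨3, by omega⟩
    rw [yvec_of_three_le _ le_rfl, ← eval_toPoly, heq, Polynomial.eval_C] at h3
    norm_num at h3
  have hd0 : derivP a₀ (-1) = 0 := by
    have := hc ⟨0, by omega⟩
    rwa [show (Fin.castSucc (Fin.succ ⟨0, by omega⟩) : Fin (b + 2)) = ⟨1, by omega⟩ from rfl,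
      ← nd_eq x₀ (j := 1) (by omega), hx0] at this
  have hdlim : Tendsto (fun n => derivP (a (φ n)) (-1)) atTop (𝓝 0) := by
    have h2 : Tendsto (fun n => (a (φ n), (-1 : ℝ))) atTop (𝓝 (a₀, -1)) :=
      Tendsto.prodMk_nhds (x := a₀) ha tendsto_const_nhds
    have h3 := (continuous_derivP_uncurry (n := b + 2)).tendsto (a₀, -1)
    have h4 := h3.comp h2
    change Tendsto _ _ (𝓝 (derivP a₀ (-1))) at h4
    rw [hd0] at h4
    exact h4
  rw [hx0] at hx1
  obtain ⟨n, hn1, hn2⟩ := ((hx1.eventually (gt_mem_nhds (show (-1 : ℝ) < 0 by norm_num))).and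
    (hdlim.eventually (gt_mem_nhds (show (0 : ℝ) < 1 by norm_num)))).exists
  have hbad' := hbad (φ n) hn1
  have hs1 := hsol (φ n)
  have hlt : -1 < nd (x (φ n)) 1 := by
    rw [← hs1.nd_zero]; exact hs1.nd_lt one_pos (by omega)
  have hcv := hs1.concaveOn_first (hA _)
  have e : x (φ n) (Fin.succ 0) = nd (x (φ n)) 1 := (nd_eq _ (j := 1) (by omega)).symm
  rw [e] at hcv
  have hsl := hcv.slope_le_of_hasDerivAt (left_mem_Icc.2 hlt.le) (right_mem_Icc.2 hlt.le) hlt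
    (hasDerivAt_evalP _ _)
  rw [slope_def_field, hs1.evalP_nd_one, hs1.evalP_neg_one, div_le_iff₀ (by linarith)] at hsl
  nlinarith

lemma IsSol.evalP_nd_last {b : ℕ} {v : ℝ} {a x : Fin (b + 2) → ℝ} (hb : 2 ≤ b)
    (h : IsSol a x (yvec b v 0)) : evalP a (nd x b) = (-1) ^ (b + 1) := by
  rcases hb.eq_or_lt with rfl | hb
  · rw [h.evalP_nd_two (by omega)]; norm_num
  · exact h.evalP_nd (by omega) hb

namespace SolFamily

variable {b : ℕ} {A X : ℝ → Fin (b + 2) → ℝ}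

/-- A parameter for which the first turning point is fixed by the map with reversed sign. -/
lemma exists_fixed (F : SolFamily b A X) (hb : 2 ≤ b) :
    ∃ α ∈ Ioo (-1 : ℝ) 1, nd (X α) 1 = -α := by
  obtain ⟨v, ⟨hv1, hv2⟩, hv⟩ := exists_small_value hb
  have hc : ContinuousOn (fun w => w + nd (X w) 1) (Icc v 1) :=
    continuousOn_id.add ((F.continuousOn hb (G := fun q => nd q.2 1)
      ((continuous_nd 1).comp continuous_snd)).mono fun w hw => ⟨by linarith [hw.1], hw.2⟩)
  have hl := hv _ _ (F.isSol v hv1)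
  have hr : -1 < nd (X 1) 1 := by
    have h := F.isSol 1 (by norm_num)
    rw [← h.nd_zero]; exact h.nd_lt one_pos (by omega)
  obtain ⟨α, hα, h0⟩ := intermediate_value_Icc (by linarith) hc
    (show (0 : ℝ) ∈ Icc (v + nd (X v) 1) (1 + nd (X 1) 1) from ⟨by linarith, by linarith⟩)
  simp only at h0
  refine ⟨α, ⟨by linarith [hα.1], lt_of_le_of_ne hα.2 ?_⟩, by linarith⟩
  rintro rfl
  linarith

/-- A parameter for which the first turning point has period two. -/
lemma exists_periodic (F : SolFamily b A X) (hb : 2 ≤ b) :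
    ∃ α ∈ Ioo (-1 : ℝ) 1, nd (X α) b < α ∧ evalP (A α) α = nd (X α) 1 := by
  obtain ⟨v, ⟨hv1, hv2⟩, hv⟩ := exists_small_value hb
  set G : (Fin (b + 2) → ℝ) × (Fin (b + 2) → ℝ) → ℝ := fun q =>
    (-1) ^ b * (evalP q.1 (max (evalP q.1 (nd q.2 1)) (nd q.2 b)) - nd q.2 1) with hG
  have hnd : ∀ j, Continuous fun q : (Fin (b + 2) → ℝ) × (Fin (b + 2) → ℝ) => nd q.2 j :=
    fun j => (continuous_nd j).comp continuous_snd
  have hGc : Continuous G := by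
    refine continuous_const.mul (Continuous.sub ?_ (hnd 1))
    refine continuous_evalP_uncurry.comp (continuous_fst.prodMk (Continuous.max ?_ (hnd b)))
    exact continuous_evalP_uncurry.comp (continuous_fst.prodMk (hnd 1))
  have hc := (F.continuousOn hb hGc).mono
    (fun w (hw : w ∈ Icc v 1) => (⟨by linarith [hw.1], hw.2⟩ : w ∈ Ioc (-1 : ℝ) 1))
  have hlt : ∀ w, -1 < w → -1 < nd (X w) 1 ∧ nd (X w) 1 < 1 := fun w hw => by
    have h := F.isSol w hw
    have h1 := h.nd_lt (i := 0) (j := 1) one_pos (by omega)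
    have h2 := h.nd_lt (i := 1) (j := b + 1) (by omega) (by omega)
    rw [h.nd_zero] at h1
    rw [h.nd_last] at h2
    exact ⟨h1, h2⟩
  have hpow : ((-1 : ℝ) ^ b = 1) ∨ ((-1 : ℝ) ^ b = -1) := neg_one_pow_eq_or ℝ b
  have hval : ∀ w, -1 < w → G (A w, X w) =
      (-1) ^ b * (evalP (A w) (max w (nd (X w) b)) - nd (X w) 1) := fun w hw => by
    simp only [hG, (F.isSol w hw).evalP_nd_one]
  have hl : G (A v, X v) ≤ 0 := by
    have h := F.isSol v hv1
    rw [hval v hv1, max_eq_right ((hv _ _ h).2.le.trans (h.nd_le (by omega) (by omega))),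
      h.evalP_nd_last hb, pow_succ]
    rcases hpow with e | e <;> rw [e] <;> linarith [hlt v hv1]
  have hr : 0 < G (A 1, X 1) := by
    have h := F.isSol 1 (by norm_num)
    rw [hval 1 (by norm_num), max_eq_left (h.nd_mem (by omega)).2, h.evalP_one hb]
    rcases hpow with e | e <;> rw [e] <;> linarith [hlt 1 (by norm_num)]
  obtain ⟨α, hα, h0⟩ := intermediate_value_Icc (by linarith) hc
    (show (0 : ℝ) ∈ Icc (G (A v, X v)) (G (A 1, X 1)) from ⟨hl, hr.le⟩)
  have hα1 : -1 < α := by linarith [hα.1]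
  have h := F.isSol α hα1
  simp only [hval α hα1] at h0
  have hlα := hlt α hα1
  have hgt : nd (X α) b < α := by
    by_contra hle
    rw [max_eq_right (not_lt.1 hle), h.evalP_nd_last hb, pow_succ] at h0
    rcases hpow with e | e <;> rw [e] at h0 <;> linarith
  refine ⟨α, ⟨hα1, lt_of_le_of_ne hα.2 ?_⟩, hgt, ?_⟩
  · rintro rfl
    rw [hval 1 (by norm_num)] at hr
    linarith
  · rw [max_eq_left hgt.le] at h0
    rcases hpow with e | e <;> rw [e] at h0 <;> linarith

end SolFamily

/-- `q` consists of the coefficients and nodes of the solution with parameters `v`, `η`. -/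
structure Adm (b : ℕ) (v η : ℝ) (q : (Fin (b + 2) → ℝ) × (Fin (b + 2) → ℝ)) : Prop where
  sol : IsSol q.1 q.2 (yvec b v η)
  nonneg : 0 ≤ η
  lt : -1 + η < v
  le : v ≤ 1

section

variable {b : ℕ} {θ v η : ℝ} {q : (Fin (b + 2) → ℝ) × (Fin (b + 2) → ℝ)}

lemma Adm.nearCheb (h : Adm b v η q) (hb : 2 ≤ b) (hθ : θ = 1 ∨ θ = -1) :
    NearCheb b θ η v (evalP (θ • q.1)) (nd q.2) :=
  h.sol.nearCheb hb h.lt h.le h.nonneg hθ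

lemma Adm.alternating (h : Adm b v η q) : Alternating (yvec b v η) :=
  alternating_yvec h.lt h.nonneg (by linarith [h.lt, h.le])

lemma exists_adm (h0 : 0 ≤ η) (h : -1 + η < v) (h1 : v ≤ 1) : ∃ q, Adm b v η q := by
  obtain ⟨a, x, hs⟩ := exists_isSol (alternating_yvec (b := b) h h0 (by linarith))
  exact ⟨(a, x), hs, h0, h, h1⟩

/-- On short neighbourhoods of the ends the map is injective. -/
lemma Adm.injOn_endNhd (h : Adm b v η q) (hb : 2 ≤ b) (hθ : θ = 1 ∨ θ = -1) {e δ : ℝ}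
    (he : e = 1 ∨ e = -1) (h1 : δ ≤ nd q.2 1 + 1) (h2 : δ ≤ 1 - nd q.2 b) :
    InjOn (evalP (θ • q.1)) (endNhd e δ) ∧ ∀ t ∈ endNhd e δ, t ∉ Ioo (nd q.2 1) (nd q.2 2) := by
  have hN := h.nearCheb hb hθ
  rcases he with rfl | rfl
  · have hsub : ∀ t ∈ endNhd 1 δ, nd q.2 b < t ∧ t ≤ 1 := fun t ht => by
      have := (abs_lt.1 ht.2).1
      exact ⟨by linarith, ht.1.2⟩
    refine ⟨(hN.injOn (j := b) le_rfl).mono fun t ht => ?_, fun t ht ht' => ?_⟩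
    · rw [h.sol.nd_last]
      exact ⟨(hsub t ht).1.le, (hsub t ht).2⟩
    · linarith [(hsub t ht).1, ht'.2, h.sol.nd_le hb (by omega)]
  · have hsub : ∀ t ∈ endNhd (-1) δ, -1 ≤ t ∧ t < nd q.2 1 := fun t ht => by
      have := (abs_lt.1 ht.2).2
      exact ⟨ht.1.1, by linarith⟩
    refine ⟨(hN.injOn (j := 0) (by omega)).mono fun t ht => ?_, fun t ht ht' => ?_⟩
    · rw [h.sol.nd_zero]
      exact ⟨(hsub t ht).1, (hsub t ht).2.le⟩
    · linarith [(hsub t ht).2, ht'.1]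

end

/-- The end opposite to the exceptional critical value is mapped to `e₁` and back. -/
structure EndCycle (b : ℕ) (θ e₀ e₁ : ℝ) : Prop where
  sign : θ = 1 ∨ θ = -1
  left : e₀ = -θ
  right : e₁ = 1 ∨ e₁ = -1
  map_left : ∀ v η q, Adm b v η q → evalP (θ • q.1) e₀ = e₁
  map_right : ∀ v η q, Adm b v η q → evalP (θ • q.1) e₁ = e₀

namespace EndCycle

variable {b : ℕ} {θ e₀ e₁ : ℝ}

lemma left' (E : EndCycle b θ e₀ e₁) : e₀ = 1 ∨ e₀ = -1 := by
  rcases E.sign with h | h <;> simp [E.left, h]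

lemma endSeq_eq (E : EndCycle b θ e₀ e₁) (n : ℕ) :
    endSeq e₀ e₁ n = 1 ∨ endSeq e₀ e₁ n = -1 := by
  unfold endSeq
  split_ifs
  exacts [E.left', E.right]

lemma abs_derivP (E : EndCycle b θ e₀ e₁) (a : Fin (b + 2) → ℝ) (t : ℝ) :
    |derivP (θ • a) t| = |derivP a t| := by
  rw [derivP_smul, abs_mul]
  rcases E.sign with h | h <;> simp [h]

/-- Chains of coverings for maps close to a given one. -/
lemma eventually_covChain (E : EndCycle b θ e₀ e₁) (hb : 2 ≤ b)
    {q₀ : (Fin (b + 2) → ℝ) × (Fin (b + 2) → ℝ)} {w₀ w₁ D L₀ L₁ : ℝ}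
    (hw₀ : 0 < w₀) (hw₁ : 0 < w₁) (hD : w₀ < D) (hL₀ : 0 < L₀) (hL : 1 < L₀ * L₁)
    (h₀ : L₀ < |derivP q₀.1 e₀|) (h₁ : L₁ < |derivP q₀.1 e₁|)
    (hCov : ∀ᶠ q in 𝓝 q₀, ∀ v η, Adm b v η q → ∀ t, 0 < t → t ≤ 1 →
      Cov (evalP (θ • q.1)) e₀ (t * w₀) e₁ (t * w₁) ∧
      Cov (evalP (θ • q.1)) e₁ (t * w₁) e₀ (t * D)) :
    ∃ (M : ℕ) (ρ : ℝ), 0 < ρ ∧ ∀ᶠ q in 𝓝 q₀, ∀ v η, Adm b v η q → ∀ n, ∃ r,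
      CovChain (evalP (θ • q.1)) e₀ e₁ w₀ w₁ (2 * (n + M + 1)) (ρ / (L₀ * L₁) ^ n) D r := by
  obtain ⟨ρ₀, hρ₀, hd₀⟩ := eventually_le_abs_derivP h₀
  obtain ⟨ρ₁, hρ₁, hd₁⟩ := eventually_le_abs_derivP h₁
  have hlim : Tendsto (fun M : ℕ => w₀ / (D / w₀) ^ M) atTop (𝓝 0) :=
    tendsto_const_nhds.div_atTop (tendsto_pow_atTop_atTop_of_one_lt ((one_lt_div hw₀).2 hD))
  have hlim' : Tendsto (fun M : ℕ => L₀ * (w₀ / (D / w₀) ^ M)) atTop (𝓝 0) := by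
    simpa using hlim.const_mul L₀
  obtain ⟨M, hM1, hM2⟩ := ((hlim.eventually (gt_mem_nhds (show 0 < min ρ₀ 2 by positivity))).and
    (hlim'.eventually (gt_mem_nhds (show 0 < min (min ρ₁ 2) w₁ by positivity)))).exists
  have hDpos : 0 < D := hw₀.trans hD
  have hcf : Continuous (Prod.fst : (Fin (b + 2) → ℝ) × (Fin (b + 2) → ℝ) → _) := continuous_fst
  refine ⟨M, w₀ / (D / w₀) ^ M, by positivity, ?_⟩
  filter_upwards [hCov, hcf.tendsto q₀ |>.eventually hd₀, hcf.tendsto q₀ |>.eventually hd₁]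
    with q hc hq₀ hq₁ v η hq n
  have hmaps := (hq.nearCheb hb E.sign).maps
  refine exists_covChain hw₀ hw₁ hD hL hL₀ rfl (hM2.le.trans (min_le_right _ _)) ?_ ?_
    (fun t ht ht1 => (hc v η hq t ht ht1).1) (fun t ht ht1 => (hc v η hq t ht ht1).2) n
  · intro d hd hdρ
    refine cov_of_le_abs_derivP E.left' E.right hd
      (hdρ.trans (hM1.le.trans (min_le_right _ _))) (E.map_left v η q hq) hmaps fun t ht => ?_
    rw [E.abs_derivP]
    exact hq₀ t (ht.trans (hdρ.trans (hM1.le.trans (min_le_left _ _))))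
  · intro d hd hdρ
    refine cov_of_le_abs_derivP E.right E.left' hd
      (hdρ.trans (hM2.le.trans ((min_le_left _ _).trans (min_le_right _ _))))
      (E.map_right v η q hq) hmaps fun t ht => ?_
    rw [E.abs_derivP]
    exact hq₁ t (ht.trans (hdρ.trans (hM2.le.trans ((min_le_left _ _).trans (min_le_left _ _)))))

/-- Chains of neighbourhoods for maps close to a given one. -/
lemma eventually_hitChain (E : EndCycle b θ e₀ e₁) (hb : 2 ≤ b)
    {q₀ : (Fin (b + 2) → ℝ) × (Fin (b + 2) → ℝ)} {δ l₀ l₁ : ℝ} (hδ : 0 < δ)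
    (hl : 1 < l₀ * l₁) (h₀ : |derivP q₀.1 e₀| < l₀) (h₁ : |derivP q₀.1 e₁| < l₁) :
    ∃ C δ' : ℝ, 0 < δ' ∧ ∀ᶠ q in 𝓝 q₀, ∀ v η, Adm b v η q → ∀ (m : ℕ) (d : ℝ), 0 < d →
      C * (l₀ * l₁) ^ m * d ≤ δ' → ∃ r, HitChain (evalP (θ • q.1)) e₀ e₁ δ (2 * m) d r := by
  obtain ⟨ρ₀, hρ₀, hd₀⟩ := eventually_abs_derivP_le h₀
  obtain ⟨ρ₁, hρ₁, hd₁⟩ := eventually_abs_derivP_le h₁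
  have hl₀ : 0 < l₀ := (abs_nonneg _).trans_lt h₀
  have hl₁ : 0 < l₁ := (abs_nonneg _).trans_lt h₁
  have hcf : Continuous (Prod.fst : (Fin (b + 2) → ℝ) × (Fin (b + 2) → ℝ) → _) := continuous_fst
  refine ⟨max 1 l₀, min δ (min ρ₀ ρ₁), by positivity, ?_⟩
  filter_upwards [hcf.tendsto q₀ |>.eventually hd₀, hcf.tendsto q₀ |>.eventually hd₁]
    with q hq₀ hq₁ v η hq m d hd hm
  have hmaps := (hq.nearCheb hb E.sign).maps
  have key : ∃ r, HitChain (evalP (θ • q.1)) e₀ e₁ (min δ (min ρ₀ ρ₁)) (2 * m) d r := by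
    refine exists_hitChain hl (le_max_left _ _) (le_max_right _ _) hl₀ ?_ ?_ m hd hm
    · intro d hd hdρ
      refine hit_of_abs_derivP_le hd hl₀ (E.map_left v η q hq) hmaps fun t ht => ?_
      rw [E.abs_derivP]
      exact hq₀ t (ht.trans (hdρ.trans ((min_le_right _ _).trans (min_le_left _ _))))
    · intro d hd hdρ
      refine hit_of_abs_derivP_le hd hl₁ (E.map_right v η q hq) hmaps fun t ht => ?_
      rw [E.abs_derivP]
      exact hq₁ t (ht.trans (hdρ.trans ((min_le_right _ _).trans (min_le_right _ _))))
  obtain ⟨r, hr⟩ := key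
  exact ⟨r, hr.zero, hr.even, hr.hit, fun n hn => (hr.le n hn).trans (min_le_left _ _)⟩

end EndCycle

/-- Existence and proximity of solutions for small `η`. -/
lemma SolFamily.eventually_adm {b : ℕ} {A X : ℝ → Fin (b + 2) → ℝ} (F : SolFamily b A X)
    (hb : 2 ≤ b) {v : ℝ} (hv : v ∈ Ioc (-1 : ℝ) 1)
    {p : (Fin (b + 2) → ℝ) × (Fin (b + 2) → ℝ) → Prop} (hp : ∀ᶠ q in 𝓝 (A v, X v), p q) :
    ∀ᶠ η in 𝓝[>] (0 : ℝ), ∃ q, Adm b v η q ∧ p q := by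
  have h1 : Tendsto (fun η : ℝ => (v, η)) (𝓝[>] 0) (𝓝 (v, 0)) :=
    ((Continuous.prodMk_right v).tendsto 0).mono_left nhdsWithin_le_nhds
  have h2 : ∀ᶠ η in 𝓝[>] (0 : ℝ), η < v + 1 :=
    nhdsWithin_le_nhds (gt_mem_nhds (by linarith [hv.1]))
  filter_upwards [h1.eventually (F.eventually hb hv hp), h2, self_mem_nhdsWithin] with η h3 h4 h5
  obtain ⟨q, hq⟩ := exists_adm (b := b) (v := v) (η := η) (le_of_lt h5) (by linarith) hv.2
  exact ⟨q, hq, h3 hq.lt hq.nonneg hq.le _ _ hq.sol⟩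

/-- The entropy is nearly maximal if the first critical value is maximal. -/
lemma SolFamily.eventually_le_htop {b : ℕ} {θ e₀ e₁ : ℝ} {A X : ℝ → Fin (b + 2) → ℝ}
    (F : SolFamily b A X) (E : EndCycle b θ e₀ e₁) (hb : 2 ≤ b) {μ : ℝ} (hμ : 1 < μ)
    (hμb : μ < b + 1) :
    ∀ᶠ η in 𝓝[>] (0 : ℝ), ∃ q, Adm b 1 η q ∧ (Real.log μ : ℝ) ≤ htop (evalP (θ • q.1)) := by
  have hsol := F.isSol 1 (by norm_num)
  set δ : ℝ := min (nd (X 1) 1 + 1) (1 - nd (X 1) b) / 2 with hδ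
  have hx1 := hsol.nd_lt (i := 0) (j := 1) one_pos (by omega)
  have hxb := hsol.nd_lt (i := b) (j := b + 1) (by omega) (by omega)
  rw [hsol.nd_zero] at hx1
  rw [hsol.nd_last] at hxb
  have hδ0 : 0 < min (nd (X 1) 1 + 1) (1 - nd (X 1) b) := lt_min (by linarith) (by linarith)
  have hδpos : 0 < δ := by positivity
  have hlt1 : δ < nd (X 1) 1 + 1 := (half_lt_self hδ0).trans_le (min_le_left _ _)
  have hltb : δ < 1 - nd (X 1) b := (half_lt_self hδ0).trans_le (min_le_right _ _)
  set l₀ := max 1 |derivP (A 1) e₀| + 1 with hl₀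
  set l₁ := max 1 |derivP (A 1) e₁| + 1 with hl₁
  have hl0 : 2 ≤ l₀ := by rw [hl₀]; linarith [le_max_left 1 |derivP (A 1) e₀|]
  have hl1 : 2 ≤ l₁ := by rw [hl₁]; linarith [le_max_left 1 |derivP (A 1) e₁|]
  obtain ⟨C, δ', hδ', hch⟩ := E.eventually_hitChain hb (q₀ := (A 1, X 1)) hδpos
    (l₀ := l₀) (l₁ := l₁) (by nlinarith)
    (by simp only [hl₀]; linarith [le_max_right 1 |derivP (A 1) e₀|])
    (by simp only [hl₁]; linarith [le_max_right 1 |derivP (A 1) e₁|])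
  obtain ⟨m, hm⟩ : ∃ m : ℕ, 2 / (b + 1 - μ) < μ ^ m := pow_unbounded_of_one_lt _ hμ
  have hm2 : 2 ≤ (b + 1 - μ) * μ ^ (2 * m) := by
    rw [div_lt_iff₀ (by linarith)] at hm
    have : μ ^ m ≤ μ ^ (2 * m) := pow_le_pow_right₀ hμ.le (by omega)
    nlinarith
  have ho1 : ∀ᶠ q : (Fin (b + 2) → ℝ) × (Fin (b + 2) → ℝ) in 𝓝 (A 1, X 1), δ < nd q.2 1 + 1 :=
    (((continuous_nd 1).comp continuous_snd).add continuous_const).tendsto (A 1, X 1)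
      |>.eventually (lt_mem_nhds hlt1)
  have hob : ∀ᶠ q : (Fin (b + 2) → ℝ) × (Fin (b + 2) → ℝ) in 𝓝 (A 1, X 1), δ < 1 - nd q.2 b :=
    (continuous_const.sub ((continuous_nd b).comp continuous_snd)).tendsto (A 1, X 1)
      |>.eventually (lt_mem_nhds hltb)
  have hsmall : ∀ᶠ η in 𝓝[>] (0 : ℝ), C * (l₀ * l₁) ^ m * η < δ' := by
    refine nhdsWithin_le_nhds ((continuous_const.mul continuous_id).tendsto (0 : ℝ) |>.eventually
      (gt_mem_nhds ?_))
    simpa using hδ'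
  filter_upwards [F.eventually_adm hb (v := 1) ⟨by norm_num, le_rfl⟩ (hch.and (ho1.and hob)),
    hsmall, self_mem_nhdsWithin] with η ⟨q, hq, hchq, h1, h2⟩ hη hη0
  obtain ⟨r, hr⟩ := hchq 1 η hq m η hη0 hη.le
  refine ⟨q, hq, (hq.nearCheb hb E.sign).le_htop (S := fun n => endNhd (endSeq e₀ e₁ n) (r n))
    hμ hm2 ?_ ?_ hr.hit ?_⟩
  · simp [endSeq, hr.zero, E.left]
  · intro n hn
    exact (hq.injOn_endNhd hb E.sign (E.endSeq_eq n) ((hr.le n hn.le).trans h1.le)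
      ((hr.le n hn.le).trans h2.le)).1
  · intro n hn
    exact (hq.injOn_endNhd hb E.sign (E.endSeq_eq n) ((hr.le n hn.le).trans h1.le)
      ((hr.le n hn.le).trans h2.le)).2

/-- Separation of the growth rates of the upper and lower estimates. -/
lemma exists_growth {s : ℝ → ℝ} {b m : ℝ} {k : ℕ} (hb : 2 ≤ b) (hbm : b < m)
    (hs : ContinuousOn s (Icc b m)) (hsm : s m < 0) (hk : 2 < s b * b ^ (k + 1)) :
    ∃ μ μ', b < μ ∧ μ < μ' ∧ μ < m ∧ s μ * μ ^ k < 2 ∧ 2 ≤ s μ' * μ' ^ (k + 2) := by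
  have hc : ∀ j : ℕ, ContinuousOn (fun μ => s μ * μ ^ j) (Icc b m) := fun j =>
    hs.mul (continuous_pow j).continuousOn
  have hm0 : s m * m ^ (k + 1) < 0 := mul_neg_of_neg_of_pos hsm (pow_pos (by linarith) _)
  obtain ⟨μ, hμ, h2⟩ := intermediate_value_Icc' hbm.le (hc (k + 1))
    (show (2 : ℝ) ∈ Icc (s m * m ^ (k + 1)) (s b * b ^ (k + 1)) from ⟨by linarith, hk.le⟩)
  simp only at h2
  have h1 : b < μ := lt_of_le_of_ne hμ.1 (by rintro rfl; linarith)
  have h3 : μ < m := lt_of_le_of_ne hμ.2 (by rintro rfl; linarith)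
  have h4 : 2 < s μ * μ ^ (k + 2) := by
    have : s μ * μ ^ (k + 2) = s μ * μ ^ (k + 1) * μ := by ring
    rw [this, h2]; linarith
  have h5 : s μ * μ ^ k < 2 := by
    have : s μ * μ ^ (k + 1) = s μ * μ ^ k * μ := by ring
    rw [this] at h2
    nlinarith
  have hat : ContinuousAt (fun μ => s μ * μ ^ (k + 2)) μ :=
    (hc (k + 2)).continuousAt (Icc_mem_nhds h1 h3)
  have hev : ∀ᶠ μ' in 𝓝[>] μ, 2 < s μ' * μ' ^ (k + 2) :=
    nhdsWithin_le_nhds (hat.eventually (lt_mem_nhds h4))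
  obtain ⟨μ', h6, h7⟩ := (hev.and self_mem_nhdsWithin).exists
  exact ⟨μ, μ', h1, h7, h3, h5, h6.le⟩

/-- Local entropy estimates near the map `q₀`. -/
structure Core (b : ℕ) (θ e₀ e₁ : ℝ) (s : ℝ → ℝ) (q₀ : (Fin (b + 2) → ℝ) × (Fin (b + 2) → ℝ))
    (w₀ w₁ D δ : ℝ) : Prop where
  w₀_pos : 0 < w₀
  w₁_pos : 0 < w₁
  lt : w₀ < D
  δ_pos : 0 < δ
  upper : ∀ᶠ q in 𝓝 q₀, ∀ v η, Adm b v η q → ∀ (μ : ℝ) (k : ℕ) (r : ℕ → ℝ), b < μ →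
    s μ * μ ^ k < 2 → CovChain (evalP (θ • q.1)) e₀ e₁ w₀ w₁ k η D r →
    htop (evalP (θ • q.1)) ≤ (Real.log μ : ℝ)
  lower : ∀ᶠ q in 𝓝 q₀, ∀ v η, Adm b v η q → ∀ (μ : ℝ) (k : ℕ) (r : ℕ → ℝ), b < μ →
    2 ≤ s μ * μ ^ k → HitChain (evalP (θ • q.1)) e₀ e₁ δ k η r →
    (Real.log μ : ℝ) ≤ htop (evalP (θ • q.1))
  cov : ∀ᶠ q in 𝓝 q₀, ∀ v η, Adm b v η q → ∀ t, 0 < t → t ≤ 1 →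
    Cov (evalP (θ • q.1)) e₀ (t * w₀) e₁ (t * w₁) ∧
    Cov (evalP (θ • q.1)) e₁ (t * w₁) e₀ (t * D)
  one_lt : 1 < |derivP q₀.1 e₀| * |derivP q₀.1 e₁|

lemma SolFamily.abs_derivP_lt {b : ℕ} {A X : ℝ → Fin (b + 2) → ℝ} (F : SolFamily b A X)
    (hb : 2 ≤ b) {v v' : ℝ} (hv : -1 < v) (hvv : v < v') (hv' : v' ≤ 1) {e : ℝ}
    (he : e = 1 ∨ e = -1) : |derivP (A v) e| < |derivP (A v') e| := by
  have h := F.isSol v hv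
  have h' := F.isSol v' (hv.trans hvv)
  have hA := alternating_yvec (b := b) (v := v) (η := 0) (by linarith) le_rfl (by norm_num)
  have hA' := alternating_yvec (b := b) (v := v') (η := 0) (by linarith) le_rfl (by norm_num)
  have hc := h.compare hb hv hvv.le hv' h' (h.ne_of_lt hb hv hvv h')
  rcases he with rfl | rfl
  · have e : ∀ c : Fin (b + 2) → ℝ, |derivP c 1| = |(-1) ^ b * derivP c 1| := fun c => by
      rw [abs_mul, abs_pow, abs_neg, abs_one, one_pow, one_mul]
    rw [e, e, abs_of_pos (h.derivP_one_pos hA), abs_of_pos (h'.derivP_one_pos hA')]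
    exact hc.2
  · rw [abs_of_pos (h.derivP_neg_one_pos hA), abs_of_pos (h'.derivP_neg_one_pos hA')]
    exact hc.1

lemma exists_scale {g₀ g₁ h₀ h₁ : ℝ} (hg : 1 < g₀ * g₁)
    (hh₀ : h₀ < g₀) (hh₁ : h₁ < g₁) :
    ∃ t : ℝ, 0 < t ∧ t < 1 ∧ 1 < (t * g₀) * (t * g₁) ∧ h₀ < t * g₀ ∧ h₁ < t * g₁ := by
  have c1 : Continuous fun t : ℝ => (t * g₀) * (t * g₁) := by fun_prop
  have c2 : Continuous fun t : ℝ => t * g₀ := by fun_prop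
  have c3 : Continuous fun t : ℝ => t * g₁ := by fun_prop
  have e1 : ∀ᶠ t in 𝓝 (1 : ℝ), 1 < (t * g₀) * (t * g₁) :=
    (c1.tendsto 1).eventually (lt_mem_nhds (by simpa using hg))
  have e2 : ∀ᶠ t in 𝓝 (1 : ℝ), h₀ < t * g₀ :=
    (c2.tendsto 1).eventually (lt_mem_nhds (by simpa using hh₀))
  have e3 : ∀ᶠ t in 𝓝 (1 : ℝ), h₁ < t * g₁ :=
    (c3.tendsto 1).eventually (lt_mem_nhds (by simpa using hh₁))
  have e4 : ∀ᶠ t in 𝓝 (1 : ℝ), 0 < t := lt_mem_nhds one_pos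
  have key : ∀ᶠ t in 𝓝[<] (1 : ℝ), 0 < t ∧ 1 < (t * g₀) * (t * g₁) ∧ h₀ < t * g₀ ∧ h₁ < t * g₁ :=
    nhdsWithin_le_nhds (e4.and (e1.and (e2.and e3)))
  obtain ⟨t, ⟨h1, h2, h3, h4⟩, h5⟩ := (key.and self_mem_nhdsWithin).exists
  exact ⟨t, h1, h5, h2, h3, h4⟩

/-- Near `q₀`, decreasing the first critical value increases the entropy. -/
lemma Core.exists_lt {b : ℕ} {θ e₀ e₁ : ℝ} {s : ℝ → ℝ} {A X : ℝ → Fin (b + 2) → ℝ}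
    {α w₀ w₁ D δ : ℝ} (K : Core b θ e₀ e₁ s (A α, X α) w₀ w₁ D δ) (F : SolFamily b A X)
    (E : EndCycle b θ e₀ e₁) (hb : 2 ≤ b) (hs : ContinuousOn s (Icc b (b + 1)))
    (hs0 : 0 < s b) (hs1 : s (b + 1) < 0) (hα : α ∈ Ioo (-1 : ℝ) 1) :
    ∃ β η qg qh qe, β < α ∧ Adm b α η qg ∧ Adm b β η qh ∧ Adm b 1 η qe ∧
      htop (evalP (θ • qg.1)) < htop (evalP (θ • qh.1)) ∧
      htop (evalP (θ • qg.1)) < htop (evalP (θ • qe.1)) := by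
  have hb' : (2 : ℝ) ≤ b := by exact_mod_cast hb
  -- a nearby smaller parameter
  obtain ⟨β, hβ1, hβα, hβ⟩ : ∃ β, -1 < β ∧ β < α ∧ ∀ᶠ q in 𝓝 (A β, X β), ∀ v η, Adm b v η q →
      ∀ (μ : ℝ) (k : ℕ) (r : ℕ → ℝ), b < μ → 2 ≤ s μ * μ ^ k →
      HitChain (evalP (θ • q.1)) e₀ e₁ δ k η r →
      (Real.log μ : ℝ) ≤ htop (evalP (θ • q.1)) := by
    have h1 := F.eventually hb (v := α) ⟨hα.1, hα.2.le⟩ (eventually_eventually_nhds.2 K.lower)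
    have h2 : Tendsto (fun w : ℝ => (w, (0 : ℝ))) (𝓝[<] α) (𝓝 (α, 0)) :=
      ((Continuous.prodMk_left (0 : ℝ)).tendsto α).mono_left nhdsWithin_le_nhds
    have h3 : ∀ᶠ w in 𝓝[<] α, -1 < w := nhdsWithin_le_nhds (lt_mem_nhds hα.1)
    obtain ⟨β, h4, h5, h6⟩ := ((h2.eventually h1).and (h3.and self_mem_nhdsWithin)).exists
    exact ⟨β, h5, h6, h4 (by linarith) le_rfl (le_of_lt (lt_trans h6 hα.2)) _ _ (F.isSol β h5)⟩
  have hH₀ := F.abs_derivP_lt hb hβ1 hβα hα.2.le E.left'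
  have hH₁ := F.abs_derivP_lt hb hβ1 hβα hα.2.le E.right
  have hG₀ := (abs_nonneg _).trans_lt hH₀
  have hG₁ := (abs_nonneg _).trans_lt hH₁
  have hone := K.one_lt
  simp only at hone
  set G₀ := |derivP (A α) e₀| with hG₀def
  set G₁ := |derivP (A α) e₁| with hG₁def
  obtain ⟨t, ht0, ht1, htg, hl₀, hl₁⟩ := exists_scale hone hH₀ hH₁
  set u := (1 + t) / 2 with hu
  have htu : t < u := by rw [hu]; linarith
  have hu1 : u < 1 := by rw [hu]; linarith
  have hu0 : 0 < u := ht0.trans htu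
  have hlL : (t * G₀) * (t * G₁) < (u * G₀) * (u * G₁) :=
    mul_lt_mul'' ((mul_lt_mul_iff_left₀ hG₀).2 htu) ((mul_lt_mul_iff_left₀ hG₁).2 htu)
      (by positivity) (by positivity)
  obtain ⟨M, ρ, hρ, hcov⟩ := E.eventually_covChain hb K.w₀_pos K.w₁_pos K.lt
    (L₀ := u * G₀) (L₁ := u * G₁) (mul_pos hu0 hG₀) (htg.trans hlL)
    (q₀ := (A α, X α)) (mul_lt_of_lt_one_left hG₀ hu1) (mul_lt_of_lt_one_left hG₁ hu1) K.cov
  obtain ⟨C, δ', hδ', hhit⟩ := E.eventually_hitChain hb (q₀ := (A β, X β)) K.δ_pos htg hl₀ hl₁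
  -- a growth rate close to the maximal one
  obtain ⟨m, hm1, hm2, hm3⟩ : ∃ m : ℝ, b < m ∧ m < b + 1 ∧ s m < 0 := by
    have h1 : ∀ᶠ m in 𝓝[Icc (b : ℝ) (b + 1)] ((b : ℝ) + 1), s m < 0 :=
      (hs _ (right_mem_Icc.2 (by linarith))).eventually (gt_mem_nhds hs1)
    have h2 : ∀ᶠ m in 𝓝[<] ((b : ℝ) + 1), m ∈ Ioo (b : ℝ) (b + 1) :=
      Ioo_mem_nhdsLT (by linarith)
    have h3 : ∀ᶠ m in 𝓝[<] ((b : ℝ) + 1), s m < 0 := by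
      rw [eventually_nhdsWithin_iff] at h1
      filter_upwards [nhdsWithin_le_nhds h1, h2] with m h4 h5 using h4 ⟨h5.1.le, h5.2.le⟩
    obtain ⟨m, h4, h5⟩ := (h2.and h3).exists
    exact ⟨m, h4.1, h4.2, h5⟩
  set Λ := (u * G₀) * (u * G₁) with hΛ
  set lam := (t * G₀) * (t * G₁) with hlam
  have hΛ1 : 1 < Λ := htg.trans hlL
  have hηlim : Tendsto (fun n : ℕ => ρ / Λ ^ n) atTop (𝓝[>] 0) :=
    tendsto_nhdsWithin_iff.2 ⟨tendsto_const_nhds.div_atTop (tendsto_pow_atTop_atTop_of_one_lt hΛ1),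
      Eventually.of_forall fun n => div_pos hρ (pow_pos (by linarith) _)⟩
  have hsm : ∀ᶠ n : ℕ in atTop, C * lam ^ (n + M + 2) * (ρ / Λ ^ n) ≤ δ' := by
    have h1 : Tendsto (fun n : ℕ => C * lam ^ (M + 2) * ρ * (lam / Λ) ^ n) atTop (𝓝 0) := by
      simpa using (tendsto_pow_atTop_nhds_zero_of_lt_one (by positivity)
        ((div_lt_one (by linarith)).2 hlL)).const_mul (C * lam ^ (M + 2) * ρ)
    filter_upwards [h1.eventually (gt_mem_nhds hδ')] with n hn
    refine le_of_eq_of_le ?_ hn.le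
    rw [div_pow, add_assoc, pow_add]
    field_simp
  have hbig : ∀ᶠ n : ℕ in atTop, 2 < s b * (b : ℝ) ^ (2 * (n + M + 1) + 1) := by
    have h1 : Tendsto (fun n : ℕ => s b * (b : ℝ) ^ n) atTop atTop :=
      (tendsto_pow_atTop_atTop_of_one_lt (by linarith)).const_mul_atTop hs0
    have h2 : Tendsto (fun n : ℕ => 2 * (n + M + 1) + 1) atTop atTop :=
      tendsto_atTop_mono (fun n => by show n ≤ _; omega) tendsto_id
    exact (h1.comp h2).eventually (eventually_gt_atTop 2)
  obtain ⟨n, hn1, hn2, ⟨qg, hqg, hug, hcg⟩, ⟨qh, hqh, huh, hch⟩, ⟨qe, hqe, hle⟩⟩ :=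
    (hsm.and (hbig.and ((hηlim.eventually
      (F.eventually_adm hb (v := α) ⟨hα.1, hα.2.le⟩ (K.upper.and hcov))).and
      ((hηlim.eventually (F.eventually_adm hb (v := β)
        ⟨hβ1, (hβα.trans hα.2).le⟩ (hβ.and hhit))).and
      (hηlim.eventually (F.eventually_le_htop E hb (by linarith) hm2)))))).exists
  obtain ⟨μ, μ', hμ1, hμ2, hμ3, hμ4, hμ5⟩ := exists_growth (k := 2 * (n + M + 1)) hb' hm1
    (hs.mono (Icc_subset_Icc_right hm2.le)) hm3 hn2
  have hμ0 : 0 < μ := by linarith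
  obtain ⟨r, hr⟩ := hcg _ _ hqg n
  obtain ⟨r', hr'⟩ := hch _ _ hqh (n + M + 2) (ρ / Λ ^ n) (div_pos hρ (pow_pos (by linarith) _)) hn1
  have hup := hug _ _ hqg μ _ r hμ1 hμ4 hr
  have hlo := huh _ _ hqh μ' (2 * (n + M + 2)) r' (hμ1.trans hμ2) (by
    rwa [show 2 * (n + M + 2) = 2 * (n + M + 1) + 2 by ring]) hr'
  refine ⟨β, ρ / Λ ^ n, qg, qh, qe, hβα, hqg, hqh, hqe, ?_, ?_⟩
  · exact hup.trans_lt ((EReal.coe_lt_coe_iff.2 (Real.log_lt_log hμ0 hμ2)).trans_le hlo)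
  · exact hup.trans_lt ((EReal.coe_lt_coe_iff.2 (Real.log_lt_log hμ0 hμ3)).trans_le hle)

/-- Length of the lap at the end `e`. -/
noncomputable def outerLen {b : ℕ} (e : ℝ) (x : Fin (b + 2) → ℝ) : ℝ :=
  if e = 1 then 1 - nd x b else nd x 1 + 1

lemma continuous_outerLen {b : ℕ} (e : ℝ) :
    Continuous fun x : Fin (b + 2) → ℝ => outerLen e x := by
  unfold outerLen
  split_ifs
  exacts [continuous_const.sub (continuous_nd b), (continuous_nd 1).add continuous_const]

lemma outerLen_one {b : ℕ} (x : Fin (b + 2) → ℝ) : outerLen 1 x = 1 - nd x b := by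
  simp [outerLen]

lemma outerLen_neg_one {b : ℕ} (x : Fin (b + 2) → ℝ) : outerLen (-1) x = nd x 1 + 1 := by
  rw [outerLen, if_neg (by norm_num)]

section

variable {b : ℕ} {θ v η : ℝ} {q : (Fin (b + 2) → ℝ) × (Fin (b + 2) → ℝ)}

lemma Adm.outerLen_pos (h : Adm b v η q) {e : ℝ} (he : e = 1 ∨ e = -1) : 0 < outerLen e q.2 := by
  rcases he with rfl | rfl
  · have := h.sol.nd_lt (i := b) (j := b + 1) (by omega) (by omega)
    rw [h.sol.nd_last] at this
    rw [outerLen_one]; linarith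
  · have := h.sol.nd_lt (i := 0) (j := 1) (by omega) (by omega)
    rw [h.sol.nd_zero] at this
    rw [outerLen_neg_one]; linarith

lemma Adm.outerLen_lt_two (h : Adm b v η q) (hb : 2 ≤ b) {e : ℝ} (he : e = 1 ∨ e = -1) :
    outerLen e q.2 < 2 := by
  rcases he with rfl | rfl
  · have := h.sol.nd_lt (i := 0) (j := b) (by omega) (by omega)
    rw [h.sol.nd_zero] at this
    rw [outerLen_one]; linarith
  · have := h.sol.nd_lt (i := 1) (j := b + 1) (by omega) (by omega)
    rw [h.sol.nd_last] at this
    rw [outerLen_neg_one]; linarith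

lemma Adm.concaveOn (h : Adm b v η q) : ConcaveOn ℝ (Icc (-1) (nd q.2 1)) (evalP q.1) := by
  rw [nd_eq q.2 (j := 1) (by omega)]
  exact h.sol.concaveOn_first h.alternating

lemma Adm.convexOn (h : Adm b v η q) :
    ConvexOn ℝ (Icc (nd q.2 b) 1) (fun t => (-1) ^ b * evalP q.1 t) := by
  rw [nd_eq q.2 (j := b) (by omega)]
  exact h.sol.convexOn_last h.alternating

lemma abs_neg_one_pow_mul (b : ℕ) (t : ℝ) : |(-1) ^ b * t| = |t| := by
  rw [abs_mul, abs_pow, abs_neg, abs_one, one_pow, one_mul]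

lemma Adm.evalP_mem (h : Adm b v η q) {t : ℝ} (ht : t ∈ Icc (-1 : ℝ) 1) :
    evalP q.1 t ∈ Icc (-1 : ℝ) 1 :=
  h.sol.evalP_mem h.lt h.le h.nonneg ht

lemma neg_one_pow_mul_mem {b : ℕ} {t : ℝ} (ht : t ∈ Icc (-1 : ℝ) 1) : (-1) ^ b * t ≤ 1 := by
  rcases neg_one_pow_eq_or ℝ b with e | e <;> rw [e] <;> linarith [ht.1, ht.2]

/-- The displacement of an outer lap is star-shaped. -/
lemma Adm.mul_abs_le (h : Adm b v η q) (hb : 2 ≤ b) {e d t : ℝ} (he : e = 1 ∨ e = -1)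
    (hd : 0 ≤ d) (hdl : d ≤ outerLen e q.2) (ht : 0 ≤ t) (ht1 : t ≤ 1) :
    t * |evalP q.1 (e * (1 - d)) - evalP q.1 e| ≤
      |evalP q.1 (e * (1 - t * d)) - evalP q.1 e| := by
  have hd2 := hdl.trans (h.outerLen_lt_two hb he).le
  have htd : t * d ≤ d := mul_le_of_le_one_left hd ht1
  have htd0 : 0 ≤ t * d := mul_nonneg ht hd
  have hmem : ∀ s, 0 ≤ s → s ≤ d → e * (1 - s) ∈ Icc (-1 : ℝ) 1 := fun s h0 h1 => by
    rcases he with rfl | rfl <;> constructor <;> linarith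
  rcases he with rfl | rfl
  · rw [outerLen_one] at hdl
    have hm := h.sol.nd_mem (j := b) (by omega)
    have hc := h.convexOn.2 (right_mem_Icc.2 hm.2)
      (show 1 - d ∈ Icc (nd q.2 b) 1 from ⟨by linarith, by linarith⟩)
      (sub_nonneg.2 ht1) ht (by ring)
    simp only [smul_eq_mul] at hc
    rw [show (1 - t) * 1 + t * (1 - d) = 1 * (1 - t * d) by ring] at hc
    have h1 : (-1 : ℝ) ^ b * evalP q.1 1 = 1 := by
      rw [h.sol.evalP_one hb, ← pow_add, ← two_mul, pow_mul]; norm_num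
    rw [h1] at hc
    have key : ∀ s, 0 ≤ s → s ≤ d → |evalP q.1 (1 * (1 - s)) - evalP q.1 1| =
        1 - (-1) ^ b * evalP q.1 (1 * (1 - s)) := fun s h0 h2 => by
      have := neg_one_pow_mul_mem (b := b) (h.evalP_mem (hmem s h0 h2))
      rw [← abs_neg_one_pow_mul b (evalP q.1 (1 * (1 - s)) - _), mul_sub ((-1 : ℝ) ^ b), h1,
        abs_of_nonpos (by linarith)]
      ring
    rw [key d hd le_rfl, key _ htd0 htd, one_mul (1 - d)]
    linarith
  · rw [outerLen_neg_one] at hdl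
    have hm := h.sol.nd_mem (j := 1) (by omega)
    have hc := h.concaveOn.2 (left_mem_Icc.2 hm.1)
      (show -1 + d ∈ Icc (-1) (nd q.2 1) from ⟨by linarith, by linarith⟩)
      (sub_nonneg.2 ht1) ht (by ring)
    simp only [smul_eq_mul] at hc
    rw [show (1 - t) * -1 + t * (-1 + d) = -1 * (1 - t * d) by ring, h.sol.evalP_neg_one] at hc
    rw [h.sol.evalP_neg_one, abs_of_nonneg (by linarith [(h.evalP_mem (hmem d hd le_rfl)).1]),
      abs_of_nonneg (by linarith [(h.evalP_mem (hmem _ htd0 htd)).1]),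
      show -1 * (1 - d) = -1 + d by ring]
    linarith

lemma Adm.abs_le_derivP (h : Adm b v η q) (hb : 2 ≤ b) {e d : ℝ} (he : e = 1 ∨ e = -1)
    (hd : 0 < d) (hdl : d ≤ outerLen e q.2) :
    |evalP q.1 (e * (1 - d)) - evalP q.1 e| ≤ |derivP q.1 e| * d := by
  have hd2 := hdl.trans (h.outerLen_lt_two hb he).le
  have hmem : e * (1 - d) ∈ Icc (-1 : ℝ) 1 := by
    rcases he with rfl | rfl <;> constructor <;> linarith
  rcases he with rfl | rfl
  · rw [outerLen_one] at hdl
    have hm := h.sol.nd_mem (j := b) (by omega)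
    have hs := h.convexOn.slope_le_of_hasDerivAt
      (show 1 * (1 - d) ∈ Icc (nd q.2 b) 1 from ⟨by linarith, by linarith⟩)
      (right_mem_Icc.2 hm.2) (by linarith) ((hasDerivAt_evalP q.1 1).const_mul ((-1) ^ b))
    rw [slope_def_field, div_le_iff₀ (by linarith)] at hs
    have h1 : (-1 : ℝ) ^ b * evalP q.1 1 = 1 := by
      rw [h.sol.evalP_one hb, ← pow_add, ← two_mul, pow_mul]; norm_num
    rw [← abs_neg_one_pow_mul b (_ - _), ← abs_neg_one_pow_mul b (derivP _ _), mul_sub, h1,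
      abs_of_nonpos (by linarith [neg_one_pow_mul_mem (b := b) (h.evalP_mem hmem)]),
      abs_of_pos (h.sol.derivP_one_pos h.alternating)]
    linarith
  · rw [outerLen_neg_one] at hdl
    have hm := h.sol.nd_mem (j := 1) (by omega)
    have hs := h.concaveOn.slope_le_of_hasDerivAt (left_mem_Icc.2 hm.1)
      (show -1 * (1 - d) ∈ Icc (-1) (nd q.2 1) from ⟨by linarith, by linarith⟩)
      (by linarith) (hasDerivAt_evalP q.1 (-1))
    rw [slope_def_field, div_le_iff₀ (by linarith)] at hs
    rw [h.sol.evalP_neg_one] at hs ⊢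
    rw [abs_of_nonneg (by linarith [(h.evalP_mem hmem).1]),
      abs_of_pos (h.sol.derivP_neg_one_pos h.alternating)]
    linarith

lemma Adm.cov_mul (h : Adm b v η q) (hb : 2 ≤ b) (hθ : θ = 1 ∨ θ = -1) {e e' d d' t : ℝ}
    (he : e = 1 ∨ e = -1) (he' : e' = 1 ∨ e' = -1) (hfe : evalP (θ • q.1) e = e')
    (hd : 0 < d) (hdl : d ≤ outerLen e q.2) (hd' : d' ≤ |evalP q.1 (e * (1 - d)) - evalP q.1 e|)
    (ht : 0 < t) (ht1 : t ≤ 1) : Cov (evalP (θ • q.1)) e (t * d) e' (t * d') := by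
  have hd2 := hdl.trans (h.outerLen_lt_two hb he).le
  have htd : t * d ≤ d := mul_le_of_le_one_left hd.le ht1
  have htd0 : 0 < t * d := mul_pos ht hd
  refine cov_of_le_abs (continuous_evalP _) he he' htd0 (htd.trans hd2) hfe
    ((h.nearCheb hb hθ).maps ?_) ?_
  · rcases he with rfl | rfl <;> constructor <;> linarith
  · rw [← hfe, evalP_smul, evalP_smul, ← mul_sub, abs_mul,
      show |θ| = 1 by rcases hθ with rfl | rfl <;> simp, one_mul]
    exact (mul_le_mul_of_nonneg_left hd' ht.le).trans (h.mul_abs_le hb he hd.le hdl ht.le ht1)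

end

/-- Covering relations near a map whose outer laps are long. -/
lemma EndCycle.exists_cov {b : ℕ} {θ e₀ e₁ v η : ℝ} (E : EndCycle b θ e₀ e₁) (hb : 2 ≤ b)
    {q₀ : (Fin (b + 2) → ℝ) × (Fin (b + 2) → ℝ)} (h₀ : Adm b v η q₀) {W₀ W₁ D : ℝ}
    (hW₀ : 0 < W₀) (hW₁ : 0 < W₁) (hD : W₀ ≤ D) (hl₀ : W₀ ≤ outerLen e₀ q₀.2)
    (hl₁ : W₁ ≤ outerLen e₁ q₀.2) (hψ₀ : W₁ < |evalP q₀.1 (e₀ * (1 - W₀)) - evalP q₀.1 e₀|)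
    (hψ₁ : D < |evalP q₀.1 (e₁ * (1 - W₁)) - evalP q₀.1 e₁|) :
    ∃ w₀ w₁, 0 < w₀ ∧ w₀ < W₀ ∧ 0 < w₁ ∧ w₁ < W₁ ∧
      (∀ᶠ q in 𝓝 q₀, ∀ v η, Adm b v η q → ∀ t, 0 < t → t ≤ 1 →
        Cov (evalP (θ • q.1)) e₀ (t * w₀) e₁ (t * w₁) ∧
        Cov (evalP (θ • q.1)) e₁ (t * w₁) e₀ (t * D)) ∧
      1 < |derivP q₀.1 e₀| * |derivP q₀.1 e₁| := by
  have choose_w : ∀ {e W C : ℝ}, 0 < W → C < |evalP q₀.1 (e * (1 - W)) - evalP q₀.1 e| →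
      ∃ w, 0 < w ∧ w < W ∧ C < |evalP q₀.1 (e * (1 - w)) - evalP q₀.1 e| := by
    intro e W C hW hC
    have hc : Continuous fun w => |evalP q₀.1 (e * (1 - w)) - evalP q₀.1 e| :=
      (((continuous_evalP q₀.1).comp (by fun_prop : Continuous fun w : ℝ => e * (1 - w))).sub
        continuous_const).abs
    have h1 : ∀ᶠ w in 𝓝[<] W, C < |evalP q₀.1 (e * (1 - w)) - evalP q₀.1 e| :=
      nhdsWithin_le_nhds ((hc.tendsto W).eventually (lt_mem_nhds hC))
    have h2 : ∀ᶠ w in 𝓝[<] W, 0 < w := nhdsWithin_le_nhds (lt_mem_nhds hW)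
    obtain ⟨w, h3, h4, h5⟩ := (h1.and (h2.and self_mem_nhdsWithin)).exists
    exact ⟨w, h4, h5, h3⟩
  obtain ⟨w₀, hw₀, hwW₀, hC₀⟩ := choose_w hW₀ hψ₀
  obtain ⟨w₁, hw₁, hwW₁, hC₁⟩ := choose_w hW₁ hψ₁
  have hcψ : ∀ e w : ℝ, Continuous fun q : (Fin (b + 2) → ℝ) × (Fin (b + 2) → ℝ) =>
      |evalP q.1 (e * (1 - w)) - evalP q.1 e| := fun e w =>
    ((continuous_evalP_uncurry.comp (continuous_fst.prodMk continuous_const)).sub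
      (continuous_evalP_uncurry.comp (continuous_fst.prodMk continuous_const))).abs
  have hcl : ∀ e : ℝ, Continuous fun q : (Fin (b + 2) → ℝ) × (Fin (b + 2) → ℝ) =>
      outerLen e q.2 := fun e => (continuous_outerLen e).comp continuous_snd
  refine ⟨w₀, w₁, hw₀, hwW₀, hw₁, hwW₁, ?_, ?_⟩
  · filter_upwards [((hcψ e₀ w₀).tendsto q₀).eventually (lt_mem_nhds hC₀),
      ((hcψ e₁ w₁).tendsto q₀).eventually (lt_mem_nhds hC₁),
      ((hcl e₀).tendsto q₀).eventually (lt_mem_nhds (hwW₀.trans_le hl₀)),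
      ((hcl e₁).tendsto q₀).eventually (lt_mem_nhds (hwW₁.trans_le hl₁))]
      with q g₀ g₁ g₂ g₃ v η hq t ht ht1
    exact ⟨hq.cov_mul hb E.sign E.left' E.right (E.map_left v η q hq) hw₀ g₂.le
        (hwW₁.le.trans g₀.le) ht ht1,
      hq.cov_mul hb E.sign E.right E.left' (E.map_right v η q hq) hw₁ g₃.le g₁.le ht ht1⟩
  · have h1 := hC₀.trans_le (h₀.abs_le_derivP hb E.left' hw₀ (hwW₀.le.trans hl₀))
    have h2 := hC₁.trans_le (h₀.abs_le_derivP hb E.right hw₁ (hwW₁.le.trans hl₁))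
    have h3 : w₁ * w₀ < |derivP q₀.1 e₀| * w₀ * (|derivP q₀.1 e₁| * w₁) :=
      mul_lt_mul'' (hwW₁.trans h1) ((hwW₀.trans_le hD).trans h2) hw₁.le hw₀.le
    have h4 : 0 < w₁ * w₀ := mul_pos hw₁ hw₀
    by_contra h5
    rw [not_lt] at h5
    nlinarith

lemma one_endCycle (b : ℕ) : EndCycle b 1 (-1) (-1) where
  sign := Or.inl rfl
  left := rfl
  right := Or.inr rfl
  map_left v η q h := by rw [one_smul]; exact h.sol.evalP_neg_one
  map_right v η q h := by rw [one_smul]; exact h.sol.evalP_neg_one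

lemma neg_one_endCycle {b : ℕ} (hb : 2 ≤ b) : EndCycle b (-1) 1 ((-1) ^ (b + 1)) where
  sign := Or.inr rfl
  left := by norm_num
  right := neg_one_pow_eq_or ℝ _
  map_left v η q h := by rw [evalP_smul, h.sol.evalP_one hb, pow_succ]; ring
  map_right v η q h := by
    rw [evalP_smul]
    rcases Nat.even_or_odd b with hb' | hb'
    · rw [hb'.add_one.neg_one_pow, h.sol.evalP_neg_one]; norm_num
    · rw [hb'.add_one.neg_one_pow, h.sol.evalP_one hb, hb'.neg_one_pow]; norm_num

lemma eventually_lt_outerLen {b : ℕ} {e w : ℝ} {q₀ : (Fin (b + 2) → ℝ) × (Fin (b + 2) → ℝ)}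
    (h : w < outerLen e q₀.2) : ∀ᶠ q in 𝓝 q₀, w < outerLen e q.2 :=
  ((continuous_outerLen e).comp continuous_snd).tendsto q₀ |>.eventually (lt_mem_nhds h)

lemma Adm.abs_outer_one {b : ℕ} {v : ℝ} {q : (Fin (b + 2) → ℝ) × (Fin (b + 2) → ℝ)}
    (h : Adm b v 0 q) (hb : 2 ≤ b) :
    |evalP q.1 (1 * (1 - outerLen 1 q.2)) - evalP q.1 1| = 2 := by
  rw [outerLen_one, one_mul, sub_sub_cancel, h.sol.evalP_nd_last hb, h.sol.evalP_one hb, pow_succ]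
  rcases neg_one_pow_eq_or ℝ b with e | e <;> rw [e] <;> norm_num

lemma Adm.abs_outer_neg_one {b : ℕ} {v η : ℝ} {q : (Fin (b + 2) → ℝ) × (Fin (b + 2) → ℝ)}
    (h : Adm b v η q) :
    |evalP q.1 (-1 * (1 - outerLen (-1) q.2)) - evalP q.1 (-1)| = v + 1 := by
  rw [outerLen_neg_one, show -1 * (1 - (nd q.2 1 + 1)) = nd q.2 1 by ring, h.sol.evalP_nd_one,
    h.sol.evalP_neg_one, abs_of_nonneg (by linarith [h.lt, h.nonneg])]
  ring

lemma exists_core_of_fixed {b : ℕ} (hb : 2 ≤ b) {α x0 : ℝ}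
    {q₀ : (Fin (b + 2) → ℝ) × (Fin (b + 2) → ℝ)} (h₀ : Adm b α 0 q₀)
    (hx1 : nd q₀.2 1 < x0) (hx2 : x0 < nd q₀.2 2) (hα : -x0 < α)
    (hpl : ∀ᶠ q in 𝓝 q₀, ∀ v η, Adm b v η q →
      ∃ p' p, FixedPlateau (evalP ((-1 : ℝ) • q.1)) (nd q.2) p' p ∧ x0 < p) :
    ∃ w₀ w₁ D δ, Core b (-1) 1 ((-1) ^ (b + 1)) (fun μ => ((b : ℝ) - 1) / μ + b - μ) q₀
      w₀ w₁ D δ := by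
  have E := neg_one_endCycle hb
  have hn1 := h₀.sol.nd_lt (i := 0) (j := 1) (by omega) (by omega)
  rw [h₀.sol.nd_zero] at hn1
  have hn2 := h₀.sol.nd_le hb (by omega)
  have hl0 := h₀.outerLen_pos (e := 1) (Or.inl rfl)
  have hl1 := h₀.outerLen_pos (e := -1) (Or.inr rfl)
  have hψ : ∀ e : ℝ, e = 1 ∨ e = -1 →
      1 - x0 < |evalP q₀.1 (e * (1 - outerLen e q₀.2)) - evalP q₀.1 e| := by
    rintro e (rfl | rfl)
    · rw [h₀.abs_outer_one hb]; linarith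
    · rw [h₀.abs_outer_neg_one]; linarith
  obtain ⟨w₀, w₁, hw₀, hwW₀, hw₁, hwW₁, hcov, hone⟩ := E.exists_cov hb h₀
    (W₀ := outerLen 1 q₀.2) (W₁ := outerLen ((-1) ^ (b + 1)) q₀.2) (D := 1 - x0)
    (h₀.outerLen_pos (Or.inl rfl)) (h₀.outerLen_pos E.right)
    (by rw [outerLen_one]; linarith) le_rfl le_rfl
    (by rw [h₀.abs_outer_one hb]; exact h₀.outerLen_lt_two hb E.right) (hψ _ E.right)
  set δ := min (outerLen 1 q₀.2) (outerLen (-1) q₀.2) / 2 with hδ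
  have hδ0 : 0 < min (outerLen 1 q₀.2) (outerLen (-1) q₀.2) := lt_min hl0 hl1
  refine ⟨w₀, w₁, 1 - x0, δ, hw₀, hw₁, ?_, by positivity, ?_, ?_, hcov, hone⟩
  · rw [outerLen_one] at hwW₀; linarith
  · filter_upwards [hpl, eventually_lt_outerLen hwW₀, eventually_lt_outerLen hwW₁]
      with q hq g₀ g₁ v η h μ k r hμ hs hr
    obtain ⟨p', p, hp, hxp⟩ := hq v η h
    have hN := h.nearCheb hb E.sign
    rw [outerLen_one] at g₀
    have hxb := h.sol.nd_le (i := 1) (j := b) (by omega) (by omega)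
    have hnear1 : ∀ ρ ≤ w₀, ∀ t ∈ endNhd 1 ρ, p' ≤ t := fun ρ hρ t ht => by
      linarith [(abs_lt.1 ht.2).1, hp.lt₂]
    refine hp.htop_le hN (S := fun n => endNhd (endSeq 1 ((-1) ^ (b + 1)) n) (r n)) hμ hs
      ?_ ?_ ?_ ?_
    · simp [endSeq, hr.zero]
    · intro n hn y hy hyI
      obtain ⟨t, ht, hty⟩ := hr.cov n hn y hy
      exact ⟨t, ht, ht.1, hty⟩
    · intro t ht
      simp only [endSeq, hr.even, if_true, hr.last]
      have := hp.lt₁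
      have := hp.lt₂
      have := hp.lt₃
      exact ⟨⟨by linarith [ht.1], ht.2⟩, by rw [abs_lt]; constructor <;> linarith [ht.1, ht.2]⟩
    · rcases Nat.even_or_odd b with hb' | hb'
      · right
        rw [hb'.add_one.neg_one_pow] at g₁ hr ⊢
        rw [outerLen_neg_one] at g₁
        refine ⟨hr.even, fun n hn => ⟨fun he t ht => ?_, fun ho t ht => ?_⟩⟩
        · have hle := hr.le n hn
          simp only [endSeq, he, if_true] at ht hle
          exact hnear1 _ hle t ht
        · have hle := hr.le n hn
          simp only [endSeq, Nat.not_even_iff_odd.2 ho, if_false] at ht hle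
          linarith [(abs_lt.1 ht.2).2, hp.lt₃]
      · left
        rw [hb'.add_one.neg_one_pow] at g₁ hr ⊢
        rw [outerLen_one] at g₁
        refine ⟨by obtain ⟨c, rfl⟩ := hb'; omega, fun n hn t ht => ?_⟩
        have hle := hr.le n hn
        have he : endSeq (1 : ℝ) 1 n = 1 := by simp [endSeq]
        simp only [he] at ht
        have hle' : r n ≤ max w₀ w₁ := by
          refine hle.trans ?_
          unfold endSeq
          split_ifs
          exacts [le_max_left _ _, le_max_right _ _]
        have hmax : max w₀ w₁ < 1 - nd q.2 b := max_lt g₀ g₁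
        linarith [(abs_lt.1 ht.2).1, hp.lt₂]
  · have e1 : δ < outerLen 1 q₀.2 := (half_lt_self hδ0).trans_le (min_le_left _ _)
    have e2 : δ < outerLen (-1) q₀.2 := (half_lt_self hδ0).trans_le (min_le_right _ _)
    filter_upwards [hpl, eventually_lt_outerLen e1, eventually_lt_outerLen e2]
      with q hq g₀ g₁ v η h μ k r hμ hs hr
    obtain ⟨p', p, hp, hxp⟩ := hq v η h
    have hN := h.nearCheb hb E.sign
    rw [outerLen_one] at g₀
    rw [outerLen_neg_one] at g₁
    have hinj := fun n (hn : n < k) => h.injOn_endNhd hb E.sign (E.endSeq_eq n)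
      ((hr.le n hn.le).trans g₁.le) ((hr.le n hn.le).trans g₀.le)
    refine hp.le_htop hN (S := fun n => endNhd (endSeq 1 ((-1) ^ (b + 1)) n) (r n)) hμ hs
      ?_ (fun n hn => (hinj n hn).1) hr.hit ?_ (fun n hn => (hinj n hn).2)
    · simp [endSeq, hr.zero]
    · intro t ht
      simp only [endSeq, hr.even, if_true] at ht
      have := hr.le k le_rfl
      have := h.sol.nd_le hb (by omega)
      exact ⟨by linarith [(abs_lt.1 ht.2).1, hp.lt₄], ht.1.2⟩

lemma exists_core_of_cycle {b : ℕ} (hb : 2 ≤ b) {α x0 x1 : ℝ}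
    {q₀ : (Fin (b + 2) → ℝ) × (Fin (b + 2) → ℝ)} (h₀ : Adm b α 0 q₀)
    (hx1 : -1 < x1) (hx0 : x1 < x0) (hxc : x0 < nd q₀.2 1) (hgt : x0 < evalP q₀.1 x0)
    (hpl : ∀ᶠ q in 𝓝 q₀, ∀ v η, Adm b v η q →
      ∃ p' p r, CyclePlateau b η v (evalP q.1) (nd q.2) p' p r ∧ x1 < p' ∧ p' < x0) :
    ∃ w₀ w₁ D δ, Core b 1 (-1) (-1) (CyclePlateau.defect b) q₀ w₀ w₁ D δ := by
  have E := one_endCycle b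
  have hl0 := h₀.outerLen_pos (e := 1) (Or.inl rfl)
  have hl1 := h₀.outerLen_pos (e := -1) (Or.inr rfl)
  have hψ : x0 + 1 < |evalP q₀.1 (-1 * (1 - (x0 + 1))) - evalP q₀.1 (-1)| := by
    rw [h₀.sol.evalP_neg_one, show -1 * (1 - (x0 + 1)) = x0 by ring,
      abs_of_nonneg (by linarith)]
    linarith
  have hlen : x0 + 1 ≤ outerLen (-1) q₀.2 := by rw [outerLen_neg_one]; linarith
  obtain ⟨w₀, w₁, hw₀, hwW₀, hw₁, hwW₁, hcov, hone⟩ := E.exists_cov hb h₀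
    (W₀ := x0 + 1) (W₁ := x0 + 1) (D := x0 + 1) (by linarith) (by linarith) le_rfl hlen hlen hψ hψ
  set δ := min (min (outerLen 1 q₀.2) (outerLen (-1) q₀.2)) (x1 + 1) / 2 with hδ
  have hδ0 : 0 < min (min (outerLen 1 q₀.2) (outerLen (-1) q₀.2)) (x1 + 1) :=
    lt_min (lt_min hl0 hl1) (by linarith)
  have hs1 : ∀ n, endSeq (-1 : ℝ) (-1) n = -1 := fun n => by simp [endSeq]
  refine ⟨w₀, w₁, x0 + 1, δ, hw₀, hw₁, hwW₀, by positivity, ?_, ?_, hcov, hone⟩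
  · have hxc' : ∀ᶠ q in 𝓝 q₀, x0 < nd q.2 1 :=
      ((continuous_nd 1).comp continuous_snd).tendsto q₀ |>.eventually (lt_mem_nhds hxc)
    filter_upwards [hpl, hxc'] with q hq hxq v η h μ k r hμ hs hr
    obtain ⟨p', p, r', hp, hp1, hp0⟩ := hq v η h
    have hN := h.nearCheb hb E.sign
    rw [one_smul] at hN hr ⊢
    refine hp.htop_le hN (S := fun n => endNhd (endSeq (-1) (-1) n) (r n)) hμ hs ?_ ?_ ?_ ?_
    · simp [endSeq, hr.zero]
    · intro n hn y hy hyI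
      obtain ⟨t, ht, hty⟩ := hr.cov n hn y hy
      exact ⟨t, ht, ht.1, hty⟩
    · intro t ht
      simp only [hs1, hr.last]
      have h1 := (h.sol.nd_mem (j := 1) (by omega)).2
      exact ⟨⟨ht.1, by linarith [ht.2]⟩, by rw [abs_lt]; constructor <;> linarith [ht.1, ht.2]⟩
    · intro n hn t ht
      have hle := hr.le n hn
      simp only [hs1] at ht
      have hle' : r n ≤ x0 + 1 := by
        refine hle.trans ?_
        unfold endSeq
        split_ifs
        exacts [hwW₀.le, hwW₁.le]
      linarith [(abs_lt.1 ht.2).2, hp.lt₃]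
  · have e1 : δ < outerLen 1 q₀.2 :=
      (half_lt_self hδ0).trans_le ((min_le_left _ _).trans (min_le_left _ _))
    have e2 : δ < outerLen (-1) q₀.2 :=
      (half_lt_self hδ0).trans_le ((min_le_left _ _).trans (min_le_right _ _))
    have e3 : δ < x1 + 1 := (half_lt_self hδ0).trans_le (min_le_right _ _)
    filter_upwards [hpl, eventually_lt_outerLen e1, eventually_lt_outerLen e2]
      with q hq g₀ g₁ v η h μ k r hμ hs hr
    obtain ⟨p', p, r', hp, hp1, hp0⟩ := hq v η h
    have hN := h.nearCheb hb E.sign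
    rw [outerLen_one] at g₀
    rw [outerLen_neg_one] at g₁
    have hinj := fun n (hn : n < k) => h.injOn_endNhd hb E.sign (E.endSeq_eq n)
      ((hr.le n hn.le).trans g₁.le) ((hr.le n hn.le).trans g₀.le)
    rw [one_smul] at hN hr hinj ⊢
    refine hp.le_htop hN (S := fun n => endNhd (endSeq (-1) (-1) n) (r n)) hμ hs
      ?_ (fun n hn => (hinj n hn).1) hr.hit ?_ (fun n hn => (hinj n hn).2)
    · simp [endSeq, hr.zero]
    · intro t ht
      simp only [hs1] at ht
      have := hr.le k le_rfl
      exact ⟨ht.1.1, by linarith [(abs_lt.1 ht.2).2]⟩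

lemma eventually_abs_sub_le_half {g : ℝ → ℝ} {c : ℝ} (h : HasDerivAt g 0 c) (hc : g c = c) :
    ∀ᶠ t in 𝓝 c, |g t - c| ≤ 1 / 2 * |t - c| := by
  have h1 := (hasDerivAt_iff_isLittleO.1 h).bound (show (0 : ℝ) < 1 / 2 by norm_num)
  filter_upwards [h1] with t ht
  simpa [hc] using ht

lemma eventually_lt_self {g : ℝ → ℝ} {c : ℝ} (h : HasDerivAt g 0 c) (hc : g c = c) :
    ∀ᶠ t in 𝓝[>] c, g t < t := by
  filter_upwards [nhdsWithin_le_nhds (eventually_abs_sub_le_half h hc), self_mem_nhdsWithin]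
    with t ht (hct : c < t)
  rw [abs_of_pos (sub_pos.2 hct)] at ht
  linarith [(abs_le.1 ht).2]

lemma eventually_self_lt {g : ℝ → ℝ} {c : ℝ} (h : HasDerivAt g 0 c) (hc : g c = c) :
    ∀ᶠ t in 𝓝[<] c, t < g t := by
  filter_upwards [nhdsWithin_le_nhds (eventually_abs_sub_le_half h hc), self_mem_nhdsWithin]
    with t ht (hct : t < c)
  rw [abs_of_neg (sub_neg.2 hct)] at ht
  linarith [(abs_le.1 ht).1]

lemma eventually_lt_of_continuous {Y : Type*} [TopologicalSpace Y] {f g : Y → ℝ}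
    (hf : Continuous f) (hg : Continuous g) {y : Y} (h : f y < g y) : ∀ᶠ z in 𝓝 y, f z < g z :=
  (isOpen_lt hf hg).mem_nhds h

lemma exists_gt_of_eventually {p : ℝ → Prop} {c d : ℝ} (hp : ∀ᶠ t in 𝓝[>] c, p t)
    (hd : c < d) : ∃ t, p t ∧ c < t ∧ t < d := by
  have h : ∀ᶠ t in 𝓝[>] c, t ∈ Ioo c d := Ioo_mem_nhdsGT hd
  exact (hp.and h).exists

lemma exists_lt_of_eventually {p : ℝ → Prop} {c d : ℝ} (hp : ∀ᶠ t in 𝓝[<] c, p t)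
    (hd : d < c) : ∃ t, p t ∧ t < c ∧ d < t := by
  have h : ∀ᶠ t in 𝓝[<] c, t ∈ Ioo d c := Ioo_mem_nhdsLT hd
  obtain ⟨t, h1, h2⟩ := (hp.and h).exists
  exact ⟨t, h1, h2.2, h2.1⟩

section

variable {b : ℕ} {v η : ℝ} {q : (Fin (b + 2) → ℝ) × (Fin (b + 2) → ℝ)}

lemma Adm.strictMonoOn_first (h : Adm b v η q) (hb : 2 ≤ b) :
    StrictMonoOn (evalP q.1) (Icc (-1) (nd q.2 1)) := by
  have := (h.nearCheb hb (Or.inl rfl)).mono 0 (by omega)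
  rw [h.sol.nd_zero] at this
  simpa using this

lemma Adm.strictAntiOn_second (h : Adm b v η q) (hb : 2 ≤ b) :
    StrictAntiOn (evalP q.1) (Icc (nd q.2 1) (nd q.2 2)) := by
  have := (h.nearCheb hb (Or.inl rfl)).mono 1 (by omega)
  intro s hs t ht hst
  have h1 := this hs ht hst
  simp only [one_smul, pow_one, one_mul] at h1
  linarith

lemma Adm.derivP_nd_one (h : Adm b v η q) (hb : 2 ≤ b) : derivP q.1 (nd q.2 1) = 0 := by
  rw [nd_eq q.2 (j := 1) (by omega)]
  exact h.sol.crit ⟨0, by omega⟩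

lemma Adm.neg_one_lt_nd_one (h : Adm b v η q) : -1 < nd q.2 1 := by
  rw [← h.sol.nd_zero]
  exact h.sol.nd_lt (by omega) (by omega)

lemma Adm.nd_last_lt_one (h : Adm b v η q) : nd q.2 b < 1 := by
  rw [← h.sol.nd_last]
  exact h.sol.nd_lt (by omega) (by omega)

end

lemma continuous_nd_snd {b : ℕ} (j : ℕ) :
    Continuous fun q : (Fin (b + 2) → ℝ) × (Fin (b + 2) → ℝ) => nd q.2 j :=
  (continuous_nd j).comp continuous_snd

lemma Continuous.evalP_fst {b : ℕ} {g : (Fin (b + 2) → ℝ) × (Fin (b + 2) → ℝ) → ℝ}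
    (hg : Continuous g) : Continuous fun q => evalP q.1 (g q) :=
  continuous_evalP_uncurry.comp (continuous_fst.prodMk hg)

/-- A fixed turning point gives rise to local entropy estimates. -/
lemma exists_core_fixed {b : ℕ} (hb : 2 ≤ b) {α : ℝ}
    {q₀ : (Fin (b + 2) → ℝ) × (Fin (b + 2) → ℝ)} (h₀ : Adm b α 0 q₀) (hfix : nd q₀.2 1 = -α) :
    ∃ w₀ w₁ D δ, Core b (-1) 1 ((-1) ^ (b + 1)) (fun μ => ((b : ℝ) - 1) / μ + b - μ) q₀
      w₀ w₁ D δ := by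
  set c := nd q₀.2 1 with hc
  have hn2 : c < nd q₀.2 2 := h₀.sol.nd_lt (by omega) (by omega)
  have hn2' : nd q₀.2 2 < 1 := (h₀.sol.nd_le hb (by omega)).trans_lt h₀.nd_last_lt_one
  have hPc : evalP q₀.1 c = α := h₀.sol.evalP_nd_one
  have hP2 := h₀.sol.evalP_nd_two (by omega)
  have hd : HasDerivAt (fun t => -evalP q₀.1 t) 0 c := by
    have := (hasDerivAt_evalP q₀.1 c).neg
    rwa [h₀.derivP_nd_one hb, neg_zero] at this
  obtain ⟨x0, hx0, hx0c, hx02⟩ := exists_gt_of_eventually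
    (eventually_lt_self hd (by linarith)) hn2
  have hcP : Continuous (evalP q₀.1) := continuous_evalP _
  obtain ⟨v1, hv1, hv1c, hv1'⟩ := exists_lt_of_eventually
      (p := fun t => -evalP q₀.1 t < x0)
      (eventually_nhdsWithin_of_eventually_nhds (eventually_lt_of_continuous hcP.neg
    continuous_const (y := c) (g := fun _ => x0) (by simp only [Pi.neg_apply, hPc]; linarith)))
      h₀.neg_one_lt_nd_one
  refine exists_core_of_fixed hb h₀ (x0 := x0) hx0c hx02 (by linarith) ?_
  have k : ∀ t : ℝ, Continuous fun _ : (Fin (b + 2) → ℝ) × (Fin (b + 2) → ℝ) => t := fun t =>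
    continuous_const
  filter_upwards [eventually_lt_of_continuous (k v1) (continuous_nd_snd 1) hv1c,
    eventually_lt_of_continuous (continuous_nd_snd 1) (k x0) hx0c,
    eventually_lt_of_continuous (k x0) (continuous_nd_snd 2) hx02,
    eventually_lt_of_continuous (k x0).evalP_fst.neg (k x0) (y := q₀) hx0,
    eventually_lt_of_continuous (k v1).evalP_fst.neg (k x0) (y := q₀) hv1,
    eventually_lt_of_continuous (k v1) (continuous_nd_snd 1).evalP_fst.neg (y := q₀)
      (by simp only [Pi.neg_apply, ← hc, hPc]; linarith),
    eventually_lt_of_continuous (continuous_nd_snd 2) (continuous_nd_snd 2).evalP_fst.neg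
      (y := q₀) (by simp only [Pi.neg_apply, hP2]; linarith)] with q g1 g2 g3 g4 g5 g6 g7 v η h
  simp only [Pi.neg_apply] at g4 g5 g6 g7
  have hQ : Continuous (evalP q.1) := continuous_evalP _
  have hq2 := (h.sol.nd_mem (j := 2) (by omega)).2
  obtain ⟨p, hp, hp0⟩ := intermediate_value_Ioo g3.le (hQ.neg.sub continuous_id).continuousOn
    (show (0 : ℝ) ∈ Ioo (-evalP q.1 x0 - x0) (-evalP q.1 (nd q.2 2) - nd q.2 2) from
      ⟨by linarith, by linarith⟩)
  replace hp0 : -evalP q.1 p - p = 0 := hp0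
  obtain ⟨p', hp', hp'0⟩ := intermediate_value_Ioo' hv1'.le hQ.neg.continuousOn
    (show p ∈ Ioo (-evalP q.1 v1) (-evalP q.1 (-1)) from
      ⟨by linarith [hp.1], by rw [h.sol.evalP_neg_one]; linarith [hp.2]⟩)
  replace hp'0 : -evalP q.1 p' = p := hp'0
  refine ⟨p', p, ⟨hp'.1, by linarith [hp'.2], by linarith [hp.1], hp.2, ?_, ?_, ?_⟩, hp.1⟩
  · rw [evalP_smul]; linarith
  · rw [evalP_smul]; linarith
  · rw [evalP_smul]; linarith [hp'.2]

/-- A turning point of period two gives rise to local entropy estimates. -/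
lemma exists_core_cycle {b : ℕ} (hb : 2 ≤ b) {α : ℝ}
    {q₀ : (Fin (b + 2) → ℝ) × (Fin (b + 2) → ℝ)} (h₀ : Adm b α 0 q₀) (hα : α < 1)
    (hbα : nd q₀.2 b < α) (hper : evalP q₀.1 α = nd q₀.2 1) :
    ∃ w₀ w₁ D δ, Core b 1 (-1) (-1) (CyclePlateau.defect b) q₀ w₀ w₁ D δ := by
  set c := nd q₀.2 1 with hc
  have hn1 : -1 < c := h₀.neg_one_lt_nd_one
  have hn2 : c < nd q₀.2 2 := h₀.sol.nd_lt (by omega) (by omega)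
  have hn2b : nd q₀.2 2 ≤ nd q₀.2 b := h₀.sol.nd_le hb (by omega)
  have hb1 := h₀.nd_last_lt_one
  have hPc : evalP q₀.1 c = α := h₀.sol.evalP_nd_one
  have hP2 := h₀.sol.evalP_nd_two (by omega)
  have hPb := h₀.sol.evalP_nd_last hb
  have hmono := h₀.strictMonoOn_first hb
  have hanti := h₀.strictAntiOn_second hb
  have hcP : Continuous (evalP q₀.1) := continuous_evalP _
  have hFc : evalP q₀.1 (evalP q₀.1 c) = c := by rw [hPc, hper]
  have hd : HasDerivAt (fun t => evalP q₀.1 (evalP q₀.1 t)) 0 c := by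
    have := (hasDerivAt_evalP q₀.1 (evalP q₀.1 c)).comp c (hasDerivAt_evalP q₀.1 c)
    rwa [h₀.derivP_nd_one hb, mul_zero] at this
  have k : ∀ t : ℝ, Continuous fun _ : (Fin (b + 2) → ℝ) × (Fin (b + 2) → ℝ) => t := fun t =>
    continuous_const
  have kr : ∀ t : ℝ, Continuous fun _ : ℝ => t := fun t => continuous_const
  rcases Nat.even_or_odd b with hbe | hbo
  · rw [hbe.add_one.neg_one_pow] at hPb
    obtain ⟨ξ, hξ, hξb⟩ := intermediate_value_Ioo hn1.le hcP.continuousOn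
      (show nd q₀.2 b ∈ Ioo (evalP q₀.1 (-1)) (evalP q₀.1 c) from
        ⟨by rw [h₀.sol.evalP_neg_one]; linarith, by rw [hPc]; exact hbα⟩)
    obtain ⟨x1, hx1F, hx1ξ, hx1c⟩ := exists_gt_of_eventually
      (p := fun t => evalP q₀.1 (evalP q₀.1 t) < t)
      (eventually_nhdsWithin_of_eventually_nhds (eventually_lt_of_continuous
      (hcP.comp hcP) continuous_id (y := ξ) (by
        simp only [Function.comp, hξb, hPb, id]; exact hξ.1)))
      hξ.2
    have hx1b : nd q₀.2 b < evalP q₀.1 x1 := by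
      rw [← hξb]
      exact hmono ⟨hξ.1.le, hξ.2.le⟩ ⟨by linarith [hξ.1], hx1c.le⟩ hx1ξ
    obtain ⟨x0, hx0F, hx0c, hx01⟩ := exists_lt_of_eventually
      (eventually_self_lt hd hFc) hx1c
    have hx1' : -1 < x1 := hξ.1.trans hx1ξ
    have hP01 : evalP q₀.1 x1 < evalP q₀.1 x0 :=
      hmono ⟨hx1'.le, hx1c.le⟩ ⟨by linarith, hx0c.le⟩ hx01
    have hP0c : evalP q₀.1 x0 < evalP q₀.1 c :=
      hmono ⟨by linarith, hx0c.le⟩ ⟨hn1.le, le_rfl⟩ hx0c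
    obtain ⟨y0, hy0, hy0c, hy02⟩ := exists_gt_of_eventually
      (p := fun t => evalP q₀.1 x0 < evalP q₀.1 t)
      (eventually_nhdsWithin_of_eventually_nhds (eventually_lt_of_continuous
      (kr (evalP q₀.1 x0)) hcP hP0c))
      hn2
    refine exists_core_of_cycle hb h₀ (x0 := x0) (x1 := x1) hx1' hx01 hx0c (by linarith) ?_
    filter_upwards [eventually_lt_of_continuous (k x0) (continuous_nd_snd 1) hx0c,
      eventually_lt_of_continuous (continuous_nd_snd 1) (k y0) hy0c,
      eventually_lt_of_continuous (k y0) (continuous_nd_snd 2) hy02,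
      eventually_lt_of_continuous (continuous_nd_snd 2).evalP_fst (k x1) (y := q₀)
        (by simp only [hP2]; linarith),
      eventually_lt_of_continuous (continuous_nd_snd b) (k x1).evalP_fst hx1b,
      eventually_lt_of_continuous (k x1).evalP_fst.evalP_fst (k x1) (y := q₀) hx1F,
      eventually_lt_of_continuous (k x0) (k x0).evalP_fst.evalP_fst (y := q₀) hx0F,
      eventually_lt_of_continuous (k x0).evalP_fst (k y0).evalP_fst (y := q₀) hy0,
      eventually_lt_of_continuous (continuous_nd_snd 1).evalP_fst.evalP_fst (k y0) (y := q₀)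
        (by simp only [← hc, hFc]; exact hy0c),
      eventually_lt_of_continuous (continuous_nd_snd 1).evalP_fst (k 1) (y := q₀)
        (by simp only [← hc, hPc]; exact hα)] with q g1 g2 g3 g4 g5 g6 g7 g8 g9 g10 v η h
    have hQ : Continuous (evalP q.1) := continuous_evalP _
    have hq2b := h.sol.nd_le hb (by omega)
    have hqm := h.strictMonoOn_first hb
    obtain ⟨p', hp', hp'0⟩ := intermediate_value_Ioo hx01.le
      ((hQ.comp hQ).sub continuous_id).continuousOn
      (show (0 : ℝ) ∈ Ioo (evalP q.1 (evalP q.1 x1) - x1) (evalP q.1 (evalP q.1 x0) - x0) from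
        ⟨by linarith, by linarith⟩)
    replace hp'0 : evalP q.1 (evalP q.1 p') - p' = 0 := hp'0
    have hr1 : evalP q.1 x1 < evalP q.1 p' :=
      hqm ⟨hx1'.le, by linarith⟩ ⟨by linarith [hp'.1], by linarith [hp'.2]⟩ hp'.1
    have hr0 : evalP q.1 p' < evalP q.1 x0 :=
      hqm ⟨by linarith [hp'.1], by linarith [hp'.2]⟩ ⟨by linarith, g1.le⟩ hp'.2
    obtain ⟨p, hp, hp0⟩ := intermediate_value_Ioo' g3.le hQ.continuousOn
      (show evalP q.1 p' ∈ Ioo (evalP q.1 (nd q.2 2)) (evalP q.1 y0) from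
        ⟨by linarith, by linarith⟩)
    rw [h.sol.evalP_nd_one] at g9 g10
    rw [h.sol.evalP_nd_two (by omega)] at g4
    exact ⟨p', p, evalP q.1 p', ⟨by linarith [hp'.1], by linarith [hp'.2], by linarith [hp.1],
      hp.2, rfl, hp0, by linarith, g10, Or.inl ⟨hbe, by linarith, by linarith [hp.1]⟩⟩,
      hp'.1, hp'.2⟩
  · rw [hbo.add_one.neg_one_pow] at hPb
    obtain ⟨ξ, hξ, hξb⟩ := intermediate_value_Ioo' hn2.le hcP.continuousOn
      (show nd q₀.2 b ∈ Ioo (evalP q₀.1 (nd q₀.2 2)) (evalP q₀.1 c) from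
        ⟨by rw [hP2]; linarith, by rw [hPc]; exact hbα⟩)
    obtain ⟨y1, hy1F, hy1ξ, hy1c⟩ := exists_lt_of_eventually
      (p := fun t => t < evalP q₀.1 (evalP q₀.1 t))
      (eventually_nhdsWithin_of_eventually_nhds (eventually_lt_of_continuous
      continuous_id (hcP.comp hcP) (y := ξ) (by
        simp only [Function.comp, hξb, hPb, id]; linarith [hξ.2])))
      hξ.1
    have hy12 : y1 < nd q₀.2 2 := hy1ξ.trans hξ.2
    have hy1b : nd q₀.2 b < evalP q₀.1 y1 := by
      rw [← hξb]
      exact hanti ⟨hy1c.le, hy12.le⟩ ⟨hξ.1.le, hξ.2.le⟩ hy1ξ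
    obtain ⟨y0, hy0F, hy0c, hy01⟩ := exists_gt_of_eventually
      (eventually_lt_self hd hFc) hy1c
    have hP01 : evalP q₀.1 y1 < evalP q₀.1 y0 :=
      hanti ⟨hy0c.le, by linarith⟩ ⟨hy1c.le, hy12.le⟩ hy01
    have hP0c : evalP q₀.1 y0 < evalP q₀.1 c :=
      hanti ⟨le_rfl, hn2.le⟩ ⟨hy0c.le, by linarith⟩ hy0c
    obtain ⟨x1, hx1P, hx1', hx1c⟩ := exists_gt_of_eventually
      (p := fun t => evalP q₀.1 t < nd q₀.2 b)
      (eventually_nhdsWithin_of_eventually_nhds (eventually_lt_of_continuous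
      hcP (kr (nd q₀.2 b)) (y := -1) (by rw [h₀.sol.evalP_neg_one]; linarith)))
      hn1
    obtain ⟨x0, hx0, hx0c, hx01⟩ := exists_lt_of_eventually
      (p := fun t => evalP q₀.1 y0 < evalP q₀.1 t)
      (eventually_nhdsWithin_of_eventually_nhds (eventually_lt_of_continuous
      (kr (evalP q₀.1 y0)) hcP hP0c))
      hx1c
    refine exists_core_of_cycle hb h₀ (x0 := x0) (x1 := x1) hx1' hx01 hx0c (by linarith) ?_
    filter_upwards [eventually_lt_of_continuous (k x0) (continuous_nd_snd 1) hx0c,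
      eventually_lt_of_continuous (continuous_nd_snd 1) (k y0) hy0c,
      eventually_lt_of_continuous (k y1) (continuous_nd_snd 2) hy12,
      eventually_lt_of_continuous (continuous_nd_snd 2).evalP_fst (k x1) (y := q₀)
        (by simp only [hP2]; linarith),
      eventually_lt_of_continuous (k x1).evalP_fst (continuous_nd_snd b) (y := q₀) hx1P,
      eventually_lt_of_continuous (continuous_nd_snd b) (k y1).evalP_fst hy1b,
      eventually_lt_of_continuous (k y1) (k y1).evalP_fst.evalP_fst (y := q₀) hy1F,
      eventually_lt_of_continuous (k y0).evalP_fst.evalP_fst (k y0) (y := q₀) hy0F,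
      eventually_lt_of_continuous (k y0).evalP_fst (k x0).evalP_fst (y := q₀) hx0,
      eventually_lt_of_continuous (k x0) (continuous_nd_snd 1).evalP_fst.evalP_fst (y := q₀)
        (by simp only [← hc, hFc]; exact hx0c),
      eventually_lt_of_continuous (continuous_nd_snd 1).evalP_fst (k 1) (y := q₀)
        (by simp only [← hc, hPc]; exact hα)] with q g1 g2 g3 g4 g5 g6 g7 g8 g9 g10 g11 v η h
    have hQ : Continuous (evalP q.1) := continuous_evalP _
    have hqa := h.strictAntiOn_second hb
    obtain ⟨p, hp, hp0⟩ := intermediate_value_Ioo hy01.le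
      ((hQ.comp hQ).sub continuous_id).continuousOn
      (show (0 : ℝ) ∈ Ioo (evalP q.1 (evalP q.1 y0) - y0) (evalP q.1 (evalP q.1 y1) - y1) from
        ⟨by linarith, by linarith⟩)
    replace hp0 : evalP q.1 (evalP q.1 p) - p = 0 := hp0
    have hr1 : evalP q.1 y1 < evalP q.1 p :=
      hqa ⟨by linarith [hp.1], by linarith [hp.2]⟩ ⟨by linarith, g3.le⟩ hp.2
    have hr0 : evalP q.1 p < evalP q.1 y0 :=
      hqa ⟨g2.le, by linarith⟩ ⟨by linarith [hp.1], by linarith [hp.2]⟩ hp.1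
    obtain ⟨p', hp', hp'0⟩ := intermediate_value_Ioo hx01.le hQ.continuousOn
      (show evalP q.1 p ∈ Ioo (evalP q.1 x1) (evalP q.1 x0) from ⟨by linarith, by linarith⟩)
    rw [h.sol.evalP_nd_one] at g10 g11
    rw [h.sol.evalP_nd_two (by omega)] at g4
    exact ⟨p', p, evalP q.1 p, ⟨by linarith [hp'.1], by linarith [hp'.2], by linarith [hp.1],
      by linarith [hp.2], hp'0, rfl, by linarith, g11,
      Or.inr ⟨hbo, by linarith, by linarith [hp'.2]⟩⟩, hp'.1, hp'.2⟩

section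

variable {b : ℕ} {θ v η : ℝ} {q : (Fin (b + 2) → ℝ) × (Fin (b + 2) → ℝ)}

lemma Adm.deriv_eq_zero_iff (h : Adm b v η q) (hθ : θ = 1 ∨ θ = -1) (t : ℝ) :
    deriv (evalP (θ • q.1)) t = 0 ↔ ∃ i : Fin b, q.2 i.succ.castSucc = t := by
  have hθ0 : θ ≠ 0 := by rcases hθ with rfl | rfl <;> norm_num
  rw [(hasDerivAt_evalP _ t).deriv, derivP_smul, mul_eq_zero, or_iff_right hθ0]
  exact h.sol.derivP_eq_zero_iff h.alternating t

lemma Adm.node_mem_Ioo (h : Adm b v η q) (i : Fin b) :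
    q.2 i.succ.castSucc ∈ Ioo (-1 : ℝ) 1 := by
  rw [← h.sol.first, ← h.sol.last]
  refine ⟨h.sol.mono ?_, h.sol.mono (Fin.castSucc_lt_last _)⟩
  rw [Fin.lt_def]
  simp

lemma Adm.strictMono_nodes (h : Adm b v η q) : StrictMono fun i : Fin b => q.2 i.succ.castSucc :=
  fun _ _ hij => h.sol.mono (Fin.castSucc_lt_castSucc_iff.2 (Fin.succ_lt_succ_iff.2 hij))

lemma Adm.mem_polyFam (h : Adm b v η q) (hb : 2 ≤ b) (hθ : θ = 1 ∨ θ = -1) :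
    θ • q.1 ∈ PolyFam b (-θ) := by
  have hθ0 : θ ≠ 0 := by rcases hθ with rfl | rfl <;> norm_num
  refine ⟨mul_ne_zero hθ0 (h.sol.last_ne_zero h.alternating), (h.nearCheb hb hθ).maps, ?_, ?_,
    _, h.strictMono_nodes, h.node_mem_Ioo, h.deriv_eq_zero_iff hθ⟩
  · rw [evalP_smul, h.sol.evalP_neg_one, mul_neg_one]
  · rw [evalP_smul, h.sol.evalP_one hb]
    rcases hθ with rfl | rfl <;> rcases neg_one_pow_eq_or ℝ b with h | h <;> simp [h]

lemma Adm.hasCritValues (h : Adm b v η q) (hb : 0 < b) (hθ : θ = 1 ∨ θ = -1) :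
    HasCritValues (θ • q.1) (Function.update (fun i : Fin b => θ * yvec b 0 η i.succ.castSucc)
      ⟨0, hb⟩ (θ * v)) := by
  refine ⟨_, h.strictMono_nodes, h.node_mem_Ioo, h.deriv_eq_zero_iff hθ, fun i => ?_⟩
  rw [evalP_smul, h.sol.val]
  rcases eq_or_ne i ⟨0, hb⟩ with rfl | hi
  · rw [Function.update_self]
    simp [yvec]
  · rw [Function.update_of_ne hi]
    have : (i : ℕ) ≠ 0 := fun h => hi (Fin.ext h)
    simp [yvec, this]

end

section

variable {b : ℕ}

lemma CyclePlateau.continuousOn_defect (hb : 2 ≤ b) :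
    ContinuousOn (CyclePlateau.defect b) (Icc b (b + 1)) := by
  have hb' : (2 : ℝ) ≤ b := by exact_mod_cast hb
  unfold CyclePlateau.defect
  have h0 : ∀ μ ∈ Icc (b : ℝ) (b + 1), μ ≠ 0 := fun μ hμ => by linarith [hμ.1]
  split_ifs
  · fun_prop
  · fun_prop (disch := assumption)

lemma CyclePlateau.defect_pos (hb : 2 ≤ b) : 0 < CyclePlateau.defect b b := by
  have hb' : (2 : ℝ) ≤ b := by exact_mod_cast hb
  unfold CyclePlateau.defect
  split_ifs
  · linarith
  · have : 0 < ((b : ℝ) - 1) / b := by apply div_pos <;> linarith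
    linarith

lemma CyclePlateau.defect_neg (hb : 2 ≤ b) : CyclePlateau.defect b (b + 1) < 0 := by
  have hb' : (2 : ℝ) ≤ b := by exact_mod_cast hb
  unfold CyclePlateau.defect
  split_ifs
  · linarith
  · have : ((b : ℝ) - 1) / (b + 1) < 1 := by rw [div_lt_one] <;> linarith
    linarith

/-- Both entropy inequalities hold inside one of the two families of near-Chebyshev maps. -/
lemma exists_htop_lt (hb : 2 ≤ b) {θ : ℝ} (hθ : θ = 1 ∨ θ = -1) :
    ∃ α β η qg qh qe, β < α ∧ α < 1 ∧ Adm b α η qg ∧ Adm b β η qh ∧ Adm b 1 η qe ∧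
      htop (evalP (θ • qg.1)) < htop (evalP (θ • qh.1)) ∧
      htop (evalP (θ • qg.1)) < htop (evalP (θ • qe.1)) := by
  have hb' : (2 : ℝ) ≤ b := by exact_mod_cast hb
  obtain ⟨A, X, F⟩ := exists_solFamily b
  have adm : ∀ α ∈ Ioo (-1 : ℝ) 1, Adm b α 0 (A α, X α) := fun α hα =>
    ⟨F.isSol α hα.1, le_rfl, by linarith [hα.1], hα.2.le⟩
  rcases hθ with rfl | rfl
  · obtain ⟨α, hα, hbα, hper⟩ := F.exists_periodic hb
    obtain ⟨w₀, w₁, D, δ, K⟩ := exists_core_cycle hb (adm α hα) hα.2 hbα hper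
    obtain ⟨β, η, qg, qh, qe, hβ, h⟩ := K.exists_lt F (one_endCycle b) hb
      (CyclePlateau.continuousOn_defect hb) (CyclePlateau.defect_pos hb)
      (CyclePlateau.defect_neg hb) hα
    exact ⟨α, β, η, qg, qh, qe, hβ, hα.2, h⟩
  · obtain ⟨α, hα, hfix⟩ := F.exists_fixed hb
    obtain ⟨w₀, w₁, D, δ, K⟩ := exists_core_fixed hb (adm α hα) hfix
    obtain ⟨β, η, qg, qh, qe, hβ, h⟩ := K.exists_lt F (neg_one_endCycle hb) hb
      (by
        have h0 : ∀ μ ∈ Icc (b : ℝ) (b + 1), μ ≠ 0 := fun μ hμ => by linarith [hμ.1]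
        fun_prop (disch := assumption))
      (by
        have : 0 < ((b : ℝ) - 1) / b := by apply div_pos <;> linarith
        linarith)
      (by
        have : ((b : ℝ) - 1) / (b + 1) < 1 := by rw [div_lt_one] <;> linarith
        linarith) hα
    exact ⟨α, β, η, qg, qh, qe, hβ, hα.2, h⟩

end

/-- Non-monotonicity of entropy with respect to the first critical value:
for every `b ≥ 2` and `ε ∈ {-1,1}` there are fixed values `v_2, …, v_b` and three maps
`f, g, k ∈ P^b_ε` whose ordered critical values agree except in the first coordinate,
with first critical values `vf < vg < vk`, such that `h_top(g) < h_top(f)` and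
`h_top(g) < h_top(k)`; in particular `v_1 ↦ h_top` is not monotone. -/
theorem entropy_not_monotone_in_first_critical_value (b : ℕ) (hb : 2 ≤ b)
    (ε : ℝ) (hε : ε = -1 ∨ ε = 1) :
    ∃ (w : Fin b → ℝ) (f g k : Fin (b + 2) → ℝ) (vf vg vk : ℝ),
      f ∈ PolyFam b ε ∧ g ∈ PolyFam b ε ∧ k ∈ PolyFam b ε ∧
      HasCritValues f (Function.update w ⟨0, by omega⟩ vf) ∧
      HasCritValues g (Function.update w ⟨0, by omega⟩ vg) ∧
      HasCritValues k (Function.update w ⟨0, by omega⟩ vk) ∧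
      vf < vg ∧ vg < vk ∧
      htop (evalP g) < htop (evalP f) ∧ htop (evalP g) < htop (evalP k) := by
  obtain ⟨θ, hθ, rfl⟩ : ∃ θ : ℝ, (θ = 1 ∨ θ = -1) ∧ -θ = ε := by
    rcases hε with rfl | rfl
    exacts [⟨1, Or.inl rfl, rfl⟩, ⟨-1, Or.inr rfl, neg_neg 1⟩]
  obtain ⟨α, β, η, qg, qh, qe, hβ, hα, hg, hh, he, hgh, hge⟩ := exists_htop_lt hb hθ
  have key := fun {v : ℝ} {q} (h : Adm b v η q) =>
    And.intro (h.mem_polyFam hb hθ) (h.hasCritValues (by omega) hθ)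
  rcases hθ with rfl | rfl
  · exact ⟨_, _, _, _, _, _, _, (key hh).1, (key hg).1, (key he).1, (key hh).2, (key hg).2,
      (key he).2, by linarith, by linarith, hgh, hge⟩
  · exact ⟨_, _, _, _, _, _, _, (key he).1, (key hg).1, (key hh).1, (key he).2, (key hg).2,
      (key hh).2, by linarith, by linarith, hge, hgh⟩
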